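/- arXiv:0910.0642 — 2 statements merged into one kernel-verified Lean document; each statement's English description precedes it below -/
import Mathlib

section
/- Let T be a tensor triangulated category with a canonical R-action. If R stratifies T, i.e. for each p ∈ Spec R the subcategory Γ_p T is either zero or has no nonzero proper tensor ideal localizing subcategories, then for any objects X, Y of T there is an equality supp_R(X ⊗ Y) = supp_R X ∩ supp_R Y. -/
open CategoryTheory CategoryTheory.Limits CategoryTheory.Pretriangulated

universe w v u u'

namespace BIK

section RingDefs

variable {R : Type u} [Ring R] (𝒜 : ℤ → AddSubgroup R) [GradedRing 𝒜]

/-- `R` is graded-commutative: `a * b = (-1)^{|a||b|} b * a` for homogeneous `a`, `b`. -/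
def IsGradedComm : Prop :=
  ∀ (i j : ℤ) (a b : R), a ∈ 𝒜 i → b ∈ 𝒜 j →
    a * b = ((-1 : ℤ) ^ (i * j).natAbs) • (b * a)

/-- A homogeneous ideal is prime if it is proper and for homogeneous elements `a`, `b`,
`a * b ∈ P` implies `a ∈ P` or `b ∈ P`. -/
structure IsHomPrime (P : HomogeneousIdeal 𝒜) : Prop where
  ne_top : P.toIdeal ≠ ⊤
  mem_or_mem : ∀ {i j : ℤ} {a b : R}, a ∈ 𝒜 i → b ∈ 𝒜 j →
    a * b ∈ P.toIdeal → a ∈ P.toIdeal ∨ b ∈ P.toIdeal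

/-- `Spec R`: the set of homogeneous prime ideals of the graded ring `R`. -/
def SpecR : Type u := {P : HomogeneousIdeal 𝒜 // IsHomPrime 𝒜 P}

variable {𝒜}

/-- `V(𝔞)`, the set of homogeneous primes containing the ideal `𝔞`. -/
def specV (𝔞 : Ideal R) : Set (SpecR 𝒜) := {p | 𝔞 ≤ p.1.toIdeal}

/-- A subset of `Spec R` is specialization closed if with any point it contains all larger
primes. -/
def SpecClosed (V : Set (SpecR 𝒜)) : Prop :=
  ∀ p q : SpecR 𝒜, p ∈ V → p.1.toIdeal ≤ q.1.toIdeal → q ∈ V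

/-- `Z(p) = { q | q ⊄ p }`. -/
def Zset (p : SpecR 𝒜) : Set (SpecR 𝒜) := {q | ¬ q.1.toIdeal ≤ p.1.toIdeal}

/-- `V(p) = { q | q ⊇ p }`. -/
def Vp (p : SpecR 𝒜) : Set (SpecR 𝒜) := {q | p.1.toIdeal ≤ q.1.toIdeal}

/-- The specialization closure of a subset of `Spec R`. -/
def specCl (U : Set (SpecR 𝒜)) : Set (SpecR 𝒜) := {p | ∃ q ∈ U, q.1.toIdeal ≤ p.1.toIdeal}

/-- The subset `U ⊆ Spec R` has finite dimension: the lengths of strict chains of primes in `U`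
are bounded. -/
def FiniteDim (U : Set (SpecR 𝒜)) : Prop :=
  ∃ n : ℕ, ∀ (m : ℕ) (c : Fin (m + 1) → SpecR 𝒜), (∀ i, c i ∈ U) →
    (StrictMono fun i => (c i).1.toIdeal) → m ≤ n

end RingDefs

section CatDefs

variable (T : Type u') [Category.{v} T] [HasZeroObject T] [Preadditive T] [HasShift T ℤ]
  [∀ n : ℤ, (CategoryTheory.shiftFunctor T n).Additive] [Pretriangulated T]
  [HasCoproducts.{v} T]

/-- The canonical map `⨁ⱼ Hom(C, fⱼ) → Hom(C, ∐ f)`. -/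
noncomputable def sigmaHom (C : T) {J : Type v} (f : J → T) :
    (DirectSum J fun j => (C ⟶ f j)) →+ (C ⟶ ∐ f) :=
  letI := Classical.decEq J
  DirectSum.toAddMonoid fun j =>
    AddMonoidHom.mk' (fun g => g ≫ Sigma.ι f j) (fun g h => by simp)

/-- An object `C` is compact if `Hom(C, -)` commutes with arbitrary coproducts. -/
def IsCompactObj (C : T) : Prop :=
  ∀ (J : Type v) (f : J → T), Function.Bijective (sigmaHom T C f)

/-- A localizing subcategory: a (strictly full) triangulated subcategory closed under
arbitrary coproducts. -/
structure IsLocalizing (S : Set T) : Prop where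
  zero_mem : ∀ X : T, Limits.IsZero X → X ∈ S
  iso_mem : ∀ {X Y : T}, (X ≅ Y) → X ∈ S → Y ∈ S
  shift_mem : ∀ X ∈ S, ∀ n : ℤ, X⟦n⟧ ∈ S
  ext_mem : ∀ Tr ∈ distTriang T, Tr.obj₁ ∈ S → Tr.obj₂ ∈ S → Tr.obj₃ ∈ S
  coprod_mem : ∀ (J : Type v) (f : J → T), (∀ j, f j ∈ S) → (∐ f) ∈ S

/-- The localizing subcategory generated by a class of objects. -/
def Loc (A : Set T) : Set T := ⋂₀ {S | IsLocalizing T S ∧ A ⊆ S}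

/-- A thick subcategory: a (strictly full) triangulated subcategory closed under
direct summands (i.e. retracts). -/
structure IsThick (S : Set T) : Prop where
  zero_mem : ∀ X : T, Limits.IsZero X → X ∈ S
  iso_mem : ∀ {X Y : T}, (X ≅ Y) → X ∈ S → Y ∈ S
  shift_mem : ∀ X ∈ S, ∀ n : ℤ, X⟦n⟧ ∈ S
  ext_mem : ∀ Tr ∈ distTriang T, Tr.obj₁ ∈ S → Tr.obj₂ ∈ S → Tr.obj₃ ∈ S
  retract_mem : ∀ X Y : T, Y ∈ S → ∀ (i : X ⟶ Y) (p : Y ⟶ X), i ≫ p = 𝟙 X → X ∈ S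

/-- The thick subcategory generated by a class of objects. -/
def ThickSub (A : Set T) : Set T := ⋂₀ {S | IsThick T S ∧ A ⊆ S}

/-- `T` is compactly generated: it is generated, as a localizing subcategory,
by a set of compact objects. -/
def CompactlyGen : Prop :=
  ∃ (ι : Type v) (g : ι → T), (∀ i, IsCompactObj T (g i)) ∧ Loc T (Set.range g) = Set.univ

end CatDefs

section Action

variable {R : Type u} [Ring R] (𝒜 : ℤ → AddSubgroup R) [GradedRing 𝒜]
variable (T : Type u') [Category.{v} T] [HasZeroObject T] [Preadditive T] [HasShift T ℤ]
  [∀ n : ℤ, (CategoryTheory.shiftFunctor T n).Additive] [Pretriangulated T]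
  [HasCoproducts.{v} T]

/-- An action of the graded ring `R` on the triangulated category `T`, i.e. a homomorphism of
graded rings from `R` to the graded center of `T`: each homogeneous `a ∈ R` of degree `i`
determines a natural transformation `Id → Σⁱ` commuting with the shift up to the sign
`(-1)^i`. -/
structure CenterAction where
  act : ∀ (i : ℤ) (a : R), a ∈ 𝒜 i → ∀ X : T, X ⟶ X⟦i⟧
  act_add : ∀ (i : ℤ) (a b : R) (ha : a ∈ 𝒜 i) (hb : b ∈ 𝒜 i) (X : T),
    act i (a + b) (add_mem ha hb) X = act i a ha X + act i b hb X
  act_one : ∀ X : T, act 0 1 (SetLike.one_mem_graded 𝒜) X = (shiftFunctorZero T ℤ).inv.app X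
  act_mul : ∀ (i j : ℤ) (a b : R) (ha : a ∈ 𝒜 i) (hb : b ∈ 𝒜 j) (X : T),
    act (i + j) (a * b) (SetLike.mul_mem_graded ha hb) X
      = act j b hb X ≫ act i a ha (X⟦j⟧) ≫ (shiftFunctorAdd' T j i (i + j) (by ring)).inv.app X
  act_natural : ∀ (i : ℤ) (a : R) (ha : a ∈ 𝒜 i) {X Y : T} (f : X ⟶ Y),
    f ≫ act i a ha Y = act i a ha X ≫ f⟦i⟧'
  act_shift : ∀ (i : ℤ) (a : R) (ha : a ∈ 𝒜 i) (X : T) (n : ℤ),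
    act i a ha (X⟦n⟧)
      = ((-1 : ℤ) ^ (i * n).natAbs) • ((act i a ha X)⟦n⟧' ≫ (shiftComm X i n).hom)

variable {𝒜 T}

/-- The action of a homogeneous element of `R` on the graded abelian group
`Hom*(X, Y) = ⊕ₙ Hom(X, Y⟦n⟧)`. -/
def CenterAction.hsmul (A : CenterAction 𝒜 T) {i : ℤ} {a : R} (ha : a ∈ 𝒜 i) {X Y : T} {n : ℤ}
    (f : X ⟶ Y⟦n⟧) : X ⟶ Y⟦n + i⟧ :=
  f ≫ A.act i a ha (Y⟦n⟧) ≫ (shiftFunctorAdd' T n i (n + i) rfl).inv.app Y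

/-- The homogeneous localization of the graded `R`-module `Hom*(X, Y)` at the homogeneous
prime `p` vanishes: every element is annihilated by some homogeneous `s ∉ p`. -/
def LocVanishes (A : CenterAction 𝒜 T) (p : SpecR 𝒜) (X Y : T) : Prop :=
  ∀ (n : ℤ) (f : X ⟶ Y⟦n⟧), ∃ (i : ℤ) (s : R) (hs : s ∈ 𝒜 i),
    s ∉ p.1.toIdeal ∧ A.hsmul hs f = 0

variable (T) in
/-- The subcategory `T_V` of `V`-torsion objects, for `V ⊆ Spec R` specialization closed. -/
def TVset (A : CenterAction 𝒜 T) (V : Set (SpecR 𝒜)) : Set T :=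
  {X | ∀ C : T, IsCompactObj T C → ∀ p : SpecR 𝒜, p ∉ V → LocVanishes A p C X}

/-- The local cohomology and localization functors `Γ_V`, `L_V` attached to the `R`-action on
`T`: for each specialization closed `V ⊆ Spec R`, `L_V` is the (essentially unique) localization
functor with `Ker L_V = T_V`, and `Γ_V` is defined by the exact localization triangle
`Γ_V X → X → L_V X → `. -/
structure BIKData (A : CenterAction 𝒜 T) where
  Γ : Set (SpecR 𝒜) → T ⥤ T
  Lf : Set (SpecR 𝒜) → T ⥤ T
  γ : ∀ V : Set (SpecR 𝒜), Γ V ⟶ 𝟭 T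
  η : ∀ V : Set (SpecR 𝒜), 𝟭 T ⟶ Lf V
  δ : ∀ (V : Set (SpecR 𝒜)) (X : T), (Lf V).obj X ⟶ ((Γ V).obj X)⟦(1 : ℤ)⟧
  tri : ∀ V : Set (SpecR 𝒜), SpecClosed V → ∀ X : T,
    Triangle.mk ((γ V).app X) ((η V).app X) (δ V X) ∈ distTriang T
  Lη_iso : ∀ V : Set (SpecR 𝒜), SpecClosed V → ∀ X : T,
    IsIso ((Lf V).map ((η V).app X))
  Lη_eq : ∀ V : Set (SpecR 𝒜), SpecClosed V → ∀ X : T,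
    (Lf V).map ((η V).app X) = (η V).app ((Lf V).obj X)
  kerL : ∀ V : Set (SpecR 𝒜), SpecClosed V → ∀ X : T,
    Limits.IsZero ((Lf V).obj X) ↔ X ∈ TVset T A V

namespace BIKData

variable {A : CenterAction 𝒜 T} (B : BIKData A)

/-- `X_p = L_{Z(p)} X`. -/
def locP (p : SpecR 𝒜) (X : T) : T := (B.Lf (Zset p)).obj X

/-- `Γ_p = Γ_{V(p)} ∘ L_{Z(p)}`. -/
def ΓP (p : SpecR 𝒜) : T ⥤ T := B.Lf (Zset p) ⋙ B.Γ (Vp p)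

/-- `supp_R X = { p ∈ Spec R | Γ_p X ≠ 0 }`. -/
def suppObj (X : T) : Set (SpecR 𝒜) := {p | ¬ Limits.IsZero ((B.ΓP p).obj X)}

/-- `supp_R T = ⋃_X supp_R X`. -/
def suppT : Set (SpecR 𝒜) := {p | ∃ X : T, p ∈ B.suppObj X}

/-- The support of a class of objects. -/
def suppSet (S : Set T) : Set (SpecR 𝒜) := ⋃ X ∈ S, B.suppObj X

/-- `supp_R⁻¹ U`, the class of objects supported in `U`. -/
def invSupp (U : Set (SpecR 𝒜)) : Set T := {X | B.suppObj X ⊆ U}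

/-- `Γ_p T`, the essential image of `Γ_p`. -/
def ΓPImage (p : SpecR 𝒜) : Set T := {X | ∃ Y : T, Nonempty (X ≅ (B.ΓP p).obj Y)}

/-- The local-global principle: each object is built from its local cohomology objects. -/
def LocalGlobal : Prop :=
  ∀ X : T, Loc T {X} = Loc T {Y | ∃ p : SpecR 𝒜, Y = (B.ΓP p).obj X}

end BIKData

/-- A localizing subcategory is minimal if it is nonzero and has no proper nonzero localizing
subcategories. -/
def IsMinimalLoc (S : Set T) : Prop :=
  IsLocalizing T S ∧ (∃ X ∈ S, ¬ Limits.IsZero X) ∧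
    ∀ S' : Set T, IsLocalizing T S' → S' ⊆ S →
      (∀ X ∈ S', Limits.IsZero X) ∨ S' = S

/-- `T` is stratified by the `R`-action: the local-global principle holds and each `Γ_p T`
is either zero or a minimal localizing subcategory. -/
def Stratified {A : CenterAction 𝒜 T} (B : BIKData A) : Prop :=
  B.LocalGlobal ∧
    ∀ p : SpecR 𝒜, (∀ X ∈ B.ΓPImage p, Limits.IsZero X) ∨ IsMinimalLoc (B.ΓPImage p)

/-- A graded `R`-submodule of `Hom*(X,Y)`. -/
structure HomSub (A : CenterAction 𝒜 T) (X Y : T) where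
  car : ∀ n : ℤ, AddSubgroup (X ⟶ Y⟦n⟧)
  hsmul_mem : ∀ (i : ℤ) (a : R) (ha : a ∈ 𝒜 i) (n : ℤ) (f : X ⟶ Y⟦n⟧),
    f ∈ car n → A.hsmul ha f ∈ car (n + i)

/-- The graded `R`-module `Hom*(X,Y)` is finitely generated. -/
def FGHom (A : CenterAction 𝒜 T) (X Y : T) : Prop :=
  ∃ F : Finset ((n : ℤ) × (X ⟶ Y⟦n⟧)),
    ∀ S : HomSub A X Y, (∀ g ∈ F, g.2 ∈ S.car g.1) → ∀ (n : ℤ) (f : X ⟶ Y⟦n⟧), f ∈ S.car n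

/-- The `R`-linear category `T` is noetherian: `End*(C)` is a finitely generated `R`-module
for each compact object `C`. -/
def NoetherianT (A : CenterAction 𝒜 T) : Prop :=
  ∀ C : T, IsCompactObj T C → FGHom A C C

end Action

section Extra

variable {R : Type u} [Ring R] {𝒜 : ℤ → AddSubgroup R} [GradedRing 𝒜]
variable {T : Type u'} [Category.{v} T] [HasZeroObject T] [Preadditive T] [HasShift T ℤ]
  [∀ n : ℤ, (CategoryTheory.shiftFunctor T n).Additive] [Pretriangulated T]
  [HasCoproducts.{v} T]

/-- A subset of `Spec R` closed under generalization. -/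
def GenClosed (U : Set (SpecR 𝒜)) : Prop :=
  ∀ p q : SpecR 𝒜, q ∈ U → p.1.toIdeal ≤ q.1.toIdeal → p ∈ U

/-- `Supp_R Hom*(X,Y) = { p | Hom*(X,Y)_p ≠ 0 }`, the big support of the graded `R`-module
`Hom*(X,Y)`. -/
def bigSuppHom (A : CenterAction 𝒜 T) (X Y : T) : Set (SpecR 𝒜) :=
  {p | ¬ LocVanishes A p X Y}

/-- `Supp_R X = ⋃_{C compact} Supp_R Hom*(C,X)`, the big support of an object. -/
def bigSuppObj (A : CenterAction 𝒜 T) (X : T) : Set (SpecR 𝒜) :=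
  {p | ∃ C : T, IsCompactObj T C ∧ ¬ LocVanishes A p C X}

/-- The graded `R`-module `Hom*(X,Y)` is `p`-local: every homogeneous element outside of `p`
acts invertibly on it. -/
def PLocalHom (A : CenterAction 𝒜 T) (p : SpecR 𝒜) (X Y : T) : Prop :=
  ∀ (i : ℤ) (s : R) (hs : s ∈ 𝒜 i), s ∉ p.1.toIdeal →
    ∀ n : ℤ, Function.Bijective fun f : X ⟶ Y⟦n⟧ => A.hsmul hs f

/-- `K` is a Koszul object `X ⫽ a` of the homogeneous element `a` of degree `i` on `X`,
i.e. there is an exact triangle `X → Σ^i X → K → `, the first map being given by the action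
of `a`. -/
def IsKoszul (A : CenterAction 𝒜 T) {i : ℤ} (a : R) (ha : a ∈ 𝒜 i) (X K : T) : Prop :=
  ∃ (w : X⟦i⟧ ⟶ K) (d : K ⟶ X⟦(1 : ℤ)⟧),
    Triangle.mk (A.act i a ha X) w d ∈ distTriang T

/-- Iterated Koszul object on a finite sequence of homogeneous elements. -/
inductive IsKoszulSeq (A : CenterAction 𝒜 T) :
    T → List ((i : ℤ) × {a : R // a ∈ 𝒜 i}) → T → Prop
  | nil (X : T) : IsKoszulSeq A X [] X
  | cons (X Y K : T) (i : ℤ) (a : {a : R // a ∈ 𝒜 i})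
      (l : List ((i : ℤ) × {a : R // a ∈ 𝒜 i})) :
      IsKoszulSeq A X l Y → IsKoszul A a.1 a.2 Y K → IsKoszulSeq A X (⟨i, a⟩ :: l) K

/-- `K` is a Koszul object `X ⫽ 𝔞` of the homogeneous ideal `𝔞` on `X`, obtained by iterating
the Koszul construction on some finite sequence of homogeneous generators of `𝔞`. -/
def IsKoszulIdeal (A : CenterAction 𝒜 T) (𝔞 : HomogeneousIdeal 𝒜) (X K : T) : Prop :=
  ∃ l : List ((i : ℤ) × {a : R // a ∈ 𝒜 i}),
    Ideal.span {x : R | ∃ s ∈ l, (s.2 : R) = x} = 𝔞.toIdeal ∧ IsKoszulSeq A X l K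

end Extra

section Hocolim

variable {T : Type u'} [Category.{v} T] [Preadditive T] [HasCoproductsOfShape ℕ T]

/-- The map `⊕ₙ Xₙ → ⊕ₙ Xₙ` given by `id - fₙ`, whose cone is the homotopy colimit. -/
noncomputable def hoColimMap {Xs : ℕ → T} (fs : ∀ n, Xs n ⟶ Xs (n + 1)) : (∐ Xs) ⟶ (∐ Xs) :=
  Sigma.desc fun n => Sigma.ι Xs n - fs n ≫ Sigma.ι Xs (n + 1)

variable [HasZeroObject T] [HasShift T ℤ]
  [∀ n : ℤ, (CategoryTheory.shiftFunctor T n).Additive] [Pretriangulated T]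

/-- A homotopy colimit of the sequence `X₀ → X₁ → X₂ → ⋯`, defined by an exact triangle
`⊕ Xₙ → ⊕ Xₙ → hocolim Xₙ → `. -/
structure HocolimData (Xs : ℕ → T) (fs : ∀ n, Xs n ⟶ Xs (n + 1)) where
  pt : T
  ι : (∐ Xs) ⟶ pt
  d : pt ⟶ (∐ Xs)⟦(1 : ℤ)⟧
  tri : Triangle.mk (hoColimMap fs) ι d ∈ distTriang T

end Hocolim

end BIK

set_option linter.unusedSectionVars false

namespace BIKaux

open scoped ZeroObject

section Tri

variable {T : Type u'} [Category.{v} T] [HasZeroObject T] [Preadditive T] [HasShift T ℤ]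
  [∀ n : ℤ, (CategoryTheory.shiftFunctor T n).Additive] [Pretriangulated T]

lemma yo2 {X Y Z W : T} {f : X ⟶ Y} {g : Y ⟶ Z} {h : Z ⟶ X⟦(1 : ℤ)⟧}
    (hT : Triangle.mk f g h ∈ distTriang T) (φ : Y ⟶ W) (hf : f ≫ φ = 0) :
    ∃ ψ : Z ⟶ W, φ = g ≫ ψ :=
  Triangle.yoneda_exact₂ _ hT φ hf

lemma yo3 {X Y Z W : T} {f : X ⟶ Y} {g : Y ⟶ Z} {h : Z ⟶ X⟦(1 : ℤ)⟧}
    (hT : Triangle.mk f g h ∈ distTriang T) (φ : Z ⟶ W) (hf : g ≫ φ = 0) :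
    ∃ ψ : X⟦(1 : ℤ)⟧ ⟶ W, φ = h ≫ ψ :=
  Triangle.yoneda_exact₃ _ hT φ hf

lemma co2 {X Y Z W : T} {f : X ⟶ Y} {g : Y ⟶ Z} {h : Z ⟶ X⟦(1 : ℤ)⟧}
    (hT : Triangle.mk f g h ∈ distTriang T) (φ : W ⟶ Y) (hf : φ ≫ g = 0) :
    ∃ ψ : W ⟶ X, φ = ψ ≫ f :=
  Triangle.coyoneda_exact₂ _ hT φ hf

lemma co3 {X Y Z W : T} {f : X ⟶ Y} {g : Y ⟶ Z} {h : Z ⟶ X⟦(1 : ℤ)⟧}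
    (hT : Triangle.mk f g h ∈ distTriang T) (φ : W ⟶ Z) (hf : φ ≫ h = 0) :
    ∃ ψ : W ⟶ Y, φ = ψ ≫ g :=
  Triangle.coyoneda_exact₃ _ hT φ hf

lemma z12 {X Y Z : T} {f : X ⟶ Y} {g : Y ⟶ Z} {h : Z ⟶ X⟦(1 : ℤ)⟧}
    (hT : Triangle.mk f g h ∈ distTriang T) : f ≫ g = 0 :=
  comp_distTriang_mor_zero₁₂ _ hT

lemma z23 {X Y Z : T} {f : X ⟶ Y} {g : Y ⟶ Z} {h : Z ⟶ X⟦(1 : ℤ)⟧}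
    (hT : Triangle.mk f g h ∈ distTriang T) : g ≫ h = 0 :=
  comp_distTriang_mor_zero₂₃ _ hT

lemma z31 {X Y Z : T} {f : X ⟶ Y} {g : Y ⟶ Z} {h : Z ⟶ X⟦(1 : ℤ)⟧}
    (hT : Triangle.mk f g h ∈ distTriang T) : h ≫ f⟦(1 : ℤ)⟧' = 0 :=
  comp_distTriang_mor_zero₃₁ _ hT

lemma rotT {X Y Z : T} {f : X ⟶ Y} {g : Y ⟶ Z} {h : Z ⟶ X⟦(1 : ℤ)⟧}
    (hT : Triangle.mk f g h ∈ distTriang T) :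
    Triangle.mk g h (-f⟦(1 : ℤ)⟧') ∈ distTriang T :=
  rot_of_distTriang _ hT

lemma fill2 {X Y Z X' Y' Z' : T} {f : X ⟶ Y} {g : Y ⟶ Z} {h : Z ⟶ X⟦(1 : ℤ)⟧}
    {f' : X' ⟶ Y'} {g' : Y' ⟶ Z'} {h' : Z' ⟶ X'⟦(1 : ℤ)⟧}
    (hT : Triangle.mk f g h ∈ distTriang T) (hT' : Triangle.mk f' g' h' ∈ distTriang T)
    (a : X ⟶ X') (c : Z ⟶ Z') (comm : h ≫ a⟦(1 : ℤ)⟧' = c ≫ h') :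
    ∃ b : Y ⟶ Y', f ≫ b = a ≫ f' ∧ g ≫ c = b ≫ g' :=
  complete_distinguished_triangle_morphism₂ _ _ hT hT' a c comm

lemma fill3 {X Y Z X' Y' Z' : T} {f : X ⟶ Y} {g : Y ⟶ Z} {h : Z ⟶ X⟦(1 : ℤ)⟧}
    {f' : X' ⟶ Y'} {g' : Y' ⟶ Z'} {h' : Z' ⟶ X'⟦(1 : ℤ)⟧}
    (hT : Triangle.mk f g h ∈ distTriang T) (hT' : Triangle.mk f' g' h' ∈ distTriang T)
    (a : X ⟶ X') (b : Y ⟶ Y') (comm : f ≫ b = a ≫ f') :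
    ∃ c : Z ⟶ Z', g ≫ c = b ≫ g' ∧ h ≫ a⟦(1 : ℤ)⟧' = c ≫ h' :=
  complete_distinguished_triangle_morphism _ _ hT hT' a b comm

lemma sh_zero {X Y : T} {f : X ⟶ Y} (n : ℤ) (h : f⟦n⟧' = 0) : f = 0 :=
  (shiftFunctor T n).map_injective (by rw [h]; simp)

/-- extension along the first map of a triangle -/
lemma yo1 {X Y Z W : T} {f : X ⟶ Y} {g : Y ⟶ Z} {h : Z ⟶ X⟦(1 : ℤ)⟧}
    (hT : Triangle.mk f g h ∈ distTriang T) (φ : X ⟶ W) (hf : h ≫ φ⟦(1 : ℤ)⟧' = 0) :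
    ∃ ψ : Y ⟶ W, φ = f ≫ ψ := by
  obtain ⟨ψ, hψ⟩ := yo3 (rotT hT) (φ⟦(1 : ℤ)⟧') hf
  obtain ⟨ψ', rfl⟩ := (shiftFunctor T (1 : ℤ)).map_surjective ψ
  refine ⟨-ψ', (shiftFunctor T (1 : ℤ)).map_injective ?_⟩
  rw [hψ]
  simp

lemma co1 {X Y Z W : T} {f : X ⟶ Y} {g : Y ⟶ Z} {h : Z ⟶ X⟦(1 : ℤ)⟧}
    (hT : Triangle.mk f g h ∈ distTriang T) (φ : W ⟶ X) (hf : φ ≫ f = 0) :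
    ∃ ψ : W⟦(1 : ℤ)⟧ ⟶ Z, φ⟦(1 : ℤ)⟧' = ψ ≫ h := by
  refine Triangle.coyoneda_exact₁ _ hT (φ⟦(1 : ℤ)⟧') ?_
  change φ⟦(1 : ℤ)⟧' ≫ f⟦(1 : ℤ)⟧' = 0
  rw [← Functor.map_comp, hf, Functor.map_zero]

lemma exists_pred (W : T) : ∃ y : T, Nonempty (y⟦(1 : ℤ)⟧ ≅ W) :=
  ⟨W⟦(-1 : ℤ)⟧, ⟨(shiftFunctorCompIsoId T (-1 : ℤ) 1 (by norm_num)).app W⟩⟩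

lemma exists_invrot {X Y Z : T} {f : X ⟶ Y} {g : Y ⟶ Z} {h : Z ⟶ X⟦(1 : ℤ)⟧}
    (hT : Triangle.mk f g h ∈ distTriang T) :
    ∃ (y : T) (b : y ⟶ X) (c : Y ⟶ y⟦(1 : ℤ)⟧), Nonempty (y⟦(1 : ℤ)⟧ ≅ Z) ∧
      Triangle.mk b f c ∈ distTriang T :=
  ⟨Z⟦(-1 : ℤ)⟧, _, _, ⟨(shiftFunctorCompIsoId T (-1 : ℤ) 1 (by norm_num)).app Z⟩,
    inv_rot_of_distTriang _ hT⟩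

end Tri

/-- abstract localization data -/
structure LD (T : Type u') [Category.{v} T] [HasZeroObject T] [Preadditive T] [HasShift T ℤ]
    [∀ n : ℤ, (CategoryTheory.shiftFunctor T n).Additive] [Pretriangulated T] where
  Γ : T ⥤ T
  L : T ⥤ T
  γ : Γ ⟶ 𝟭 T
  η : 𝟭 T ⟶ L
  δ : ∀ X : T, L.obj X ⟶ (Γ.obj X)⟦(1 : ℤ)⟧
  tri : ∀ X : T, Triangle.mk (γ.app X) (η.app X) (δ X) ∈ distTriang T
  Lη_iso : ∀ X : T, IsIso (L.map (η.app X))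
  Lη_eq : ∀ X : T, L.map (η.app X) = η.app (L.obj X)
  zero_mem : ∀ X : T, IsZero X → IsZero (L.obj X)
  shift_mem : ∀ (X : T) (n : ℤ), IsZero (L.obj X) → IsZero (L.obj (X⟦n⟧))

namespace LD

variable {T : Type u'} [Category.{v} T] [HasZeroObject T] [Preadditive T] [HasShift T ℤ]
  [∀ n : ℤ, (CategoryTheory.shiftFunctor T n).Additive] [Pretriangulated T] (D : LD T)

def Mem (X : T) : Prop := IsZero (D.L.obj X)

def IsLoc (X : T) : Prop := IsIso (D.η.app X)

def g (X : T) : D.Γ.obj X ⟶ X := D.γ.app X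
def e (X : T) : X ⟶ D.L.obj X := D.η.app X

lemma tri' (X : T) : Triangle.mk (D.g X) (D.e X) (D.δ X) ∈ distTriang T := D.tri X

lemma g_nat {X Y : T} (f : X ⟶ Y) : D.Γ.map f ≫ D.g Y = D.g X ≫ f := D.γ.naturality f
lemma e_nat {X Y : T} (f : X ⟶ Y) : f ≫ D.e Y = D.e X ≫ D.L.map f := D.η.naturality f

lemma isLoc_L (X : T) : D.IsLoc (D.L.obj X) := by
  have := D.Lη_iso X
  rw [D.Lη_eq] at this
  exact this

variable {D}

lemma IsLoc.of_iso {X Y : T} (h : D.IsLoc X) (i : X ≅ Y) : D.IsLoc Y := by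
  have : IsIso (D.η.app X) := h
  have h2 : D.η.app Y = i.inv ≫ D.η.app X ≫ D.L.map i.hom := by
    rw [← D.η.naturality]; simp
  unfold IsLoc
  rw [h2]
  infer_instance

lemma Mem.of_iso {X Y : T} (h : D.Mem X) (i : X ≅ Y) : D.Mem Y :=
  IsZero.of_iso h (D.L.mapIso i.symm)

/-- K1 -/
lemma K1 {Y s : T} (hY : D.Mem Y) (hs : D.IsLoc s) (f : Y ⟶ s) : f = 0 := by
  have : IsIso (D.η.app s) := hs
  have h : f ≫ D.η.app s = D.η.app Y ≫ D.L.map f := D.η.naturality f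
  have h2 : D.η.app Y = 0 := hY.eq_of_tgt _ _
  rw [h2, zero_comp] at h
  have := congrArg (fun x => x ≫ inv (D.η.app s)) h
  simpa using this

/-- K2 -/
lemma K2 {Y : T} (h : D.e Y = 0) : D.Mem Y := by
  have h1 := D.Lη_iso Y
  have h2 : D.L.map (D.e Y) = 0 := by
    rw [h]
    have h0 : IsZero (D.L.obj (0 : T)) := D.zero_mem _ (isZero_zero T)
    have : (0 : Y ⟶ D.L.obj Y) = (0 : Y ⟶ (0 : T)) ≫ (0 : (0 : T) ⟶ D.L.obj Y) := by simp
    rw [this, Functor.map_comp, h0.eq_of_tgt (D.L.map (0 : Y ⟶ (0 : T))) 0, zero_comp]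
  have h3 : IsIso (0 : D.L.obj Y ⟶ D.L.obj (D.L.obj Y)) := by
    rw [← h2]; exact h1
  refine (IsZero.iff_id_eq_zero _).2 ?_
  rw [← IsIso.hom_inv_id (0 : D.L.obj Y ⟶ D.L.obj (D.L.obj Y)), zero_comp]

lemma K2' {Y : T} (h : ∀ s, D.IsLoc s → ∀ f : Y ⟶ s, f = 0) : D.Mem Y :=
  K2 (h _ (D.isLoc_L Y) _)

lemma e_eq_zero {Y : T} (h : D.Mem Y) : D.e Y = 0 := h.eq_of_tgt _ _

lemma Mem.shift {X : T} (h : D.Mem X) (n : ℤ) : D.Mem (X⟦n⟧) := D.shift_mem X n h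

lemma Mem.unshift {X : T} (n : ℤ) (h : D.Mem (X⟦n⟧)) : D.Mem X :=
  (h.shift (-n)).of_iso ((shiftFunctorCompIsoId T n (-n) (by simp)).app X)

lemma Mem.zero {X : T} (h : IsZero X) : D.Mem X := D.zero_mem X h

lemma mem3 {X Y Z : T} {f : X ⟶ Y} {g : Y ⟶ Z} {h : Z ⟶ X⟦(1 : ℤ)⟧}
    (hT : Triangle.mk f g h ∈ distTriang T) (hX : D.Mem X) (hY : D.Mem Y) : D.Mem Z := by
  refine K2' fun s hs φ => ?_
  obtain ⟨ψ, rfl⟩ := yo3 hT φ (K1 hY hs _)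
  rw [K1 (hX.shift 1) hs ψ, comp_zero]

lemma mem2 {X Y Z : T} {f : X ⟶ Y} {g : Y ⟶ Z} {h : Z ⟶ X⟦(1 : ℤ)⟧}
    (hT : Triangle.mk f g h ∈ distTriang T) (hX : D.Mem X) (hZ : D.Mem Z) : D.Mem Y := by
  refine K2' fun s hs φ => ?_
  obtain ⟨ψ, rfl⟩ := yo2 hT φ (K1 hX hs _)
  rw [K1 hZ hs ψ, comp_zero]

lemma mem1 {X Y Z : T} {f : X ⟶ Y} {g : Y ⟶ Z} {h : Z ⟶ X⟦(1 : ℤ)⟧}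
    (hT : Triangle.mk f g h ∈ distTriang T) (hY : D.Mem Y) (hZ : D.Mem Z) : D.Mem X :=
  Mem.unshift 1 (mem3 (rotT hT) hY hZ)

lemma mem_coprod {J : Type w} (f : J → T) [HasCoproduct f] (h : ∀ j, D.Mem (f j)) :
    D.Mem (∐ f) := by
  refine K2' fun s hs φ => ?_
  refine Sigma.hom_ext _ _ fun j => ?_
  rw [comp_zero]
  exact K1 (h j) hs _

lemma isZero_of_mem_loc {X : T} (h : D.Mem X) (hl : D.IsLoc X) : IsZero X :=
  (IsZero.iff_id_eq_zero X).2 (K1 h hl _)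

/-- U -/
lemma U {X s : T} (hs : D.IsLoc s) (f : X ⟶ s) : ∃ f' : D.L.obj X ⟶ s, f = D.e X ≫ f' := by
  have : IsIso (D.η.app s) := hs
  refine ⟨D.L.map f ≫ inv (D.η.app s), ?_⟩
  have h : f ≫ D.η.app s = D.e X ≫ D.L.map f := D.η.naturality f
  rw [← Category.assoc, ← h]
  simp

lemma Uniq {X s : T} (hs : D.IsLoc s) (f : D.L.obj X ⟶ s) (hf : D.e X ≫ f = 0) : f = 0 := by
  have hs' : IsIso (D.η.app s) := hs
  have hX : IsIso (D.η.app (D.L.obj X)) := D.isLoc_L X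
  have h : f ≫ D.η.app s = D.η.app (D.L.obj X) ≫ D.L.map f := D.η.naturality f
  have h2 : D.η.app (D.L.obj X) ≫ D.L.map f = 0 := by
    rw [← D.Lη_eq, ← D.L.map_comp]
    have : D.L.map (D.e X ≫ f) = 0 := by
      rw [hf]
      have h0 : IsZero (D.L.obj (0 : T)) := D.zero_mem _ (isZero_zero T)
      have : (0 : X ⟶ s) = (0 : X ⟶ (0 : T)) ≫ (0 : (0 : T) ⟶ s) := by simp
      rw [this, Functor.map_comp, h0.eq_of_tgt (D.L.map (0 : X ⟶ (0 : T))) 0, zero_comp]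
    exact this
  rw [h2] at h
  have := congrArg (fun x => x ≫ inv (D.η.app s)) h
  simpa using this

lemma one {X s : T} (hs : D.IsLoc s) (f : X ⟶ s) : D.g X ≫ f = 0 := by
  obtain ⟨f', rfl⟩ := U hs f
  rw [← Category.assoc, z12 (D.tri' X), zero_comp]

lemma two {X s : T} (hs : D.IsLoc (s⟦(1 : ℤ)⟧)) (θ : D.Γ.obj X ⟶ s) :
    ∃ φ : X ⟶ s, θ = D.g X ≫ φ := by
  refine yo1 (D.tri' X) θ ?_
  refine Uniq hs _ ?_
  rw [← Category.assoc, z23 (D.tri' X), zero_comp]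

lemma Γ_map_zero (X Y : T) : D.Γ.map (0 : X ⟶ Y) = 0 := by
  have h0 : IsZero (D.Γ.obj (0 : T)) :=
    Triangle.isZero₁_of_isZero₂₃ _ (D.tri (0 : T)) (isZero_zero T) (D.zero_mem _ (isZero_zero T))
  have : (0 : X ⟶ Y) = (0 : X ⟶ (0 : T)) ≫ (0 : (0 : T) ⟶ Y) := by simp
  rw [this, Functor.map_comp, h0.eq_of_tgt (D.Γ.map (0 : X ⟶ (0 : T))) 0, zero_comp]

lemma three {X y : T} (b : y ⟶ D.Γ.obj X) (c : X ⟶ y⟦(1 : ℤ)⟧) (hy : D.IsLoc (y⟦(1 : ℤ)⟧))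
    (hT : Triangle.mk b (D.g X) c ∈ distTriang T) : D.g y ≫ b = 0 := by
  have h1 : D.Γ.map b ≫ D.Γ.map (D.g X) = 0 := by
    rw [← D.Γ.map_comp, z12 hT, Γ_map_zero]
  have h2 : (D.Γ.map (D.g X) - D.g (D.Γ.obj X)) ≫ D.g X = 0 := by
    rw [Preadditive.sub_comp, D.g_nat, sub_self]
  obtain ⟨θ, hθ⟩ := co2 hT _ h2
  obtain ⟨φ, rfl⟩ := two hy θ
  obtain ⟨φ', rfl⟩ := two hy φ
  have h3 : D.Γ.map (D.g X) = D.g (D.Γ.obj X) + (D.g (D.Γ.obj X) ≫ D.g X ≫ φ') ≫ b := by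
    rw [← hθ]; abel
  rw [h3, Preadditive.comp_add, D.g_nat] at h1
  have h4 : D.Γ.map b ≫ (D.g (D.Γ.obj X) ≫ D.g X ≫ φ') ≫ b = 0 := by
    have : D.Γ.map b ≫ D.g (D.Γ.obj X) = D.g y ≫ b := D.g_nat b
    have h5 : b ≫ D.g X = 0 := z12 hT
    simp only [Category.assoc]
    rw [← Category.assoc, this, Category.assoc, ← Category.assoc b, h5, zero_comp, comp_zero]
  rw [h4, add_zero] at h1
  exact h1

lemma splitting {e q x : T} (he : D.IsLoc e) (hq : D.IsLoc q) (σ : q ⟶ e)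
    (hσ : ∀ s, D.IsLoc s → ∀ f : e ⟶ s, σ ≫ f = 0 → f = 0) (p : x ⟶ e)
    (h1 : ∀ s, D.IsLoc s → ∀ f : e ⟶ s, p ≫ f = 0 → f = 0)
    (h2 : ∀ s, D.IsLoc s → ∀ f : x ⟶ s, ∃ f' : e ⟶ s, f = p ≫ f')
    (h3 : ∀ s, D.IsLoc s → ∀ h : e ⟶ s⟦(1 : ℤ)⟧, p ≫ h = 0) :
    ∃ τ : e ⟶ q, τ ≫ σ = 𝟙 e := by
  obtain ⟨F, a, i, hT1⟩ := distinguished_cocone_triangle₁ σ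
  obtain ⟨N, j, vv, hT2⟩ := distinguished_cocone_triangle₂ (p ≫ i)
  obtain ⟨uu, hu1, hu2⟩ := fill2 hT2 hT1 (𝟙 F) p (by simp)
  rw [Category.id_comp] at hu1
  obtain ⟨n, hn⟩ := yo1 hT2 (D.e F) (by
    rw [Category.assoc]; exact h3 _ (D.isLoc_L F) _)
  have hk := D.e_nat j
  set k := D.L.map j with hkdef
  obtain ⟨w, hw⟩ := yo2 hT2 (D.e N - n ≫ k) (by
    rw [Preadditive.comp_sub, ← Category.assoc, ← hn, hk, sub_self])
  obtain ⟨w', rfl⟩ := h2 _ (D.isLoc_L N) w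
  obtain ⟨u', hu'⟩ := U hq uu
  have e1 : k ≫ u' ≫ σ = 0 := by
    refine Uniq he _ ?_
    rw [← Category.assoc, ← hk, Category.assoc, ← Category.assoc (D.e N), ← hu',
      ← Category.assoc, hu1]
    exact z12 hT1
  have e2 : uu ≫ σ = uu ≫ σ ≫ w' ≫ u' ≫ σ := by
    have : D.e N = n ≫ k + vv ≫ p ≫ w' := by rw [← hw]; abel
    conv_lhs => rw [hu', this]
    simp only [Preadditive.add_comp, Category.assoc]
    rw [e1, comp_zero, zero_add, ← Category.assoc vv, hu2]
    simp
  have inj : ∀ s, D.IsLoc s → ∀ f : q ⟶ s, uu ≫ f = 0 → f = 0 := by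
    intro s hs f hf
    obtain ⟨h, rfl⟩ := yo2 hT1 f (by rw [← hu1, Category.assoc, hf, comp_zero])
    have : vv ≫ p ≫ h = 0 := by rw [← Category.assoc, hu2, Category.assoc, hf]
    obtain ⟨m, hm⟩ := yo3 hT2 (p ≫ h) this
    have h5 : h - i ≫ m = 0 := h1 s hs _ (by
      rw [Preadditive.comp_sub, hm]; simp)
    rw [sub_eq_zero.1 h5, ← Category.assoc, z23 hT1, zero_comp]
  have e3 : σ ≫ (w' ≫ u' ≫ σ - 𝟙 e) = 0 := by
    apply inj _ he
    rw [Preadditive.comp_sub, Preadditive.comp_sub, ← e2]; simp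
  have e4 := hσ _ he _ e3
  exact ⟨w' ≫ u', by rw [Category.assoc]; exact sub_eq_zero.1 e4⟩

lemma key {X X' n t : T} (i : t ≅ D.Γ.obj X) (i1 : n⟦(1 : ℤ)⟧ ≅ t) (i' : n ≅ D.Γ.obj X') :
    D.Mem t := by
  suffices hh : D.Mem (D.Γ.obj X) from hh.of_iso i.symm
  replace i1 : n⟦(1 : ℤ)⟧ ≅ D.Γ.obj X := i1 ≪≫ i
  clear i
  set t' := D.Γ.obj X with ht'
  clear t
  let e := D.L.obj t'
  obtain ⟨ye, ⟨ε⟩⟩ := exists_pred e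
  have he : D.IsLoc e := D.isLoc_L _
  have hye : D.IsLoc (ye⟦(1 : ℤ)⟧) := he.of_iso ε.symm
  obtain ⟨η', hη'⟩ := (shiftFunctor T (1 : ℤ)).map_surjective (i1.hom ≫ D.e t' ≫ ε.inv)
  obtain ⟨gg, hgg⟩ := two hye (i'.inv ≫ η')
  have hη2 : η' = i'.hom ≫ D.g X' ≫ gg := by rw [← hgg]; simp
  have kill : ∀ s, D.IsLoc s → ∀ f : ye ⟶ s, η' ≫ f = 0 := by
    intro s hs f
    rw [hη2, Category.assoc, Category.assoc, one hs, comp_zero]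
  -- triangle for X
  obtain ⟨y, b, c, ⟨iy⟩, hT⟩ := exists_invrot (D.tri' X)
  have hy : D.IsLoc (y⟦(1 : ℤ)⟧) := (D.isLoc_L X).of_iso iy.symm
  obtain ⟨b', hb'⟩ := yo2 (D.tri' y) b (three b c hy hT)
  obtain ⟨τ, hτ⟩ := splitting (D := D) he (D.isLoc_L y) (b' ≫ D.e t') (by
    intro s hs f hf
    refine Uniq hs _ ?_
    have : b ≫ D.e t' ≫ f = 0 := by
      rw [hb', Category.assoc, ← Category.assoc b', hf, comp_zero]
    obtain ⟨f', hf'⟩ := yo2 hT _ this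
    rw [hf', one hs]) ((D.g ye)⟦(1 : ℤ)⟧' ≫ ε.hom)
    (by
      intro s hs f hf
      obtain ⟨s', ⟨es⟩⟩ := exists_pred s
      obtain ⟨f', hf'⟩ := (shiftFunctor T (1 : ℤ)).map_surjective (ε.hom ≫ f ≫ es.inv)
      have h1 : D.g ye ≫ f' = 0 := by
        apply sh_zero 1
        rw [Functor.map_comp, hf', ← Category.assoc, ← Category.assoc, hf, zero_comp]
      obtain ⟨ξ, hξ⟩ := yo2 (D.tri' ye) f' h1
      have h2 : η' ≫ f' = 0 := by
        rw [hξ, ← Category.assoc, kill _ (D.isLoc_L ye), zero_comp]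
      have h3 : i1.hom ≫ D.e t' ≫ f ≫ es.inv = 0 := by
        have := congrArg (fun x => x⟦(1 : ℤ)⟧') h2
        simp only [Functor.map_comp, hη', hf', Functor.map_zero] at this
        simpa using this
      refine Uniq hs f ?_
      have h4 := congrArg (fun x => i1.inv ≫ x ≫ es.hom) h3
      simpa using h4)
    (by
      intro s hs f
      obtain ⟨s', ⟨es⟩⟩ := exists_pred s
      obtain ⟨θ, hθ⟩ := (shiftFunctor T (1 : ℤ)).map_surjective (f ≫ es.inv)
      obtain ⟨φ, rfl⟩ := two (D := D) (hs.of_iso es.symm) θ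
      refine ⟨ε.inv ≫ φ⟦(1 : ℤ)⟧' ≫ es.hom, ?_⟩
      have : f = (D.g ye ≫ φ)⟦(1 : ℤ)⟧' ≫ es.hom := by rw [hθ]; simp
      rw [this]; simp)
    (by
      intro s hs h
      obtain ⟨h', hh'⟩ := (shiftFunctor T (1 : ℤ)).map_surjective (ε.hom ≫ h)
      rw [Category.assoc, ← hh', ← Functor.map_comp, one hs, Functor.map_zero])
  have hsplit : (τ ≫ b') ≫ D.e t' = 𝟙 _ := by rw [Category.assoc]; exact hτ
  have hmem : D.Mem ye := by
    refine K2' fun s hs h => ?_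
    have h1 := kill s hs h
    have h2 : i1.hom ≫ D.e t' ≫ ε.inv ≫ h⟦(1 : ℤ)⟧' = 0 := by
      have := congrArg (fun x => x⟦(1 : ℤ)⟧') h1
      simp only [Functor.map_comp, hη', Functor.map_zero] at this
      simpa using this
    apply sh_zero 1
    have h3 := congrArg (fun x => ε.hom ≫ (τ ≫ b') ≫ i1.inv ≫ x) h2
    simp only [Iso.inv_hom_id_assoc, comp_zero] at h3
    rw [← Category.assoc (τ ≫ b'), hsplit] at h3
    simpa using h3
  have hz : IsZero e := isZero_of_mem_loc ((hmem.shift 1).of_iso ε) he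
  exact hz

end LD

end BIKaux

namespace BIKaux

open scoped ZeroObject
open BIK MonoidalCategory

section Tri2

variable {T : Type u'} [Category.{v} T] [HasZeroObject T] [Preadditive T] [HasShift T ℤ]
  [∀ n : ℤ, (CategoryTheory.shiftFunctor T n).Additive] [Pretriangulated T]

lemma isoTri {X Y Z Y' Z' : T} {f : X ⟶ Y} {g : Y ⟶ Z} {h : Z ⟶ X⟦(1 : ℤ)⟧}
    (hT : Triangle.mk f g h ∈ distTriang T) (e2 : Y ≅ Y') (e3 : Z ≅ Z') :
    Triangle.mk (f ≫ e2.hom) (e2.inv ≫ g ≫ e3.hom) (e3.inv ≫ h) ∈ distTriang T := by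
  refine isomorphic_distinguished _ hT _ ?_
  exact Triangle.isoMk _ _ (Iso.refl _) e2.symm e3.symm
    (by change (f ≫ e2.hom) ≫ e2.inv = 𝟙 X ≫ f; simp)
    (by change (e2.inv ≫ g ≫ e3.hom) ≫ e3.inv = e2.inv ≫ g; simp)
    (by change (e3.inv ≫ h) ≫ (𝟙 X)⟦(1 : ℤ)⟧' = e3.inv ≫ h; simp)

def Orth (C N : T) : Prop := ∀ (j : ℤ) (f : C ⟶ N⟦j⟧), f = 0

lemma Orth.tgt_iso {C N N' : T} (h : Orth C N) (i : N ≅ N') : Orth C N' := by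
  intro j f
  have h1 : f ≫ (i.inv)⟦j⟧' = 0 := h j _
  have h2 := congrArg (fun x => x ≫ (i.hom)⟦j⟧') h1
  simpa [← Functor.map_comp] using h2

lemma Orth.src_iso {C C' N : T} (h : Orth C N) (i : C ≅ C') : Orth C' N := by
  intro j f
  have h1 : i.hom ≫ f = 0 := h j _
  have h2 := congrArg (fun x => i.inv ≫ x) h1
  simpa using h2

lemma Orth.shift2 {C N : T} (h : Orth C N) (a j : ℤ) (f : C ⟶ N⟦j⟧⟦a⟧) : f = 0 := by
  have h1 : f ≫ ((shiftFunctorAdd T j a).inv.app N) = 0 := h _ _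
  have h2 := congrArg (fun x => x ≫ ((shiftFunctorAdd T j a).hom.app N)) h1
  simpa using h2

lemma Orth.src_shift {C N : T} (h : Orth C N) (a : ℤ) : Orth (C⟦a⟧) N := by
  intro j f
  apply sh_zero (-a)
  have h1 := h.shift2 (-a) j
    ((shiftFunctorCompIsoId T a (-a) (by simp)).inv.app C ≫ f⟦-a⟧')
  have h2 := congrArg (fun x => (shiftFunctorCompIsoId T a (-a) (by simp)).hom.app C ≫ x) h1
  simpa using h2

lemma Orth.tgt_shift {C N : T} (h : Orth C N) (a : ℤ) : Orth C (N⟦a⟧) := by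
  intro j f
  exact h.shift2 j a f

lemma Orth.hom_zero {C N : T} (h : Orth C N) (f : C ⟶ N) : f = 0 := by
  have h1 := h 0 (f ≫ (shiftFunctorZero T ℤ).inv.app N)
  have h2 := congrArg (fun x => x ≫ (shiftFunctorZero T ℤ).hom.app N) h1
  simpa using h2

end Tri2

section Ten

variable (T : Type u') [Category.{v} T] [HasZeroObject T] [Preadditive T] [HasShift T ℤ]
  [∀ n : ℤ, (CategoryTheory.shiftFunctor T n).Additive] [Pretriangulated T]
  [HasCoproducts.{v} T] [MonoidalCategory T] [SymmetricCategory T]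

structure TH where
  tshift : ∀ (X Y : T) (n : ℤ), (X ⊗ Y⟦n⟧) ≅ (X ⊗ Y)⟦n⟧
  htshift : ∀ (X : T) {Y Y' : T} (g : Y ⟶ Y') (n : ℤ),
      (X ◁ g⟦n⟧') ≫ (tshift X Y' n).hom = (tshift X Y n).hom ≫ ((X ◁ g)⟦n⟧')
  hexact : ∀ (X : T), ∀ Tr ∈ distTriang T,
      Triangle.mk (X ◁ Tr.mor₁) (X ◁ Tr.mor₂) ((X ◁ Tr.mor₃) ≫ (tshift X Tr.obj₁ 1).hom)
        ∈ distTriang T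
  hcop : ∀ (X : T) (J : Type v) (f : J → T),
      IsIso (Sigma.desc fun j => X ◁ Sigma.ι f j : (∐ fun j => X ⊗ f j) ⟶ X ⊗ ∐ f)

variable {T} (H : TH T)
namespace TH

lemma ex {X Y Z : T} (W : T) {f : X ⟶ Y} {g : Y ⟶ Z} {h : Z ⟶ X⟦(1 : ℤ)⟧}
    (hT : Triangle.mk f g h ∈ distTriang T) :
    Triangle.mk (W ◁ f) (W ◁ g) ((W ◁ h) ≫ (H.tshift W X 1).hom) ∈ distTriang T :=
  H.hexact W _ hT

lemma zero_right (H : TH T) {Y : T} (X : T) (hY : IsZero Y) : IsZero (X ⊗ Y) := by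
  have h : Triangle.mk (𝟙 Y) (𝟙 Y) (0 : Y ⟶ Y⟦(1 : ℤ)⟧) ∈ distTriang T :=
    (Triangle.distinguished_iff_of_isZero₃ _ hY).2 (inferInstanceAs (IsIso (𝟙 Y)))
  have h2 := z12 (H.ex X h)
  rw [IsZero.iff_id_eq_zero]
  simpa using h2

lemma zero_left (H : TH T) {Y : T} (X : T) (hY : IsZero Y) : IsZero (Y ⊗ X) :=
  (H.zero_right X hY).of_iso (β_ Y X)

lemma wl_zero (H : TH T) (X Y Z : T) : X ◁ (0 : Y ⟶ Z) = 0 := by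
  have : (0 : Y ⟶ Z) = (0 : Y ⟶ (0 : T)) ≫ (0 : (0 : T) ⟶ Z) := by simp
  rw [this, MonoidalCategory.whiskerLeft_comp,
    (H.zero_right X (isZero_zero T)).eq_of_tgt (X ◁ (0 : Y ⟶ (0 : T))) 0, zero_comp]

lemma wl_biprod (H : TH T) (X Y Z : T) :
    𝟙 (X ⊗ (Y ⊞ Z)) = X ◁ (biprod.fst : Y ⊞ Z ⟶ Y) ≫ X ◁ (biprod.inl : Y ⟶ Y ⊞ Z) +
      X ◁ (biprod.snd : Y ⊞ Z ⟶ Z) ≫ X ◁ (biprod.inr : Z ⟶ Y ⊞ Z) := by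
  have hT : Triangle.mk (biprod.inl : Y ⟶ Y ⊞ Z) (biprod.snd : Y ⊞ Z ⟶ Z)
    (0 : Z ⟶ Y⟦(1 : ℤ)⟧) ∈ distTriang T := binaryBiproductTriangle_distinguished Y Z
  have hT2 := H.ex X hT
  have a1 : X ◁ (biprod.inl : Y ⟶ Y ⊞ Z) ≫ X ◁ (biprod.fst : Y ⊞ Z ⟶ Y) = 𝟙 _ := by
    rw [← MonoidalCategory.whiskerLeft_comp]; simp
  have a2 : X ◁ (biprod.inl : Y ⟶ Y ⊞ Z) ≫ X ◁ (biprod.snd : Y ⊞ Z ⟶ Z) = 0 := by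
    rw [← MonoidalCategory.whiskerLeft_comp]; simp [H.wl_zero]
  have a3 : X ◁ (biprod.inr : Z ⟶ Y ⊞ Z) ≫ X ◁ (biprod.fst : Y ⊞ Z ⟶ Y) = 0 := by
    rw [← MonoidalCategory.whiskerLeft_comp]; simp [H.wl_zero]
  have a4 : X ◁ (biprod.inr : Z ⟶ Y ⊞ Z) ≫ X ◁ (biprod.snd : Y ⊞ Z ⟶ Z) = 𝟙 _ := by
    rw [← MonoidalCategory.whiskerLeft_comp]; simp
  have key : 𝟙 (X ⊗ (Y ⊞ Z)) - (X ◁ (biprod.fst : Y ⊞ Z ⟶ Y) ≫ X ◁ (biprod.inl : Y ⟶ Y ⊞ Z) +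
      X ◁ (biprod.snd : Y ⊞ Z ⟶ Z) ≫ X ◁ (biprod.inr : Z ⟶ Y ⊞ Z)) = 0 := by
    obtain ⟨k, hk⟩ := yo2 hT2 (𝟙 (X ⊗ (Y ⊞ Z)) -
      (X ◁ (biprod.fst : Y ⊞ Z ⟶ Y) ≫ X ◁ (biprod.inl : Y ⟶ Y ⊞ Z) +
      X ◁ (biprod.snd : Y ⊞ Z ⟶ Z) ≫ X ◁ (biprod.inr : Z ⟶ Y ⊞ Z))) (by
        rw [Preadditive.comp_sub, Preadditive.comp_add, ← Category.assoc, ← Category.assoc, a1, a2]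
        simp)
    have hk0 : k = 0 := by
      have : k = X ◁ (biprod.inr : Z ⟶ Y ⊞ Z) ≫ X ◁ (biprod.snd : Y ⊞ Z ⟶ Z) ≫ k := by
        rw [← Category.assoc, a4, Category.id_comp]
      rw [this, ← hk, Preadditive.comp_sub, Preadditive.comp_add, ← Category.assoc,
        ← Category.assoc, a3, a4]
      simp
    rw [hk, hk0, comp_zero]
  exact sub_eq_zero.1 key

lemma wl_add (H : TH T) (X : T) {Y Z : T} (f g : Y ⟶ Z) : X ◁ (f + g) = X ◁ f + X ◁ g := by
  have h1 : f + g = biprod.lift f g ≫ biprod.desc (𝟙 Z) (𝟙 Z) := by simp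
  rw [h1, MonoidalCategory.whiskerLeft_comp, ← Category.id_comp (X ◁ biprod.desc (𝟙 Z) (𝟙 Z)),
    H.wl_biprod]
  simp only [Preadditive.add_comp, Preadditive.comp_add, Category.assoc]
  simp only [← MonoidalCategory.whiskerLeft_comp]
  simp

lemma wl_sub (H : TH T) (X : T) {Y Z : T} (f g : Y ⟶ Z) : X ◁ (f - g) = X ◁ f - X ◁ g := by
  rw [eq_sub_iff_add_eq, ← H.wl_add, sub_add_cancel]

end TH
end Ten

section Act

variable {R : Type u} [Ring R] {𝒜 : ℤ → AddSubgroup R} [GradedRing 𝒜]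
variable {T : Type u'} [Category.{v} T] [HasZeroObject T] [Preadditive T] [HasShift T ℤ]
  [∀ n : ℤ, (CategoryTheory.shiftFunctor T n).Additive] [Pretriangulated T]
  [HasCoproducts.{v} T]

variable (𝒜) in
abbrev HEl : Type u := (i : ℤ) × {a : R // a ∈ 𝒜 i}

def HEl.sq (s : HEl 𝒜) : HEl 𝒜 :=
  ⟨s.1 + s.1, s.2.1 * s.2.1, SetLike.mul_mem_graded s.2.2 s.2.2⟩

variable (A : CenterAction 𝒜 T)

def ac (s : HEl 𝒜) (X : T) : X ⟶ X⟦s.1⟧ := A.act s.1 s.2.1 s.2.2 X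

lemma ac_nat (s : HEl 𝒜) {X Y : T} (f : X ⟶ Y) : f ≫ ac A s Y = ac A s X ≫ f⟦s.1⟧' :=
  A.act_natural _ _ _ f

def Kills (s : HEl 𝒜) (X : T) : Prop := ac A s X = 0

variable {A}

lemma Kills.of_iso {s : HEl 𝒜} {X Y : T} (h : Kills A s X) (i : X ≅ Y) : Kills A s Y := by
  have h1 := ac_nat A s i.hom
  rw [show ac A s X = 0 from h, zero_comp] at h1
  have := congrArg (fun x => i.inv ≫ x) h1
  change ac A s Y = 0
  simpa using this

lemma ac_shift_zero {s : HEl 𝒜} {X Y : T} (n : ℤ) (f : Y ⟶ X) (h : f ≫ ac A s X = 0) :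
    f⟦n⟧' ≫ ac A s (X⟦n⟧) = 0 := by
  unfold ac
  rw [A.act_shift, Preadditive.comp_zsmul, ← Category.assoc, ← Functor.map_comp]
  rw [show f ≫ A.act s.1 s.2.1 s.2.2 X = 0 from h]
  simp

lemma Kills.shift {s : HEl 𝒜} {X : T} (h : Kills A s X) (n : ℤ) : Kills A s (X⟦n⟧) := by
  have := ac_shift_zero n (𝟙 X) (by rw [show ac A s X = 0 from h, comp_zero])
  change ac A s (X⟦n⟧) = 0
  simpa using this

lemma Kills.unshift {s : HEl 𝒜} {X : T} (n : ℤ) (h : Kills A s (X⟦n⟧)) : Kills A s X :=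
  (h.shift (-n)).of_iso ((shiftFunctorCompIsoId T n (-n) (by simp)).app X)

lemma shift_ac_zero {s : HEl 𝒜} {X Y : T} (f : X⟦s.1⟧ ⟶ Y) (h : ac A s X ≫ f = 0) :
    ac A s (X⟦s.1⟧) ≫ f⟦s.1⟧' = 0 := by
  unfold ac
  have h1 : (shiftComm X s.1 s.1).hom = 𝟙 _ := by
    change (shiftFunctorComm T s.1 s.1).hom.app X = _
    rw [shiftFunctorComm_eq_refl]; rfl
  rw [A.act_shift, h1, Category.comp_id, Preadditive.zsmul_comp, ← Functor.map_comp]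
  rw [show A.act s.1 s.2.1 s.2.2 X ≫ f = 0 from h]
  simp

lemma kills_sq {s : HEl 𝒜} {P X : T} {a : P ⟶ X} {c : X⟦s.1⟧ ⟶ P⟦(1 : ℤ)⟧}
    (hT : Triangle.mk a (ac A s X) c ∈ distTriang T) : Kills A s.sq P := by
  apply Kills.unshift 1
  have h1 : c ≫ ac A s (P⟦(1 : ℤ)⟧) = 0 := by
    rw [ac_nat]; exact shift_ac_zero c (z23 hT)
  obtain ⟨m, hm⟩ := yo3 (rotT hT) _ h1
  have h2 : ac A s (P⟦(1 : ℤ)⟧) ≫ ac A s (P⟦(1 : ℤ)⟧⟦s.1⟧) = 0 := by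
    conv_lhs => rw [hm]
    rw [Category.assoc, ac_nat, ← Category.assoc, Preadditive.neg_comp,
      ac_shift_zero 1 a (z12 hT)]
    simp
  have h3 : ac A s.sq (P⟦(1 : ℤ)⟧) = ac A s (P⟦(1 : ℤ)⟧) ≫ ac A s (P⟦(1 : ℤ)⟧⟦s.1⟧) ≫
      (shiftFunctorAdd' T s.1 s.1 (s.1 + s.1) (by ring)).inv.app _ :=
    A.act_mul s.1 s.1 s.2.1 s.2.1 s.2.2 s.2.2 _
  unfold Kills
  rw [h3, ← Category.assoc, h2, zero_comp]
  rfl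

end Act

end BIKaux

namespace BIKaux

open scoped ZeroObject
open BIK MonoidalCategory

section Can

variable {R : Type u} [Ring R] {𝒜 : ℤ → AddSubgroup R} [GradedRing 𝒜]
variable {T : Type u'} [Category.{v} T] [HasZeroObject T] [Preadditive T] [HasShift T ℤ]
  [∀ n : ℤ, (CategoryTheory.shiftFunctor T n).Additive] [Pretriangulated T]
  [HasCoproducts.{v} T] [MonoidalCategory T] [SymmetricCategory T]

structure CN (A : CenterAction 𝒜 T) extends TH T where
  u : ∀ (i : ℤ) (a : R), a ∈ 𝒜 i → ((𝟙_ T) ⟶ (𝟙_ T)⟦i⟧)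
  hcanon : ∀ (i : ℤ) (a : R) (ha : a ∈ 𝒜 i) (X : T),
      A.act i a ha X =
        (ρ_ X).inv ≫ (X ◁ u i a ha) ≫ (tshift X (𝟙_ T) i).hom ≫ ((ρ_ X).hom)⟦i⟧'

variable (T) in
abbrev Idx : Type v := (i : ℤ) × ((𝟙_ T) ⟶ (𝟙_ T)⟦i⟧)

noncomputable def Fo (m : Idx T) : T := (distinguished_cocone_triangle₁ m.2).choose

lemma Fo_tri (m : Idx T) : ∃ (f : Fo m ⟶ 𝟙_ T) (h : (𝟙_ T)⟦m.1⟧ ⟶ (Fo m)⟦(1 : ℤ)⟧),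
    Triangle.mk f m.2 h ∈ distTriang T :=
  (distinguished_cocone_triangle₁ m.2).choose_spec

variable {A : CenterAction 𝒜 T} (K : CN A)

namespace CN

def ix (s : HEl 𝒜) : Idx T := ⟨s.1, K.u s.1 s.2.1 s.2.2⟩

def actm (m : Idx T) (X : T) : X ⟶ X⟦m.1⟧ :=
  (ρ_ X).inv ≫ (X ◁ m.2) ≫ (K.tshift X (𝟙_ T) m.1).hom ≫ ((ρ_ X).hom)⟦m.1⟧'

lemma ac_eq (s : HEl 𝒜) (X : T) : ac A s X = K.actm (K.ix s) X := K.hcanon _ _ _ X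

noncomputable def F (s : HEl 𝒜) : T := Fo (K.ix s)

lemma triM (m : Idx T) (X : T) : ∃ (a : X ⊗ Fo m ⟶ X) (c : X⟦m.1⟧ ⟶ (X ⊗ Fo m)⟦(1 : ℤ)⟧),
    Triangle.mk a (K.actm m X) c ∈ distTriang T := by
  obtain ⟨f, h, hT⟩ := Fo_tri m
  have h2 := isoTri (K.ex X hT) (ρ_ X)
    (K.tshift X (𝟙_ T) m.1 ≪≫ (shiftFunctor T m.1).mapIso (ρ_ X))
  exact ⟨_, _, by simpa [actm] using h2⟩

lemma triF (s : HEl 𝒜) (X : T) : ∃ (a : X ⊗ K.F s ⟶ X) (c : X⟦s.1⟧ ⟶ (X ⊗ K.F s)⟦(1 : ℤ)⟧),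
    Triangle.mk a (ac A s X) c ∈ distTriang T := by
  obtain ⟨a, c, h⟩ := K.triM (K.ix s) X
  rw [← K.ac_eq] at h
  exact ⟨a, c, h⟩

lemma kills_F (s : HEl 𝒜) (X : T) : Kills A s.sq (X ⊗ K.F s) := by
  obtain ⟨a, c, h⟩ := K.triF s X
  exact kills_sq h

lemma kills_tensor (K : CN A) {s : HEl 𝒜} {Y : T} (h : Kills A s Y) (X : T) :
    Kills A s (X ⊗ Y) := by
  have h1 : Y ◁ (K.u s.1 s.2.1 s.2.2) = 0 := by
    have h2 : (ρ_ Y).inv ≫ (Y ◁ K.u s.1 s.2.1 s.2.2) ≫ (K.tshift Y (𝟙_ T) s.1).hom ≫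
      ((ρ_ Y).hom)⟦s.1⟧' = 0 := (K.hcanon _ _ _ Y).symm.trans h
    have h3 := congrArg (fun x => (ρ_ Y).hom ≫ x ≫ ((ρ_ Y).inv)⟦s.1⟧' ≫
      (K.tshift Y (𝟙_ T) s.1).inv) h2
    simpa [← Functor.map_comp_assoc] using h3
  have h4 : (X ⊗ Y) ◁ (K.u s.1 s.2.1 s.2.2) = 0 := by
    rw [MonoidalCategory.tensor_whiskerLeft, h1, K.wl_zero]; simp
  change ac A s (X ⊗ Y) = 0
  unfold ac
  rw [K.hcanon, h4]; simp

lemma kills_tensor' (K : CN A) {s : HEl 𝒜} {Y : T} (h : Kills A s Y) (X : T) :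
    Kills A s (Y ⊗ X) := (K.kills_tensor h X).of_iso (β_ X Y)

noncomputable def E (K : CN A) : T → List (HEl 𝒜) → T
  | X, [] => X
  | X, s :: l => E K (X ⊗ K.F s) l

lemma kills_E_of (l : List (HEl 𝒜)) {s : HEl 𝒜} : ∀ {X : T}, Kills A s X → Kills A s (K.E X l) := by
  induction l with
  | nil => intro X h; exact h
  | cons t l ih => intro X h; exact ih (K.kills_tensor' h _)

lemma kills_E (l : List (HEl 𝒜)) {s : HEl 𝒜} (hs : s ∈ l) :
    ∀ X : T, Kills A s.sq (K.E X l) := by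
  induction l with
  | nil => simp at hs
  | cons t l ih =>
    intro X
    rcases List.mem_cons.1 hs with rfl | h
    · exact K.kills_E_of l (K.kills_F s X)
    · exact ih h _

lemma E_iso (l : List (HEl 𝒜)) : ∀ X : T, Nonempty (K.E X l ≅ X ⊗ K.E (𝟙_ T) l) := by
  induction l with
  | nil => intro X; exact ⟨(ρ_ X).symm⟩
  | cons t l ih =>
    intro X
    obtain ⟨i⟩ := ih (X ⊗ K.F t)
    obtain ⟨j⟩ := ih (𝟙_ T ⊗ K.F t)
    exact ⟨i ≪≫ α_ _ _ _ ≪≫ whiskerLeftIso X ((whiskerRightIso (λ_ (K.F t)).symm _) ≪≫ j.symm)⟩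

/-- lemma H -/
lemma homH (l : List (HEl 𝒜)) : ∀ (X Y : T), IsZero (K.E X l) → (∀ s ∈ l, Kills A s Y) →
    ∀ f : X ⟶ Y, f = 0 := by
  induction l with
  | nil => intro X Y h _ f; exact IsZero.eq_of_src h _ _
  | cons s l ih =>
    intro X Y h hY f
    obtain ⟨a, c, hT⟩ := K.triF s X
    obtain ⟨g, hg⟩ := yo2 hT f (ih _ Y h (fun t ht => hY t (List.mem_cons_of_mem _ ht)) _)
    have hs : Kills A s (Y⟦-s.1⟧) := (hY s (List.mem_cons_self)).shift _
    let e := (shiftFunctorCompIsoId T (-s.1) s.1 (by simp)).app Y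
    obtain ⟨k, hk⟩ := (shiftFunctor T s.1).map_surjective (g ≫ e.inv)
    have h1 : ac A s X ≫ k⟦s.1⟧' = 0 := by
      rw [← ac_nat, show ac A s (Y⟦-s.1⟧) = 0 from hs, comp_zero]
    rw [hk, ← Category.assoc, ← hg] at h1
    have h2 := congrArg (fun x => x ≫ e.hom) h1
    simpa using h2

lemma lift (l : List (HEl 𝒜)) {b : T} (hb : ∀ s ∈ l, Kills A s b) :
    ∀ (N : T), (∀ f : b ⟶ K.E N l, f = 0) → ∀ f : b ⟶ N, f = 0 := by
  induction l with
  | nil => intro N h f; exact h f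
  | cons s l ih =>
    intro N h f
    have h1 := ih (fun t ht => hb t (List.mem_cons_of_mem _ ht)) (N ⊗ K.F s) h
    obtain ⟨a, c, hT⟩ := K.triF s N
    obtain ⟨g, rfl⟩ := co2 hT f (by
      rw [ac_nat, show ac A s b = 0 from hb s List.mem_cons_self, zero_comp])
    rw [h1 g, zero_comp]

lemma orth_F (s : HEl 𝒜) {C N : T} (h : Orth C N) : Orth (C ⊗ K.F s) N := by
  intro j f
  obtain ⟨a, c, hT⟩ := K.triF s C
  obtain ⟨g, rfl⟩ := yo1 hT f ((h.src_shift _).shift2 _ _ _)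
  rw [h _ g, comp_zero]

lemma orth_E (l : List (HEl 𝒜)) : ∀ {C N : T}, Orth C N → Orth (K.E C l) N := by
  induction l with
  | nil => intro C N h; exact h
  | cons s l ih => intro C N h; exact ih (K.orth_F s h)

/-- hom-local objects -/
def _root_.BIKaux.LD.HL (D : LD T) (X : T) : Prop := ∀ Y, D.Mem Y → ∀ f : Y ⟶ X, f = 0

lemma _root_.BIKaux.LD.HL.shift {D : LD T} {X : T} (h : D.HL X) (n : ℤ) : D.HL (X⟦n⟧) := by
  intro Y hY f
  let e := (shiftFunctorCompIsoId T (-n) n (by simp)).app Y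
  obtain ⟨k, hk⟩ := (shiftFunctor T n).map_surjective (e.hom ≫ f)
  rw [h _ (hY.shift _) k, Functor.map_zero] at hk
  have h2 := congrArg (fun x => e.inv ≫ x) hk
  simpa using h2.symm

lemma _root_.BIKaux.LD.HL.of_iso {D : LD T} {X X' : T} (h : D.HL X) (i : X ≅ X') : D.HL X' := by
  intro Y hY f
  have h1 := congrArg (fun x => x ≫ i.hom) (h _ hY (f ≫ i.inv))
  simpa using h1

lemma _root_.BIKaux.LD.IsLoc.hl {D : LD T} {X : T} (h : D.IsLoc X) : D.HL X :=
  fun _ hY f => LD.K1 hY h f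

lemma hl_F {D : LD T} (s : HEl 𝒜) {X : T} (h : D.HL X) : D.HL (X ⊗ K.F s) := by
  intro Y hY f
  obtain ⟨a, c, hT⟩ := K.triF s X
  obtain ⟨g, hg⟩ := co1 hT f (h _ hY _)
  apply sh_zero 1
  rw [hg, h.shift _ _ (hY.shift 1) g, zero_comp]

lemma hl_E {D : LD T} (l : List (HEl 𝒜)) : ∀ {X : T}, D.HL X → D.HL (K.E X l) := by
  induction l with
  | nil => intro X h; exact h
  | cons s l ih => intro X h; exact ih (K.hl_F s h)

lemma _root_.BIKaux.LD.HL.isZero {D : LD T} {X : T} (h : D.HL X) (h2 : D.Mem X) : IsZero X :=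
  (IsZero.iff_id_eq_zero X).2 (h _ h2 _)

end CN

end Can

section Tors

variable {R : Type u} [Ring R] {𝒜 : ℤ → AddSubgroup R} [GradedRing 𝒜]
variable {T : Type u'} [Category.{v} T] [HasZeroObject T] [Preadditive T] [HasShift T ℤ]
  [∀ n : ℤ, (CategoryTheory.shiftFunctor T n).Additive] [Pretriangulated T]
  [HasCoproducts.{v} T]
variable {A : CenterAction 𝒜 T}

lemma hsmul_zero_iff (s : HEl 𝒜) {X Y : T} {n : ℤ} (f : X ⟶ Y⟦n⟧) :
    A.hsmul s.2.2 f = 0 ↔ f ≫ ac A s (Y⟦n⟧) = 0 := by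
  unfold CenterAction.hsmul
  constructor
  · intro h
    have h2 := congrArg (fun x => x ≫ (shiftFunctorAdd' T n s.1 (n + s.1) rfl).hom.app Y) h
    change f ≫ A.act s.1 s.2.1 s.2.2 (Y⟦n⟧) = 0
    simpa using h2
  · intro h
    rw [← Category.assoc]
    rw [show f ≫ A.act s.1 s.2.1 s.2.2 (Y⟦n⟧) = 0 from h, zero_comp]

lemma tv_iff {V : Set (SpecR 𝒜)} {X : T} : X ∈ TVset T A V ↔ ∀ C : T, IsCompactObj T C →
    ∀ q : SpecR 𝒜, q ∉ V → ∀ (n : ℤ) (f : C ⟶ X⟦n⟧), ∃ s : HEl 𝒜, s.2.1 ∉ q.1.toIdeal ∧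
      f ≫ ac A s (X⟦n⟧) = 0 := by
  constructor
  · intro h C hC q hq n f
    obtain ⟨i, s, hs, h1, h2⟩ := h C hC q hq n f
    exact ⟨⟨i, s, hs⟩, h1, (hsmul_zero_iff ⟨i, s, hs⟩ f).1 h2⟩
  · intro h C hC q hq n f
    obtain ⟨s, h1, h2⟩ := h C hC q hq n f
    exact ⟨s.1, s.2.1, s.2.2, h1, (hsmul_zero_iff s f).2 h2⟩

lemma ac_iso_zero {s : HEl 𝒜} {C X Y : T} (i : X ≅ Y) (f : C ⟶ X)
    (h : (f ≫ i.hom) ≫ ac A s Y = 0) : f ≫ ac A s X = 0 := by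
  rw [Category.assoc, ac_nat] at h
  have h2 := congrArg (fun x => x ≫ (i.inv)⟦s.1⟧') h
  simpa [← Functor.map_comp] using h2

lemma tv_shift {V : Set (SpecR 𝒜)} {X : T} (h : X ∈ TVset T A V) (a : ℤ) :
    X⟦a⟧ ∈ TVset T A V := by
  rw [tv_iff] at h ⊢
  intro C hC q hq n f
  let i := (shiftFunctorAdd T a n).symm.app X
  obtain ⟨s, h1, h2⟩ := h C hC q hq (a + n) (f ≫ i.hom)
  exact ⟨s, h1, ac_iso_zero i f h2⟩

lemma one_not_mem (q : SpecR 𝒜) : (1 : R) ∉ q.1.toIdeal :=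
  fun h => q.2.ne_top ((Ideal.eq_top_iff_one _).2 h)

lemma tv_of_kills {V : Set (SpecR 𝒜)} {X : T}
    (h : ∀ q : SpecR 𝒜, q ∉ V → ∃ s : HEl 𝒜, s.2.1 ∉ q.1.toIdeal ∧ Kills A s X) :
    X ∈ TVset T A V := by
  rw [tv_iff]
  intro C hC q hq n f
  obtain ⟨s, h1, h2⟩ := h q hq
  exact ⟨s, h1, by rw [show ac A s (X⟦n⟧) = 0 from h2.shift n, comp_zero]⟩

lemma tv_zero {V : Set (SpecR 𝒜)} {X : T} (h : IsZero X) : X ∈ TVset T A V := by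
  refine tv_of_kills fun q _ => ⟨⟨0, 1, SetLike.one_mem_graded 𝒜⟩, one_not_mem q, ?_⟩
  exact h.eq_of_src _ _

def ldB (B : BIKData A) (V : Set (SpecR 𝒜)) (hV : SpecClosed V) : LD T where
  Γ := B.Γ V
  L := B.Lf V
  γ := B.γ V
  η := B.η V
  δ := B.δ V
  tri := B.tri V hV
  Lη_iso := B.Lη_iso V hV
  Lη_eq := B.Lη_eq V hV
  zero_mem X hX := (B.kerL V hV X).2 (tv_zero hX)
  shift_mem X n hX := (B.kerL V hV _).2 (tv_shift ((B.kerL V hV X).1 hX) n)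

lemma ldB_mem {B : BIKData A} {V : Set (SpecR 𝒜)} {hV : SpecClosed V} {X : T} :
    (ldB B V hV).Mem X ↔ X ∈ TVset T A V := B.kerL V hV X

lemma zset_closed (p : SpecR 𝒜) : SpecClosed (Zset p) :=
  fun _ _ hq h h2 => hq (h.trans h2)

lemma vp_closed (p : SpecR 𝒜) : SpecClosed (Vp p) :=
  fun _ _ hq h => le_trans (show p.1.toIdeal ≤ _ from hq) h

structure IsGen (p : SpecR 𝒜) (l : List (HEl 𝒜)) : Prop where
  mem : ∀ s ∈ l, s.2.1 ∈ p.1.toIdeal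
  gen : ∀ q : SpecR 𝒜, (∀ s ∈ l, s.2.1 ∈ q.1.toIdeal) → p.1.toIdeal ≤ q.1.toIdeal

lemma IsGen.sq {p : SpecR 𝒜} {l : List (HEl 𝒜)} (h : IsGen p l) : IsGen p (l.map HEl.sq) where
  mem s hs := by
    obtain ⟨t, ht, rfl⟩ := List.mem_map.1 hs
    exact p.1.toIdeal.mul_mem_left _ (h.mem t ht)
  gen q hq := h.gen q fun s hs => by
    have := hq _ (List.mem_map_of_mem (f := HEl.sq) hs)
    exact (q.2.mem_or_mem s.2.2 s.2.2 this).elim id id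

lemma exists_gen (hn : IsNoetherianRing R) (p : SpecR 𝒜) : ∃ l, IsGen p l := by
  classical
  have h1 := p.1.isHomogeneous.toIdeal_homogeneousCore_eq_self
  have h2 : Ideal.span ({x : R | SetLike.IsHomogeneousElem 𝒜 x ∧ x ∈ p.1.toIdeal}) = p.1.toIdeal := by
    apply le_antisymm
    · exact Ideal.span_le.2 fun x hx => hx.2
    · rw [← h1]
      change Ideal.span _ ≤ _
      apply Ideal.span_mono
      rintro _ ⟨x, hx, rfl⟩
      refine ⟨x.2, ?_⟩
      have h3 := p.1.isHomogeneous.toIdeal_homogeneousCore_eq_self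
      first
        | exact hx
        | (rw [h3]; exact hx)
  have h3 : (Ideal.span ({x : R | SetLike.IsHomogeneousElem 𝒜 x ∧ x ∈ p.1.toIdeal})).FG :=
    IsNoetherian.noetherian _
  obtain ⟨S, hS, hS2⟩ := (Submodule.fg_span_iff_fg_span_finset_subset _).1 h3
  have h4 : ∀ x : S, ∃ s : HEl 𝒜, s.2.1 = x.1 := fun x => by
    obtain ⟨⟨i, hi⟩, _⟩ := hS x.2
    exact ⟨⟨i, x.1, hi⟩, rfl⟩
  choose φ hφ using h4
  refine ⟨S.attach.toList.map φ, ⟨?_, ?_⟩⟩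
  · intro s hs
    obtain ⟨t, _, rfl⟩ := List.mem_map.1 hs
    rw [hφ]; exact (hS t.2).2
  · intro q hq
    rw [← h2]
    change Submodule.span R _ ≤ _
    rw [hS2]
    refine Submodule.span_le.2 fun x hx => ?_
    have := hq (φ ⟨x, hx⟩) (List.mem_map_of_mem (by simp))
    rw [hφ] at this
    exact this

lemma IsGen.tv {p : SpecR 𝒜} {l : List (HEl 𝒜)} (h : IsGen p l) {X : T}
    (hX : ∀ s ∈ l, Kills A s X) : X ∈ TVset T A (Vp p) := by
  refine tv_of_kills fun q hq => ?_
  by_contra hc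
  push Not at hc
  refine hq (h.gen q fun s hs => ?_)
  by_contra h2
  exact hc s h2 (hX s hs)

end Tors

end BIKaux

namespace BIKaux

open scoped ZeroObject
open BIK MonoidalCategory

section CG

variable {T : Type u'} [Category.{v} T] [HasZeroObject T] [Preadditive T] [HasShift T ℤ]
  [∀ n : ℤ, (CategoryTheory.shiftFunctor T n).Additive] [Pretriangulated T]
  [HasCoproducts.{v} T]

lemma loc_orth (W : T) : IsLocalizing T {X : T | Orth X W} where
  zero_mem X hX := fun j f => hX.eq_of_src _ _
  iso_mem i h := h.src_iso i
  shift_mem X h n := h.src_shift n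
  ext_mem Tr hT h1 h2 := fun j f => by
    obtain ⟨ψ, hψ⟩ := Triangle.yoneda_exact₃ _ hT f (h2 j _)
    rw [hψ, (show Orth Tr.obj₁ W from h1).src_shift 1 j ψ, comp_zero]
  coprod_mem J f h := fun j φ => by
    refine Sigma.hom_ext _ _ fun i => ?_
    rw [comp_zero]
    exact h i j _

lemma cg (hgen : CompactlyGen T) {W : T} (h : ∀ C : T, IsCompactObj T C → Orth C W) :
    IsZero W := by
  obtain ⟨ι, g, hg, hL⟩ := hgen
  have h1 : W ∈ Loc T (Set.range g) := by rw [hL]; trivial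
  have h2 : W ∈ {X : T | Orth X W} := by
    refine Set.mem_sInter.1 h1 _ ⟨loc_orth W, ?_⟩
    rintro _ ⟨i, rfl⟩
    exact h _ (hg i)
  exact (IsZero.iff_id_eq_zero W).2 ((show Orth W W from h2).hom_zero _)

end CG

section Ann

variable {R : Type u} [Ring R] {𝒜 : ℤ → AddSubgroup R} [GradedRing 𝒜]
variable {T : Type u'} [Category.{v} T] [HasZeroObject T] [Preadditive T] [HasShift T ℤ]
  [∀ n : ℤ, (CategoryTheory.shiftFunctor T n).Additive] [Pretriangulated T]
  [HasCoproducts.{v} T]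
variable (A : CenterAction 𝒜 T)

lemma act_congr {i j : ℤ} {a b : R} (ha : a ∈ 𝒜 i) (hb : b ∈ 𝒜 j) (hij : i = j) (hab : a = b)
    {C M : T} (x : C ⟶ M) : x ≫ A.act i a ha M = 0 ↔ x ≫ A.act j b hb M = 0 := by
  subst hij; subst hab; rfl

lemma act_zero (i : ℤ) (M : T) : A.act i 0 (zero_mem _) M = 0 := by
  have h := A.act_add i 0 0 (zero_mem _) (zero_mem _) M
  simp only [add_zero] at h
  simpa using h

lemma act_zero' (i : ℤ) {a : R} (ha : a ∈ 𝒜 i) (h : a = 0) (M : T) : A.act i a ha M = 0 := by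
  subst h; exact act_zero A i M

lemma act_neg_zero {i : ℤ} {a : R} (ha : a ∈ 𝒜 i) {C M : T} (x : C ⟶ M)
    (h : x ≫ A.act i a ha M = 0) : x ≫ A.act i (-a) (neg_mem ha) M = 0 := by
  have h1 := A.act_add i a (-a) ha (neg_mem ha) M
  rw [act_zero' A i _ (add_neg_cancel a)] at h1
  have h2 := congrArg (fun y => x ≫ y) h1
  simp only [Preadditive.comp_add, h, comp_zero, zero_add] at h2
  exact h2.symm

/-- annihilation by a product -/
lemma act_mul_zero {i j : ℤ} {a b : R} (ha : a ∈ 𝒜 i) (hb : b ∈ 𝒜 j) {C M : T} (x : C ⟶ M) :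
    x ≫ A.act (i + j) (a * b) (SetLike.mul_mem_graded ha hb) M = 0 ↔
      (x ≫ A.act j b hb M) ≫ A.act i a ha (M⟦j⟧) = 0 := by
  rw [A.act_mul]
  constructor
  · intro h
    have h2 := congrArg (fun y => y ≫ (shiftFunctorAdd' T j i (i + j) (by ring)).hom.app M) h
    simpa using h2
  · intro h
    rw [← Category.assoc, ← Category.assoc, h, zero_comp]

lemma act_mul_zero_left {i j : ℤ} {a b : R} (ha : a ∈ 𝒜 i) (hb : b ∈ 𝒜 j) {C M : T} (x : C ⟶ M)
    (h : x ≫ A.act j b hb M = 0) :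
    x ≫ A.act (i + j) (a * b) (SetLike.mul_mem_graded ha hb) M = 0 := by
  rw [act_mul_zero A ha hb, h, zero_comp]

def KillsD {C M : T} (x : C ⟶ M) (r : R) : Prop :=
  ∀ i : ℤ, x ≫ A.act i (DirectSum.decompose 𝒜 r i : R) (SetLike.coe_mem _) M = 0

lemma killsD_hom {C M : T} (x : C ⟶ M) {i : ℤ} {a : R} (ha : a ∈ 𝒜 i) :
    KillsD A x a ↔ x ≫ A.act i a ha M = 0 := by
  constructor
  · intro h
    exact (act_congr A _ _ rfl (DirectSum.decompose_of_mem_same 𝒜 ha) x).1 (h i)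
  · intro h j
    by_cases hij : i = j
    · subst hij
      exact (act_congr A _ _ rfl (DirectSum.decompose_of_mem_same 𝒜 ha) x).2 h
    · rw [act_zero' A j _ (DirectSum.decompose_of_mem_ne 𝒜 ha hij), comp_zero]

lemma killsD_add {C M : T} (x : C ⟶ M) {a b : R} (ha : KillsD A x a) (hb : KillsD A x b) :
    KillsD A x (a + b) := by
  intro i
  have h1 := A.act_add i _ _ (SetLike.coe_mem (DirectSum.decompose 𝒜 a i))
    (SetLike.coe_mem (DirectSum.decompose 𝒜 b i)) M
  refine (act_congr A (add_mem (SetLike.coe_mem (DirectSum.decompose 𝒜 a i))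
    (SetLike.coe_mem (DirectSum.decompose 𝒜 b i))) _ rfl (by simp) x).1 ?_
  rw [h1, Preadditive.comp_add, ha i, hb i, add_zero]

lemma killsD_zero {C M : T} (x : C ⟶ M) : KillsD A x (0 : R) := by
  intro i
  rw [act_zero' A i _ (by simp), comp_zero]

lemma killsD_mul {C M : T} (x : C ⟶ M) (r : R) {a : R} (ha : KillsD A x a) :
    KillsD A x (r * a) := by
  induction r using DirectSum.Decomposition.inductionOn 𝒜 with
  | zero => rw [zero_mul]; exact killsD_zero A x
  | @homogeneous j r =>
    intro i
    have h1 : (DirectSum.decompose 𝒜 ((r : R) * a) (j + (i - j)) : R) =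
      r * DirectSum.decompose 𝒜 a (i - j) :=
      DirectSum.coe_decompose_mul_add_of_left_mem 𝒜 r.2
    refine (act_congr A _ (SetLike.coe_mem _) (by ring) (h1.symm.trans (by
      rw [show j + (i - j) = i by ring])) x).1
      (act_mul_zero_left A r.2 (SetLike.coe_mem (DirectSum.decompose 𝒜 a (i - j))) x (ha _))
  | add r r' h h' => rw [add_mul]; exact killsD_add A x h h'

def AnnI {C M : T} (x : C ⟶ M) : Ideal R where
  carrier := {r | KillsD A x r}
  add_mem' := killsD_add A x
  zero_mem' := killsD_zero A x
  smul_mem' r _ h := killsD_mul A x r h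

lemma mem_ann {C M : T} {x : C ⟶ M} {i : ℤ} {a : R} (ha : a ∈ 𝒜 i) :
    a ∈ AnnI A x ↔ x ≫ A.act i a ha M = 0 := killsD_hom A x ha

lemma ann_hom {C M : T} (x : C ⟶ M) : (AnnI A x).IsHomogeneous 𝒜 := by
  intro i r hr
  exact (mem_ann A (SetLike.coe_mem _)).2 (hr i)

lemma ann_le {C M : T} {x : C ⟶ M} {I : Ideal R} (h : ∀ (i : ℤ) (a : R) (ha : a ∈ 𝒜 i),
    x ≫ A.act i a ha M = 0 → a ∈ I) : AnnI A x ≤ I := by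
  classical
  intro r hr
  rw [← DirectSum.sum_support_decompose 𝒜 r]
  exact Ideal.sum_mem _ fun i _ => h i _ (SetLike.coe_mem _) (hr i)

lemma ann_le_mul (hcomm : IsGradedComm 𝒜) {C M : T} (x : C ⟶ M) {j : ℤ} {b : R} (hb : b ∈ 𝒜 j) :
    AnnI A x ≤ AnnI A (x ≫ A.act j b hb M) := by
  refine ann_le A fun i a ha h => ?_
  rw [mem_ann A ha, ← act_mul_zero A ha hb]
  have h1 := act_mul_zero_left A hb ha x h
  rw [← mem_ann A] at h1 ⊢
  rw [hcomm i j a b ha hb]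
  exact zsmul_mem h1 _

lemma exists_ann_prime (hcomm : IsGradedComm 𝒜) (hn : IsNoetherianRing R) {C t : T} {n : ℤ}
    (f : C ⟶ t⟦n⟧) (hf : f ≠ 0) : ∃ (q : SpecR 𝒜) (m : ℤ) (x : C ⟶ t⟦m⟧), x ≠ 0 ∧
      q.1.toIdeal = AnnI A x := by
  obtain ⟨I, ⟨M, m, ⟨e⟩, x, hx, rfl⟩, hI⟩ := set_has_maximal_iff_noetherian.2 hn
    {I : Ideal R | ∃ (M : T) (m : ℤ) (_ : Nonempty (M ≅ t⟦m⟧)) (x : C ⟶ M), x ≠ 0 ∧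
      I = AnnI A x} ⟨_, _, n, ⟨Iso.refl _⟩, f, hf, rfl⟩
  refine ⟨⟨⟨_, ann_hom A x⟩, ⟨?_, ?_⟩⟩, m, x ≫ e.hom, ?_, ?_⟩
  · intro h
    have h1 : (1 : R) ∈ AnnI A x := by
      rw [show AnnI A x = ⊤ from h]; trivial
    rw [mem_ann A (SetLike.one_mem_graded 𝒜), A.act_one] at h1
    apply hx
    have h2 := congrArg (fun y => y ≫ (shiftFunctorZero T ℤ).hom.app M) h1
    simpa using h2
  · intro i j a b ha hb hab
    change a ∈ AnnI A x ∨ b ∈ AnnI A x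
    by_cases hbx : b ∈ AnnI A x
    · exact Or.inr hbx
    left
    have hab' : a * b ∈ AnnI A x := hab
    rw [mem_ann A (SetLike.mul_mem_graded ha hb), act_mul_zero A ha hb, ← mem_ann A ha] at hab'
    have h1 := ann_le_mul A hcomm x hb
    have h2 := hI (AnnI A (x ≫ A.act j b hb M)) ⟨_, m + j,
      ⟨(shiftFunctor T j).mapIso e ≪≫ (shiftFunctorAdd T m j).symm.app t⟩, _,
      fun h => hbx ((mem_ann A hb).2 h), rfl⟩
    rw [eq_of_le_of_not_lt h1 h2]
    exact hab'
  · intro h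
    apply hx
    have h2 := congrArg (fun y => y ≫ e.inv) h
    simpa using h2
  · change AnnI A x = _
    apply le_antisymm
    · refine ann_le A fun i a ha h => ?_
      rw [mem_ann A ha, Category.assoc, A.act_natural, ← Category.assoc, h, zero_comp]
    · refine ann_le A fun i a ha h => ?_
      rw [mem_ann A ha]
      exact ac_iso_zero (s := ⟨i, a, ha⟩) e x h

end Ann

section Tors2

variable {R : Type u} [Ring R] {𝒜 : ℤ → AddSubgroup R} [GradedRing 𝒜]
variable {T : Type u'} [Category.{v} T] [HasZeroObject T] [Preadditive T] [HasShift T ℤ]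
  [∀ n : ℤ, (CategoryTheory.shiftFunctor T n).Additive] [Pretriangulated T]
  [HasCoproducts.{v} T] [MonoidalCategory T] [SymmetricCategory T]
variable {A : CenterAction 𝒜 T} (K : CN A)

lemma CN.tors1 (hcomm : IsGradedComm 𝒜) (hn : IsNoetherianRing R) (hgen : CompactlyGen T)
    {p : SpecR 𝒜} {t : T} (ht : t ∈ TVset T A (Vp p)) {s : HEl 𝒜} (hs : s.2.1 ∈ p.1.toIdeal)
    (hz : IsZero (t ⊗ K.F s)) : IsZero t := by
  refine cg hgen fun C hC n f => ?_
  by_contra hf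
  obtain ⟨q, m, x, hx, hq⟩ := exists_ann_prime A hcomm hn f hf
  have hsq : s.2.1 ∉ q.1.toIdeal := by
    rw [hq, mem_ann A s.2.2]
    intro h
    obtain ⟨a, c, hT⟩ := K.triF s (t⟦m⟧)
    obtain ⟨ψ, hψ⟩ := co2 hT x h
    have hz2 : IsZero (t⟦m⟧ ⊗ K.F s) :=
      (((shiftFunctor T m).map_isZero (hz.of_iso (β_ _ _)))).of_iso
        (β_ _ _ ≪≫ K.tshift (K.F s) t m)
    rw [hψ, hz2.eq_of_tgt ψ 0, zero_comp] at hx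
    exact hx rfl
  have hqV : q ∉ Vp p := fun h => hsq (h hs)
  obtain ⟨s', h1, h2⟩ := tv_iff.1 ht C hC q hqV m x
  rw [hq, mem_ann A s'.2.2] at h1
  exact h1 h2

lemma CN.mem_F (K : CN A) {D : LD T} {X : T} (h : D.Mem X) (s : HEl 𝒜) : D.Mem (X ⊗ K.F s) := by
  obtain ⟨a, c, hT⟩ := K.triF s X
  exact LD.mem1 hT h (h.shift _)

lemma CN.mem_E (K : CN A) {D : LD T} (l : List (HEl 𝒜)) :
    ∀ {X : T}, D.Mem X → D.Mem (K.E X l) := by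
  induction l with
  | nil => intro X h; exact h
  | cons s l ih => intro X h; exact ih (K.mem_F h s)

lemma CN.tors (hcomm : IsGradedComm 𝒜) (hn : IsNoetherianRing R) (hgen : CompactlyGen T)
    (B : BIKData A) {p : SpecR 𝒜} (l : List (HEl 𝒜)) (hl : ∀ s ∈ l, s.2.1 ∈ p.1.toIdeal) :
    ∀ {t : T}, t ∈ TVset T A (Vp p) → IsZero (K.E t l) → IsZero t := by
  induction l with
  | nil => intro t _ h; exact h
  | cons s l ih =>
    intro t ht h
    refine K.tors1 hcomm hn hgen ht (hl s List.mem_cons_self) ?_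
    refine ih (fun s hs => hl s (List.mem_cons_of_mem _ hs)) ?_ h
    rw [← ldB_mem (B := B) (hV := vp_closed p)] at ht ⊢
    exact K.mem_F ht s

end Tors2

end BIKaux

namespace BIKaux

open scoped ZeroObject
open BIK MonoidalCategory

section Cpt

variable {T : Type u'} [Category.{v} T] [HasZeroObject T] [Preadditive T] [HasShift T ℤ]
  [∀ n : ℤ, (CategoryTheory.shiftFunctor T n).Additive] [Pretriangulated T]
  [HasCoproducts.{v} T]

lemma sigmaHom_of (C : T) {J : Type v} (f : J → T) (x : DirectSum J fun j => (C ⟶ f j)) {Q : T}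
    (σ : (∐ f) ⟶ Q) (h : ∀ (j : J) (g : C ⟶ f j), (g ≫ Sigma.ι f j) ≫ σ = 0) :
    sigmaHom T C f x ≫ σ = 0 := by
  letI := Classical.decEq J
  induction x using DirectSum.induction_on with
  | zero => rw [map_zero, zero_comp]
  | of j g =>
    unfold sigmaHom
    rw [DirectSum.toAddMonoid_of]
    exact h j g
  | add x y hx hy => rw [map_add, Preadditive.add_comp, hx, hy, add_zero]

lemma cpt_zero {C : T} (hC : IsCompactObj T C) {J : Type v} (f : J → T) (m : ℤ) {Q : T}
    (φ : C ⟶ (∐ f)⟦m⟧) (σ : (∐ f)⟦m⟧ ⟶ Q)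
    (h : ∀ (j : J) (g : C ⟶ (f j)⟦m⟧), g ≫ (Sigma.ι f j)⟦m⟧' ≫ σ = 0) : φ ≫ σ = 0 := by
  let cmp := sigmaComparison (shiftFunctor T m) f
  have hi : IsIso cmp := inferInstance
  obtain ⟨x, hx⟩ := (hC J fun j => (f j)⟦m⟧).2 (φ ≫ inv cmp)
  have h1 := sigmaHom_of C (fun j => (f j)⟦m⟧) x (cmp ≫ σ) (fun j g => by
    rw [Category.assoc]
    change g ≫ Sigma.ι (fun j => (shiftFunctor T m).obj (f j)) j ≫
      sigmaComparison (shiftFunctor T m) f ≫ σ = 0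
    rw [ι_comp_sigmaComparison_assoc]
    exact h j g)
  rw [hx] at h1
  simpa using h1

lemma shift_src {C P Q : T} (σ : P ⟶ Q) (h : ∀ (m : ℤ) (φ : C ⟶ P⟦m⟧), φ ≫ σ⟦m⟧' = 0)
    (k m : ℤ) (φ : C⟦k⟧ ⟶ P⟦m⟧) : φ ≫ σ⟦m⟧' = 0 := by
  apply sh_zero (-k)
  have h1 := h (m + -k) ((shiftFunctorCompIsoId T k (-k) (by simp)).inv.app C ≫ φ⟦-k⟧' ≫
    (shiftFunctorAdd T m (-k)).inv.app P)
  have h2 := (shiftFunctorAdd T m (-k)).inv.naturality σ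
  simp only [Functor.comp_map] at h2
  simp only [Category.assoc] at h1
  rw [← h2] at h1
  have h3 := congrArg (fun x => (shiftFunctorCompIsoId T k (-k) (by simp)).hom.app C ≫ x ≫
    (shiftFunctorAdd T m (-k)).hom.app Q) h1
  simpa using h3

lemma shift_src0 {C P Q : T} (σ : P ⟶ Q) (h : ∀ (m : ℤ) (φ : C ⟶ P⟦m⟧), φ ≫ σ⟦m⟧' = 0)
    (k : ℤ) (φ : C⟦k⟧ ⟶ P) : φ ≫ σ = 0 := by
  have h1 := shift_src σ h k 0 (φ ≫ (shiftFunctorZero T ℤ).inv.app P)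
  have h2 := (shiftFunctorZero T ℤ).inv.naturality σ
  simp only [Functor.id_map] at h2
  rw [Category.assoc, ← h2] at h1
  have h3 := congrArg (fun x => x ≫ (shiftFunctorZero T ℤ).hom.app Q) h1
  simpa using h3

lemma cone_zero (hgen : CompactlyGen T) {P W : T} (σ : P ⟶ P)
    (hσ : ∀ C : T, IsCompactObj T C → ∀ (m : ℤ) (φ : C ⟶ P⟦m⟧), φ ≫ σ⟦m⟧' = 0)
    {g : P ⟶ W} {d : W ⟶ P⟦(1 : ℤ)⟧} (hT : Triangle.mk (𝟙 P - σ) g d ∈ distTriang T) :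
    IsZero W := by
  refine cg hgen fun C hC j f => ?_
  let e := (shiftFunctorCompIsoId T (-j) j (by simp)).app C
  obtain ⟨f', hf'⟩ := (shiftFunctor T j).map_surjective (e.hom ≫ f)
  have h0 : f' = 0 := by
    have h1 : f' ≫ d = 0 := by
      have h2 : (f' ≫ d) ≫ (𝟙 P - σ)⟦(1 : ℤ)⟧' = 0 := by
        rw [Category.assoc, z31 hT, comp_zero]
      rw [Functor.map_sub, CategoryTheory.Functor.map_id, Preadditive.comp_sub, Category.comp_id,
        shift_src σ (hσ C hC), sub_zero] at h2
      exact h2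
    obtain ⟨ψ, rfl⟩ := co3 hT f' h1
    have h3 : ψ = ψ ≫ (𝟙 P - σ) := by
      rw [Preadditive.comp_sub, Category.comp_id, shift_src0 σ (hσ C hC), sub_zero]
    rw [h3, Category.assoc, z12 hT, comp_zero]
  rw [h0, Functor.map_zero] at hf'
  have h2 := congrArg (fun x => e.inv ≫ x) hf'
  simpa using h2.symm

noncomputable def shm (Xs : ℕ → T) (fs : ∀ n, Xs n ⟶ Xs (n + 1)) :
    (∐ fun n : ULift.{v} ℕ => Xs n.down) ⟶ (∐ fun n : ULift.{v} ℕ => Xs n.down) :=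
  Sigma.desc fun n => fs n.down ≫ Sigma.ι (fun n : ULift.{v} ℕ => Xs n.down) ⟨n.down + 1⟩

lemma ι_shm (Xs : ℕ → T) (fs : ∀ n, Xs n ⟶ Xs (n + 1)) (n : ℕ) :
    Sigma.ι (fun n : ULift.{v} ℕ => Xs n.down) ⟨n⟩ ≫ shm Xs fs =
      fs n ≫ Sigma.ι (fun n : ULift.{v} ℕ => Xs n.down) ⟨n + 1⟩ := by
  unfold shm
  rw [Sigma.ι_desc]

lemma shm_null (Xs : ℕ → T) (fs : ∀ n, Xs n ⟶ Xs (n + 1))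
    {C : T} (hC : IsCompactObj T C)
    (h : ∀ (n : ℕ) (m : ℤ) (φ : C ⟶ (Xs n)⟦m⟧), φ ≫ (fs n)⟦m⟧' = 0)
    (m : ℤ) (φ : C ⟶ (∐ fun n : ULift.{v} ℕ => Xs n.down)⟦m⟧) : φ ≫ (shm Xs fs)⟦m⟧' = 0 := by
  refine cpt_zero hC _ m φ _ fun j g => ?_
  rw [← Functor.map_comp]
  obtain ⟨j⟩ := j
  rw [ι_shm, Functor.map_comp, ← Category.assoc, h, zero_comp]

lemma ac_unshift_zero {R : Type u} [Ring R] {𝒜 : ℤ → AddSubgroup R} [GradedRing 𝒜]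
    {A : CenterAction 𝒜 T} {s : HEl 𝒜} {X Y : T} (n : ℤ) (f : Y ⟶ X)
    (h : f⟦n⟧' ≫ ac A s (X⟦n⟧) = 0) : f ≫ ac A s X = 0 := by
  apply sh_zero n
  unfold ac at h ⊢
  rw [A.act_shift, Preadditive.comp_zsmul, ← Category.assoc, ← Functor.map_comp] at h
  have h1 := congrArg (fun x => ((-1 : ℤ) ^ (s.1 * n).natAbs) • x) h
  simp only [smul_zero, smul_smul, ← mul_pow] at h1
  have h2 := congrArg (fun x => x ≫ (shiftComm X s.1 n).inv) h1
  simpa using h2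

end Cpt

section Ideal

variable {R : Type u} [Ring R] {𝒜 : ℤ → AddSubgroup R} [GradedRing 𝒜]
variable {T : Type u'} [Category.{v} T] [HasZeroObject T] [Preadditive T] [HasShift T ℤ]
  [∀ n : ℤ, (CategoryTheory.shiftFunctor T n).Additive] [Pretriangulated T]
  [HasCoproducts.{v} T] [MonoidalCategory T] [SymmetricCategory T]

lemma TH.hom_ext (H : TH T) (X : T) {J : Type v} (f : J → T) {Q : T} (a b : X ⊗ ∐ f ⟶ Q)
    (h : ∀ j, X ◁ Sigma.ι f j ≫ a = X ◁ Sigma.ι f j ≫ b) : a = b := by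
  have := H.hcop X J f
  rw [← cancel_epi (Sigma.desc fun j => X ◁ Sigma.ι f j : (∐ fun j => X ⊗ f j) ⟶ X ⊗ ∐ f)]
  refine Sigma.hom_ext _ _ fun j => ?_
  rw [Sigma.ι_desc_assoc, Sigma.ι_desc_assoc]
  exact h j

lemma TH.exists_desc (H : TH T) (X : T) {J : Type v} (f : J → T) {Q : T}
    (a : ∀ j, X ⊗ f j ⟶ Q) : ∃ F : X ⊗ ∐ f ⟶ Q, ∀ j, X ◁ Sigma.ι f j ≫ F = a j := by
  have := H.hcop X J f
  refine ⟨inv (Sigma.desc fun j => X ◁ Sigma.ι f j : (∐ fun j => X ⊗ f j) ⟶ X ⊗ ∐ f) ≫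
    Sigma.desc a, fun j => ?_⟩
  have h1 : X ◁ Sigma.ι f j = Sigma.ι (fun j => X ⊗ f j) j ≫
    (Sigma.desc fun j => X ◁ Sigma.ι f j : (∐ fun j => X ⊗ f j) ⟶ X ⊗ ∐ f) := by
    rw [Sigma.ι_desc]
  rw [h1, Category.assoc, IsIso.hom_inv_id_assoc, Sigma.ι_desc]

variable {A : CenterAction 𝒜 T} (K : CN A)

lemma CN.memZ_F (B : BIKData A) (p : SpecR 𝒜) (s : HEl 𝒜) (hs : s.2.1 ∉ p.1.toIdeal) (X Y : T) :
    (ldB B (Zset p) (zset_closed p)).Mem (X ⊗ (Y ⊗ K.F s)) := by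
  rw [ldB_mem]
  refine tv_of_kills fun q hq => ⟨s.sq, ?_, K.kills_tensor (K.kills_F s Y) X⟩
  have hq' : q.1.toIdeal ≤ p.1.toIdeal := by
    by_contra h; exact hq h
  intro h
  exact (p.2.mem_or_mem s.2.2 s.2.2 (hq' h)).elim hs hs

lemma CN.step (K : CN A) (B : BIKData A) (p : SpecR 𝒜) (Y : T) :
    ∃ (Z : T) (g : Y ⟶ Z),
      ((ldB B (Zset p) (zset_closed p)).Mem Y → (ldB B (Zset p) (zset_closed p)).Mem Z) ∧
      ((ldB B (Zset p) (zset_closed p)).Mem Y → ∀ C : T, IsCompactObj T C →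
        ∀ (k : ℤ) (φ : C ⟶ Y⟦k⟧), φ ≫ g⟦k⟧' = 0) ∧
      (∀ X L : T, (ldB B (Zset p) (zset_closed p)).IsLoc L → ∀ h : X ⊗ Y ⟶ L,
        ∃ h' : X ⊗ Z ⟶ L, h = X ◁ g ≫ h') := by
  let J : Type v := {j : Idx T // ∃ s : HEl 𝒜, s.2.1 ∉ p.1.toIdeal ∧ K.ix s = j}
  choose a c hac using fun j : J => K.triM j.1 Y
  let d : (∐ fun j : J => Y ⊗ Fo j.1) ⟶ Y := Sigma.desc a
  have hd : ∀ j, Sigma.ι (fun j : J => Y ⊗ Fo j.1) j ≫ d = a j := fun j => Sigma.ι_desc _ _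
  have hmem : ∀ (X : T) (j : J), (ldB B (Zset p) (zset_closed p)).Mem (X ⊗ (Y ⊗ Fo j.1)) := by
    rintro X ⟨_, s, hs, rfl⟩
    exact K.memZ_F B p s hs X Y
  obtain ⟨Z, g, h, hT⟩ := distinguished_cocone_triangle d
  refine ⟨Z, g, ?_, ?_, ?_⟩
  · intro hY
    refine LD.mem3 hT (LD.mem_coprod _ fun j => ?_) hY
    exact (hmem (𝟙_ T) j).of_iso (λ_ _)
  · intro hY C hC k φ
    rw [ldB_mem, tv_iff] at hY
    obtain ⟨s, hs, h1⟩ := hY C hC p (fun h => h le_rfl) k φ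
    let e := (shiftFunctorCompIsoId T (-k) k (by simp)).app C
    obtain ⟨f', hf'⟩ := (shiftFunctor T k).map_surjective (e.hom ≫ φ)
    have h2 : f' ≫ ac A s Y = 0 := by
      apply ac_unshift_zero k
      rw [hf', Category.assoc, h1, comp_zero]
    let j : J := ⟨K.ix s, s, hs, rfl⟩
    rw [K.ac_eq] at h2
    obtain ⟨ψ, hψ⟩ := co2 (hac j) f' h2
    have h3 : f' ≫ g = 0 := by
      rw [hψ, ← hd j, Category.assoc, Category.assoc, z12 hT, comp_zero, comp_zero]
    have h4 : φ = e.inv ≫ f'⟦k⟧' := by rw [hf']; simp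
    rw [h4, Category.assoc, ← Functor.map_comp, h3, Functor.map_zero, comp_zero]
  · intro X L hL θ
    refine yo2 (K.ex X hT) θ ?_
    refine K.hom_ext X _ _ _ fun j => ?_
    rw [comp_zero]
    exact LD.K1 (hmem X j) hL _

lemma CN.idealZ (K : CN A) (hgen : CompactlyGen T) (B : BIKData A) (p : SpecR 𝒜) (X : T) {Y : T}
    (hY : (ldB B (Zset p) (zset_closed p)).Mem Y) :
    (ldB B (Zset p) (zset_closed p)).Mem (X ⊗ Y) := by
  choose N g h1 h2 h3 using K.step B p
  refine LD.K2' fun L hL f => ?_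
  let Ys : ℕ → T := fun n => Nat.rec Y (fun _ Z => N Z) n
  let gs : ∀ n, Ys n ⟶ Ys (n + 1) := fun n => g (Ys n)
  have hYs : ∀ n, (ldB B (Zset p) (zset_closed p)).Mem (Ys n) := by
    intro n
    induction n with
    | zero => exact hY
    | succ n ih => exact h1 _ ih
  choose ex hex using h3
  let fs : ∀ n, (X ⊗ Ys n ⟶ L) := fun n => Nat.rec f (fun n φ => ex (Ys n) X L hL φ) n
  have hfs : ∀ n, fs n = X ◁ gs n ≫ fs (n + 1) := fun n => hex (Ys n) X L hL (fs n)
  obtain ⟨W, q, d, hT⟩ := distinguished_cocone_triangle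
    (𝟙 (∐ fun n : ULift.{v} ℕ => Ys n.down) - shm Ys gs)
  have hW : IsZero W := cone_zero hgen (shm Ys gs)
    (fun C hC => shm_null Ys gs hC fun n => h2 (Ys n) (hYs n) C hC) hT
  obtain ⟨F, hF⟩ := K.exists_desc X (fun n : ULift.{v} ℕ => Ys n.down) (fun n => fs n.down)
  have hF0 : X ◁ (𝟙 (∐ fun n : ULift.{v} ℕ => Ys n.down) - shm Ys gs) ≫ F = 0 := by
    refine K.hom_ext X _ _ _ fun n => ?_
    rw [comp_zero, ← Category.assoc, ← MonoidalCategory.whiskerLeft_comp, Preadditive.comp_sub,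
      Category.comp_id]
    obtain ⟨n⟩ := n
    rw [ι_shm, K.wl_sub, Preadditive.sub_comp, MonoidalCategory.whiskerLeft_comp,
      Category.assoc, hF, hF]
    exact sub_eq_zero.2 (hfs n)
  obtain ⟨ψ, hψ⟩ := yo2 (K.ex X hT) F hF0
  have hF1 : F = 0 := by
    rw [hψ, (K.zero_right X hW).eq_of_src ψ 0, comp_zero]
  have h4 := hF ⟨0⟩
  rw [hF1, comp_zero] at h4
  exact h4.symm

end Ideal

end BIKaux

namespace BIKaux

open scoped ZeroObject
open BIK MonoidalCategory

section Ret

variable {T : Type u'} [Category.{v} T] [HasZeroObject T] [Preadditive T] [HasShift T ℤ]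
  [∀ n : ℤ, (CategoryTheory.shiftFunctor T n).Additive] [Pretriangulated T]

lemma LD.IsLoc.retract {D : LD T} {M W : T} (h : D.IsLoc W) (i : M ⟶ W) (r : W ⟶ M)
    (hir : i ≫ r = 𝟙 M) : D.IsLoc M := by
  have hW : IsIso (D.η.app W) := h
  have h1 : i ≫ D.η.app W = D.η.app M ≫ D.L.map i := D.η.naturality i
  have h2 : r ≫ D.η.app M = D.η.app W ≫ D.L.map r := D.η.naturality r
  refine ⟨⟨D.L.map i ≫ inv (D.η.app W) ≫ r, ?_, ?_⟩⟩
  · rw [← Category.assoc, ← h1]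
    simpa using hir
  · rw [Category.assoc, Category.assoc, h2, IsIso.inv_hom_id_assoc, ← D.L.map_comp, hir]
    simp

lemma iso1 {X Y Z : T} {f : X ⟶ Y} {g : Y ⟶ Z} {h : Z ⟶ X⟦(1 : ℤ)⟧}
    (hT : Triangle.mk f g h ∈ distTriang T) (hZ : IsZero Z) : Nonempty (X ≅ Y) := by
  have : IsIso f := (Triangle.isZero₃_iff_isIso₁ _ hT).1 hZ
  exact ⟨asIso f⟩

end Ret

section Main

variable {R : Type u} [Ring R] {𝒜 : ℤ → AddSubgroup R} [GradedRing 𝒜]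
variable {T : Type u'} [Category.{v} T] [HasZeroObject T] [Preadditive T] [HasShift T ℤ]
  [∀ n : ℤ, (CategoryTheory.shiftFunctor T n).Additive] [Pretriangulated T]
  [HasCoproducts.{v} T] [MonoidalCategory T] [SymmetricCategory T]
variable {A : CenterAction 𝒜 T} (K : CN A) (B : BIKData A) (p : SpecR 𝒜)

def DZ : LD T := ldB B (Zset p) (zset_closed p)
def DV : LD T := ldB B (Vp p) (vp_closed p)

structure PI : Prop where
  loc : IsLocalizing T (B.ΓPImage p)
  ten : ∀ (X Y : T), Y ∈ B.ΓPImage p → (X ⊗ Y) ∈ B.ΓPImage p ∧ (Y ⊗ X) ∈ B.ΓPImage p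

variable {B p}

lemma mem_P (X : T) : (DV B p).Γ.obj ((DZ B p).L.obj X) ∈ B.ΓPImage p := ⟨X, ⟨Iso.refl _⟩⟩

lemma of_mem_P {M : T} (h : M ∈ B.ΓPImage p) :
    ∃ X : T, Nonempty (M ≅ (DV B p).Γ.obj ((DZ B p).L.obj X)) := h

lemma PI.memV (hP : PI B p) {M : T} (h : M ∈ B.ΓPImage p) : (DV B p).Mem M := by
  obtain ⟨X, ⟨i⟩⟩ := of_mem_P h
  obtain ⟨X', ⟨i'⟩⟩ := of_mem_P (hP.loc.shift_mem _ h (-1))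
  exact LD.key i ((shiftFunctorCompIsoId T (-1 : ℤ) 1 (by norm_num)).app M) i'

lemma E_LV_zero {l : List (HEl 𝒜)} (hl : IsGen p l) (W : T) :
    IsZero (K.E ((DV B p).L.obj W) l) := by
  refine LD.HL.isZero (K.hl_E l ((DV B p).isLoc_L W).hl) ?_
  refine ldB_mem.2 (hl.sq.tv ?_)
  intro s hs
  obtain ⟨t, ht, rfl⟩ := List.mem_map.1 hs
  exact K.kills_E l ht _

lemma loc_of_P (K : CN A) {l : List (HEl 𝒜)} (hl : IsGen p l) {M : T} (h : M ∈ B.ΓPImage p)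
    (hk : ∀ s ∈ l, Kills A s M) : (DZ B p).IsLoc M := by
  obtain ⟨X, ⟨i⟩⟩ := of_mem_P h
  have hd : (DV B p).δ ((DZ B p).L.obj X) = 0 :=
    K.homH l _ _ (E_LV_zero K hl _) (fun s hs => ((hk s hs).of_iso i).shift 1) _
  obtain ⟨r, hr⟩ := yo1 ((DV B p).tri' ((DZ B p).L.obj X)) (𝟙 _) (by rw [hd, zero_comp])
  exact (((DZ B p).isLoc_L X).retract _ r hr.symm).of_iso i.symm

lemma orth_P (K : CN A) (hP : PI B p) {l : List (HEl 𝒜)} (hl : IsGen p l) {M : T} (h : M ∈ B.ΓPImage p)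
    (hk : ∀ s ∈ l, Kills A s M) (X : T) : Orth ((DZ B p).Γ.obj X) M := by
  intro j f
  have h1 := hP.loc.shift_mem _ h j
  have h2 := hP.loc.shift_mem _ h1 1
  have k1 : ∀ s ∈ l, Kills A s (M⟦j⟧) := fun s hs => (hk s hs).shift j
  obtain ⟨φ, rfl⟩ := LD.two (loc_of_P K hl h2 fun s hs => (k1 s hs).shift 1) f
  exact LD.one (loc_of_P K hl h1 k1) φ

lemma E_mem_P (hP : PI B p) (l : List (HEl 𝒜)) {N : T} (h : N ∈ B.ΓPImage p) :
    K.E N l ∈ B.ΓPImage p := by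
  obtain ⟨i⟩ := K.E_iso l N
  exact hP.loc.iso_mem i.symm (hP.ten _ _ h).2

lemma E_memZ (hP : PI B p) {l : List (HEl 𝒜)} (hl : IsGen p l) (X : T) :
    (DZ B p).Mem (K.E ((DZ B p).Γ.obj X) l) := by
  have hk : ∀ s ∈ l.map HEl.sq, Kills A s (K.E ((DZ B p).Γ.obj X) l) := by
    intro s hs
    obtain ⟨t, ht, rfl⟩ := List.mem_map.1 hs
    exact K.kills_E l ht _
  set b := K.E ((DZ B p).Γ.obj X) l with hb
  have hbV : (DV B p).Mem b := ldB_mem.2 (hl.sq.tv hk)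
  apply LD.K2
  obtain ⟨ψ, hψ⟩ := co2 ((DV B p).tri' ((DZ B p).L.obj b)) ((DZ B p).e b)
    (LD.K1 hbV ((DV B p).isLoc_L _) _)
  have h0 : ψ = 0 := by
    refine K.lift (l.map HEl.sq) hk _ (fun f => ?_) ψ
    have h1 : Orth ((DZ B p).Γ.obj X)
        (K.E ((DV B p).Γ.obj ((DZ B p).L.obj b)) (l.map HEl.sq)) := by
      refine orth_P K hP hl.sq.sq (E_mem_P K hP _ (mem_P b)) (fun s hs => ?_) X
      obtain ⟨t, ht, rfl⟩ := List.mem_map.1 hs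
      exact K.kills_E _ ht _
    exact (K.orth_E l h1).hom_zero f
  rw [hψ, h0, zero_comp]

lemma EI (l : List (HEl 𝒜)) (X : T) : Nonempty (K.E X l ≅ K.E (𝟙_ T) l ⊗ X) := by
  obtain ⟨i⟩ := K.E_iso l X
  exact ⟨i ≪≫ β_ _ _⟩

lemma kW_iso {l : List (HEl 𝒜)} (hl : IsGen p l) (W : T) :
    Nonempty (K.E (𝟙_ T) l ⊗ (DV B p).Γ.obj W ≅ K.E (𝟙_ T) l ⊗ W) := by
  obtain ⟨i⟩ := EI K l ((DV B p).L.obj W)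
  exact iso1 (K.ex (K.E (𝟙_ T) l) ((DV B p).tri' W)) ((E_LV_zero K hl W).of_iso i.symm)

lemma kW_mem (hP : PI B p) {l : List (HEl 𝒜)} (hl : IsGen p l) (X : T) :
    K.E (𝟙_ T) l ⊗ (DZ B p).L.obj X ∈ B.ΓPImage p := by
  obtain ⟨i⟩ := kW_iso K hl (B := B) ((DZ B p).L.obj X)
  exact hP.loc.iso_mem i (hP.ten _ _ (mem_P X)).1

lemma kG_mem (hP : PI B p) {l : List (HEl 𝒜)} (hl : IsGen p l) (X : T) :
    (DZ B p).Mem (K.E (𝟙_ T) l ⊗ (DZ B p).Γ.obj X) := by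
  obtain ⟨i⟩ := EI K l ((DZ B p).Γ.obj X)
  exact (E_memZ K hP hl X).of_iso i

lemma kW_zero_iff (hP : PI B p) {l : List (HEl 𝒜)} (hl : IsGen p l) (X : T) :
    IsZero (K.E (𝟙_ T) l ⊗ (DZ B p).L.obj X) ↔ (DZ B p).Mem (K.E (𝟙_ T) l ⊗ X) := by
  have hT := K.ex (K.E (𝟙_ T) l) ((DZ B p).tri' X)
  constructor
  · intro h
    exact LD.mem2 hT (kG_mem K hP hl X) (LD.Mem.zero h)
  · intro h
    have h1 := LD.mem3 hT (kG_mem K hP hl X) h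
    obtain ⟨i⟩ := EI K l ((DZ B p).L.obj X)
    exact ((K.hl_E l ((DZ B p).isLoc_L X).hl).of_iso i).isZero h1

lemma supp_iff (hcomm : IsGradedComm 𝒜) (hn : IsNoetherianRing R) (hgen : CompactlyGen T)
    (hP : PI B p) {l : List (HEl 𝒜)} (hl : IsGen p l) (X : T) :
    IsZero ((B.ΓP p).obj X) ↔ (DZ B p).Mem (K.E (𝟙_ T) l ⊗ X) := by
  rw [← kW_zero_iff K hP hl]
  change IsZero ((DV B p).Γ.obj ((DZ B p).L.obj X)) ↔ _
  obtain ⟨i⟩ := kW_iso K hl (B := B) ((DZ B p).L.obj X)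
  constructor
  · intro h
    exact (K.zero_right _ h).of_iso i.symm
  · intro h
    obtain ⟨j⟩ := EI K l ((DV B p).Γ.obj ((DZ B p).L.obj X))
    exact K.tors hcomm hn hgen B l hl.mem (ldB_mem.1 (hP.memV (mem_P X)))
      (h.of_iso (j ≪≫ i))

lemma sub_loc (K : CN A) (hgen : CompactlyGen T) (hP : PI B p) (Y : T) :
    IsLocalizing T {N | N ∈ B.ΓPImage p ∧ (DZ B p).Mem (Y ⊗ N)} ∧
    ∀ (X N : T), N ∈ {N | N ∈ B.ΓPImage p ∧ (DZ B p).Mem (Y ⊗ N)} →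
      (X ⊗ N) ∈ {N | N ∈ B.ΓPImage p ∧ (DZ B p).Mem (Y ⊗ N)} ∧
      (N ⊗ X) ∈ {N | N ∈ B.ΓPImage p ∧ (DZ B p).Mem (Y ⊗ N)} := by
  constructor
  · exact
      { zero_mem := fun X hX => ⟨hP.loc.zero_mem X hX, LD.Mem.zero (K.zero_right Y hX)⟩
        iso_mem := fun i h => ⟨hP.loc.iso_mem i h.1, h.2.of_iso (whiskerLeftIso Y i)⟩
        shift_mem := fun X h n => ⟨hP.loc.shift_mem X h.1 n,
          (h.2.shift n).of_iso (K.tshift Y X n).symm⟩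
        ext_mem := fun Tr hT h1 h2 => ⟨hP.loc.ext_mem Tr hT h1.1 h2.1,
          LD.mem3 (K.hexact Y Tr hT) h1.2 h2.2⟩
        coprod_mem := fun J f h => ⟨hP.loc.coprod_mem J f fun j => (h j).1, by
          have := K.hcop Y J f
          exact (LD.mem_coprod (D := DZ B p) (fun j => Y ⊗ f j) fun j => (h j).2).of_iso
            (asIso (Sigma.desc fun j => Y ◁ Sigma.ι f j : (∐ fun j => Y ⊗ f j) ⟶ Y ⊗ ∐ f))⟩ }
  · intro X N h
    have h1 : (DZ B p).Mem (Y ⊗ (N ⊗ X)) :=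
      (K.idealZ hgen B p X h.2).of_iso (β_ _ _ ≪≫ α_ _ _ _)
    exact ⟨⟨(hP.ten X N h.1).1, h1.of_iso (whiskerLeftIso Y (β_ _ _))⟩,
      ⟨(hP.ten X N h.1).2, h1⟩⟩

lemma main_aux (K : CN A) (hcomm : IsGradedComm 𝒜) (hn : IsNoetherianRing R) (hgen : CompactlyGen T)
    (hP : PI B p)
    (hmin : ∀ S' : Set T,
          (IsLocalizing T S' ∧ ∀ (X Y : T), Y ∈ S' → (X ⊗ Y) ∈ S' ∧ (Y ⊗ X) ∈ S') →
          S' ⊆ B.ΓPImage p →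
          (∀ X ∈ S', Limits.IsZero X) ∨ S' = B.ΓPImage p) (X Y : T) :
    IsZero ((B.ΓP p).obj (X ⊗ Y)) ↔
      (IsZero ((B.ΓP p).obj X) ∨ IsZero ((B.ΓP p).obj Y)) := by
  obtain ⟨l, hl⟩ := exists_gen hn p
  rw [supp_iff K hcomm hn hgen hP hl, supp_iff K hcomm hn hgen hP hl,
    supp_iff K hcomm hn hgen hP hl]
  have hid : ∀ (U : T) {V : T}, (DZ B p).Mem V → (DZ B p).Mem (U ⊗ V) :=
    fun U _ h => K.idealZ hgen B p U h
  set κ := K.E (𝟙_ T) l with hκ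
  constructor
  · intro h
    have h1 : (DZ B p).Mem (Y ⊗ (κ ⊗ X)) := h.of_iso ((α_ _ _ _).symm ≪≫ β_ _ _)
    have hT : ∀ Z : T, _ := fun Z => K.ex Y (K.ex κ ((DZ B p).tri' Z))
    have hG : ∀ Z : T, (DZ B p).Mem (Y ⊗ (κ ⊗ (DZ B p).Γ.obj Z)) :=
      fun Z => hid Y (kG_mem K hP hl Z)
    have h2 := LD.mem3 (hT X) (hG X) h1
    rcases hmin _ (sub_loc K hgen hP Y) (fun N h => h.1) with h3 | h3
    · left
      exact (kW_zero_iff K hP hl X).1 (h3 _ ⟨kW_mem K hP hl X, h2⟩)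
    · right
      have h4 : κ ⊗ (DZ B p).L.obj (𝟙_ T) ∈ {N | N ∈ B.ΓPImage p ∧ (DZ B p).Mem (Y ⊗ N)} := by
        rw [h3]; exact kW_mem K hP hl _
      have h5 := LD.mem2 (hT (𝟙_ T)) (hG _) h4.2
      exact h5.of_iso (whiskerLeftIso Y (ρ_ κ) ≪≫ β_ _ _)
  · rintro (h | h)
    · exact (hid Y h).of_iso (β_ _ _ ≪≫ α_ _ _ _)
    · exact (hid X h).of_iso ((α_ _ _ _).symm ≪≫ whiskerRightIso (β_ _ _) Y ≪≫ α_ _ _ _)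

end Main

end BIKaux

open BIK MonoidalCategory in
/-- Theorem (tensor product theorem): let `T` be a tensor triangulated category (symmetric
monoidal, tensor exact in each variable and coproduct preserving, unit compact) with a
canonical `R`-action. If `R` stratifies `T` (each `Γ_p T` is zero or minimal among tensor
ideal localizing subcategories), then `supp_R (X ⊗ Y) = supp_R X ∩ supp_R Y`. -/
theorem statement_11
    {R : Type u} [Ring R] (𝒜 : ℤ → AddSubgroup R) [GradedRing 𝒜]
    (hcomm : IsGradedComm 𝒜) (hnoeth : IsNoetherianRing R)
    {T : Type u'} [Category.{v} T] [HasZeroObject T] [Preadditive T] [HasShift T ℤ]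
    [∀ n : ℤ, (CategoryTheory.shiftFunctor T n).Additive] [Pretriangulated T]
    [HasCoproducts.{v} T]
    [MonoidalCategory T] [SymmetricCategory T]
    (hgen : CompactlyGen T)
    -- the compatibility isomorphisms of the tensor product with the shift
    (tshift : ∀ (X Y : T) (n : ℤ), (X ⊗ Y⟦n⟧) ≅ (X ⊗ Y)⟦n⟧)
    (htshift : ∀ (X : T) {Y Y' : T} (g : Y ⟶ Y') (n : ℤ),
      (X ◁ g⟦n⟧') ≫ (tshift X Y' n).hom = (tshift X Y n).hom ≫ ((X ◁ g)⟦n⟧'))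
    -- the tensor product is exact in each variable
    (hexact : ∀ (X : T), ∀ Tr ∈ distTriang T,
      Triangle.mk (X ◁ Tr.mor₁) (X ◁ Tr.mor₂) ((X ◁ Tr.mor₃) ≫ (tshift X Tr.obj₁ 1).hom)
        ∈ distTriang T)
    -- the tensor product preserves coproducts
    (hcop : ∀ (X : T) (J : Type v) (f : J → T),
      IsIso (Sigma.desc fun j => X ◁ Sigma.ι f j : (∐ fun j => X ⊗ f j) ⟶ X ⊗ ∐ f))
    -- the unit is compact
    (hunit : IsCompactObj T (𝟙_ T))
    (A : CenterAction 𝒜 T) (B : BIKData A)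
    -- the action is canonical: it is induced by a homomorphism `R → End*(𝟙)`
    (u : ∀ (i : ℤ) (a : R), a ∈ 𝒜 i → ((𝟙_ T) ⟶ (𝟙_ T)⟦i⟧))
    (hcanon : ∀ (i : ℤ) (a : R) (ha : a ∈ 𝒜 i) (X : T),
      A.act i a ha X =
        (ρ_ X).inv ≫ (X ◁ u i a ha) ≫ (tshift X (𝟙_ T) i).hom ≫ ((ρ_ X).hom)⟦i⟧')
    -- `R` stratifies `T`: each `Γ_p T` is zero or minimal among tensor ideal localizing
    -- subcategories
    (hst : ∀ p : SpecR 𝒜,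
      (∀ X ∈ B.ΓPImage p, Limits.IsZero X) ∨
      ((IsLocalizing T (B.ΓPImage p) ∧
          ∀ (X Y : T), Y ∈ B.ΓPImage p → (X ⊗ Y) ∈ B.ΓPImage p ∧ (Y ⊗ X) ∈ B.ΓPImage p) ∧
        (∃ X ∈ B.ΓPImage p, ¬ Limits.IsZero X) ∧
        ∀ S' : Set T,
          (IsLocalizing T S' ∧ ∀ (X Y : T), Y ∈ S' → (X ⊗ Y) ∈ S' ∧ (Y ⊗ X) ∈ S') →
          S' ⊆ B.ΓPImage p →
          (∀ X ∈ S', Limits.IsZero X) ∨ S' = B.ΓPImage p)) :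
    ∀ X Y : T, B.suppObj (X ⊗ Y) = B.suppObj X ∩ B.suppObj Y := by
  intro X Y
  let K : BIKaux.CN A :=
    { tshift := tshift, htshift := htshift, hexact := hexact, hcop := hcop, u := u,
      hcanon := hcanon }
  ext p
  rcases hst p with h0 | ⟨hP, _, hmin⟩
  · have hz : ∀ Z : T, p ∉ B.suppObj Z := fun Z hZ => hZ (h0 _ ⟨Z, ⟨Iso.refl _⟩⟩)
    exact ⟨fun h => absurd h (hz _), fun h => absurd h.1 (hz _)⟩
  · have h := BIKaux.main_aux K hcomm hnoeth hgen ⟨hP.1, hP.2⟩ hmin X Y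
    change ¬ IsZero ((B.ΓP p).obj (X ⊗ Y)) ↔
      (¬ IsZero ((B.ΓP p).obj X) ∧ ¬ IsZero ((B.ΓP p).obj Y))
    rw [h, not_or]
end

section
/- Let T be a compactly generated triangulated category with arbitrary coproducts. If a localizing subcategory S of T is generated by a set of objects (i.e. S = Loc_T(G) for some set G of objects), then there exists a localization functor L : T → T with Ker L = S. -/
open CategoryTheory CategoryTheory.Limits CategoryTheory.Pretriangulated

universe w v u u'

set_option linter.unusedSectionVars false
set_option linter.unusedVariables false
set_option linter.unusedTactic false
set_option linter.unreachableTactic false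
set_option linter.style.longLine false
set_option linter.style.haveILetI false

namespace BIK

section Dist

variable {T : Type u'} [Category.{v} T] [HasZeroObject T] [Preadditive T] [HasShift T ℤ]
  [∀ n : ℤ, (CategoryTheory.shiftFunctor T n).Additive] [Pretriangulated T]

/-- Distinguished triangles, in unbundled form. -/
def Dist {A B C : T} (f : A ⟶ B) (g : B ⟶ C) (d : C ⟶ A⟦(1 : ℤ)⟧) : Prop :=
  Triangle.mk f g d ∈ distTriang T

namespace Dist

variable {A B C : T} {f : A ⟶ B} {g : B ⟶ C} {d : C ⟶ A⟦(1 : ℤ)⟧}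

lemma zero12 (h : Dist f g d) : f ≫ g = 0 := comp_distTriang_mor_zero₁₂ _ h

lemma zero23 (h : Dist f g d) : g ≫ d = 0 := comp_distTriang_mor_zero₂₃ _ h

lemma zero31 (h : Dist f g d) : d ≫ f⟦(1 : ℤ)⟧' = 0 := comp_distTriang_mor_zero₃₁ _ h

lemma desc2 (h : Dist f g d) {X : T} (φ : B ⟶ X) (hφ : f ≫ φ = 0) : ∃ ψ : C ⟶ X, g ≫ ψ = φ := by
  obtain ⟨ψ, hψ⟩ := Triangle.yoneda_exact₂ _ h φ hφ
  exact ⟨ψ, hψ.symm⟩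

lemma desc3 (h : Dist f g d) {X : T} (φ : C ⟶ X) (hφ : g ≫ φ = 0) :
    ∃ ψ : A⟦(1 : ℤ)⟧ ⟶ X, d ≫ ψ = φ := by
  obtain ⟨ψ, hψ⟩ := Triangle.yoneda_exact₃ _ h φ hφ
  exact ⟨ψ, hψ.symm⟩

lemma lift1 (h : Dist f g d) {X : T} (φ : X ⟶ A⟦(1 : ℤ)⟧) (hφ : φ ≫ f⟦(1 : ℤ)⟧' = 0) :
    ∃ ψ : X ⟶ C, ψ ≫ d = φ := by
  obtain ⟨ψ, hψ⟩ := Triangle.coyoneda_exact₁ _ h φ hφ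
  exact ⟨ψ, hψ.symm⟩

lemma lift2 (h : Dist f g d) {X : T} (φ : X ⟶ B) (hφ : φ ≫ g = 0) :
    ∃ ψ : X ⟶ A, ψ ≫ f = φ := by
  obtain ⟨ψ, hψ⟩ := Triangle.coyoneda_exact₂ _ h φ hφ
  exact ⟨ψ, hψ.symm⟩

lemma lift3 (h : Dist f g d) {X : T} (φ : X ⟶ C) (hφ : φ ≫ d = 0) :
    ∃ ψ : X ⟶ B, ψ ≫ g = φ := by
  obtain ⟨ψ, hψ⟩ := Triangle.coyoneda_exact₃ _ h φ hφ
  exact ⟨ψ, hψ.symm⟩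

lemma isIso1 (h : Dist f g d) (hC : IsZero C) : IsIso f :=
  (Triangle.isZero₃_iff_isIso₁ _ h).1 hC

lemma isZero3 (h : Dist f g d) (hA : IsZero A) (hB : IsZero B) : IsZero C :=
  Triangle.isZero₃_of_isZero₁₂ _ h hA hB

lemma exists_cone {A B : T} (f : A ⟶ B) :
    ∃ (C : T) (g : B ⟶ C) (d : C ⟶ A⟦(1 : ℤ)⟧), Dist f g d :=
  distinguished_cocone_triangle f

lemma exists_fib {B C : T} (g : B ⟶ C) :
    ∃ (A : T) (f : A ⟶ B) (d : C ⟶ A⟦(1 : ℤ)⟧), Dist f g d :=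
  distinguished_cocone_triangle₁ g

lemma exists_mor (h : Dist f g d) {A' B' C' : T} {f' : A' ⟶ B'} {g' : B' ⟶ C'}
    {d' : C' ⟶ A'⟦(1 : ℤ)⟧} (h' : Dist f' g' d') (a : A ⟶ A') (b : B ⟶ B')
    (hab : f ≫ b = a ≫ f') :
    ∃ c : C ⟶ C', g ≫ c = b ≫ g' ∧ d ≫ a⟦(1 : ℤ)⟧' = c ≫ d' :=
  complete_distinguished_triangle_morphism _ _ h h' a b hab

end Dist

end Dist

end BIK
namespace BIK

section PartA

open Cardinal
open scoped ZeroObject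

variable {T : Type u'} [Category.{v} T] [HasZeroObject T] [Preadditive T] [HasShift T ℤ]
  [∀ n : ℤ, (CategoryTheory.shiftFunctor T n).Additive] [Pretriangulated T]
  [HasCoproducts.{v} T]

lemma sigma_exact {I : Type v} {A B C : I → T} {f : ∀ i, A i ⟶ B i} {g : ∀ i, B i ⟶ C i}
    {d : ∀ i, C i ⟶ (A i)⟦(1 : ℤ)⟧} (h : ∀ i, Dist (f i) (g i) (d i))
    {t : T} (φ : t ⟶ ∐ B) (hφ : φ ≫ Limits.Sigma.map g = 0) :
    ∃ ψ : t ⟶ ∐ A, ψ ≫ Limits.Sigma.map f = φ := by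
  obtain ⟨D, g', d', hD⟩ := Dist.exists_cone (Limits.Sigma.map f)
  have : ∀ i, ∃ c : C i ⟶ D, g i ≫ c = Sigma.ι B i ≫ g' := by
    intro i
    obtain ⟨c, hc, -⟩ := (h i).exists_mor hD (Sigma.ι A i) (Sigma.ι B i) (by simp)
    exact ⟨c, hc⟩
  choose c hc using this
  have hg : g' = Limits.Sigma.map g ≫ Sigma.desc c := by
    apply Sigma.hom_ext
    intro i
    simp [hc]
  exact hD.lift2 φ (by rw [hg, reassoc_of% hφ, zero_comp])

lemma isZero_sigma {I : Type v} {f : I → T} (h : ∀ i, IsZero (f i)) : IsZero (∐ f) := by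
  rw [IsZero.iff_id_eq_zero]
  apply Sigma.hom_ext
  intro i
  exact (h i).eq_of_src _ _

/-- Closure of a class of objects under isomorphisms, shifts, cones, and coproducts with at most
`κ` nonzero terms. -/
inductive Clo (κ : Cardinal.{v}) (A : Set T) : T → Prop
  | base (X : T) (hX : X ∈ A) : Clo κ A X
  | zero (X : T) (hX : IsZero X) : Clo κ A X
  | iso {X Y : T} (e : X ≅ Y) (hX : Clo κ A X) : Clo κ A Y
  | shift (X : T) (n : ℤ) (hX : Clo κ A X) : Clo κ A (X⟦n⟧)
  | cone {X Y Z : T} (f : X ⟶ Y) (g : Y ⟶ Z) (d : Z ⟶ X⟦(1 : ℤ)⟧) (h : Dist f g d)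
      (hX : Clo κ A X) (hY : Clo κ A Y) : Clo κ A Z
  | coprod {I : Type v} (f : I → T) (hf : ∀ i, Clo κ A (f i))
      (hκ : #{i // ¬ IsZero (f i)} ≤ κ) : Clo κ A (∐ f)

lemma Clo.mono {κ κ' : Cardinal.{v}} (h : κ ≤ κ') {A : Set T} {X : T} (hX : Clo κ A X) :
    Clo κ' A X := by
  induction hX with
  | base X hX => exact .base X hX
  | zero X hX => exact .zero X hX
  | iso e _ ih => exact .iso e ih
  | shift X n _ ih => exact .shift X n ih
  | cone f g d h _ _ ih₁ ih₂ => exact .cone f g d h ih₁ ih₂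
  | coprod f _ hκ ih => exact .coprod f ih (hκ.trans h)

lemma Clo.mem {κ : Cardinal.{v}} {A : Set T} {S : Set T} (hS : IsLocalizing T S) (hA : A ⊆ S)
    {X : T} (hX : Clo κ A X) : X ∈ S := by
  induction hX with
  | base X hX => exact hA hX
  | zero X hX => exact hS.zero_mem X hX
  | iso e _ ih => exact hS.iso_mem e ih
  | shift X n _ ih => exact hS.shift_mem X ih n
  | cone f g d h _ _ ih₁ ih₂ => exact hS.ext_mem _ h ih₁ ih₂
  | coprod f _ hκ ih => exact hS.coprod_mem _ f ih

lemma Clo.biprod {κ : Cardinal.{v}} {A : Set T} {X Y : T} (hX : Clo κ A X) (hY : Clo κ A Y) :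
    Clo κ A (X ⊞ Y) :=
  .cone _ _ _ (inv_rot_of_distTriang _ (binaryBiproductTriangle_distinguished X Y))
    (.shift _ _ hY) hX

lemma isZero_biprod {X Y : T} (hX : IsZero X) (hY : IsZero Y) : IsZero (X ⊞ Y) := by
  rw [IsZero.iff_id_eq_zero]
  apply biprod.hom_ext'
  · exact hX.eq_of_src _ _
  · exact hY.eq_of_src _ _

lemma IsLocalizing.fib_mem {S : Set T} (hS : IsLocalizing T S) {X Y Z : T} {f : X ⟶ Y}
    {g : Y ⟶ Z} {d : Z ⟶ X⟦(1 : ℤ)⟧} (h : Dist f g d) (hY : Y ∈ S) (hZ : Z ∈ S) : X ∈ S := by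
  have h1 : X⟦(1 : ℤ)⟧ ∈ S := hS.ext_mem _ (rot_of_distTriang _ h) hY hZ
  exact hS.iso_mem ((shiftFunctorCompIsoId T (1 : ℤ) (-1) (by simp)).app X)
    (hS.shift_mem _ h1 (-1))

lemma card_supp_le_of_or {κ : Cardinal.{v}} (hκ : ℵ₀ ≤ κ) {I : Type v} {p q r : I → Prop}
    (hp : #{i // p i} ≤ κ) (hq : #{i // q i} ≤ κ) (h : ∀ i, r i → p i ∨ q i) :
    #{i // r i} ≤ κ := by
  have h1 : {i | r i} ⊆ {i | p i} ∪ {i | q i} := fun i hi => h i hi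
  calc #{i // r i} ≤ #({i | p i} ∪ {i | q i} : Set I) := mk_le_mk_of_subset h1
    _ ≤ #{i // p i} + #{i // q i} := mk_union_le _ _
    _ ≤ κ := add_le_of_le hκ hp hq

/-- A map to a coproduct factors through a small coproduct of maps from objects in the closure. -/
def FacMap (κ : Cardinal.{v}) (A : Set T) {I : Type v} {Y : I → T} {t : T} (f : t ⟶ ∐ Y) : Prop :=
  ∃ (s : I → T) (u : t ⟶ ∐ s) (v : ∀ i, s i ⟶ Y i),
    (∀ i, Clo κ A (s i)) ∧ #{i // ¬ IsZero (s i)} ≤ κ ∧ u ≫ Limits.Sigma.map v = f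

/-- Every map from `t` to a coproduct of objects in `S` factors as in `FacMap`. -/
def Fac (κ : Cardinal.{v}) (A S : Set T) (t : T) : Prop :=
  ∀ (I : Type v) (Y : I → T), (∀ i, Y i ∈ S) → ∀ f : t ⟶ ∐ Y, FacMap κ A f

lemma FacMap.precomp {κ : Cardinal.{v}} {A : Set T} {I : Type v} {Y : I → T} {t t' : T}
    {f : t ⟶ ∐ Y} (hf : FacMap κ A f) (g : t' ⟶ t) : FacMap κ A (g ≫ f) := by
  obtain ⟨s, u, v, h1, h2, rfl⟩ := hf
  exact ⟨s, g ≫ u, v, h1, h2, by simp⟩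

lemma facMap_zero (κ : Cardinal.{v}) (A : Set T) {I : Type v} (Y : I → T) (t : T) :
    FacMap κ A (0 : t ⟶ ∐ Y) := by
  refine ⟨fun _ => 0, 0, fun _ => 0, fun i => .zero _ (isZero_zero T), ?_, by simp⟩
  have : IsEmpty {i : I // ¬ IsZero (0 : T)} := ⟨fun i => i.2 (isZero_zero T)⟩
  simp

lemma FacMap.add {κ : Cardinal.{v}} (hκ : ℵ₀ ≤ κ) {A : Set T} {I : Type v} {Y : I → T} {t : T}
    {f f' : t ⟶ ∐ Y} (hf : FacMap κ A f) (hf' : FacMap κ A f') : FacMap κ A (f + f') := by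
  obtain ⟨s, u, v, h1, h2, rfl⟩ := hf
  obtain ⟨s', u', v', h1', h2', rfl⟩ := hf'
  refine ⟨fun i => s i ⊞ s' i, u ≫ Limits.Sigma.map (fun i => biprod.inl) +
    u' ≫ Limits.Sigma.map (fun i => biprod.inr), fun i => biprod.desc (v i) (v' i),
    fun i => (h1 i).biprod (h1' i), card_supp_le_of_or hκ h2 h2' ?_, ?_⟩
  · intro i hi
    by_contra! h
    exact hi (isZero_biprod h.1 h.2)
  · rw [Preadditive.add_comp, Category.assoc, Category.assoc]
    congr 2 <;> (apply Sigma.hom_ext; intro i; simp)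

lemma Fac.iso {κ : Cardinal.{v}} {A S : Set T} {t t' : T} (e : t ≅ t') (h : Fac κ A S t) :
    Fac κ A S t' := fun I Y hY f => by
  simpa using (h I Y hY (e.hom ≫ f)).precomp e.inv

lemma Fac.cone {κ : Cardinal.{v}} (hκ : ℵ₀ ≤ κ) {A S : Set T} (hS : IsLocalizing T S)
    (hAS : A ⊆ S) {t t' t'' : T} {a : t ⟶ t'} {b : t' ⟶ t''} {d : t'' ⟶ t⟦(1 : ℤ)⟧}
    (h : Dist a b d) (h0 : Fac κ A S t) (h1 : Fac κ A S (t⟦(1 : ℤ)⟧)) (h' : Fac κ A S t') :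
    Fac κ A S t'' := by
  intro I Y hY f
  obtain ⟨s', u', v', hs', hc', e'⟩ := h' I Y hY (b ≫ f)
  choose F i dF hF using fun i => Dist.exists_fib (v' i)
  obtain ⟨w, hw⟩ := sigma_exact hF (a ≫ u') (by
    rw [Category.assoc, e', ← Category.assoc, h.zero12, zero_comp])
  obtain ⟨s, u, v, hs, hc, e⟩ := h0 I F (fun i => hS.fib_mem (hF i) ((hs' i).mem hS hAS) (hY i)) w
  choose s'' g'' d'' hD using fun j => Dist.exists_cone (v j ≫ i j)
  have hz : ∀ j, (v j ≫ i j) ≫ v' j = 0 := fun j => by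
    rw [Category.assoc, (hF j).zero12, comp_zero]
  choose v'' hv'' using fun j => (hD j).desc2 (v' j) (hz j)
  obtain ⟨u'', hu''⟩ := h.desc2 (u' ≫ Limits.Sigma.map g'') (by
    have : Limits.Sigma.map v ≫ Limits.Sigma.map i ≫ Limits.Sigma.map g'' = 0 := by
      apply Sigma.hom_ext
      intro j
      have := (hD j).zero12
      rw [Category.assoc] at this
      simp [reassoc_of% this]
    rw [← Category.assoc, ← hw, ← e, Category.assoc, Category.assoc, this, comp_zero])
  have hdiff : b ≫ (f - u'' ≫ Limits.Sigma.map v'') = 0 := by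
    rw [Preadditive.comp_sub, ← Category.assoc, hu'', ← e', Category.assoc, sub_eq_zero]
    congr 1
    apply Sigma.hom_ext
    intro j
    simp [reassoc_of% (hv'' j)]
  obtain ⟨r, hr⟩ := h.desc3 _ hdiff
  have hf : f = u'' ≫ Limits.Sigma.map v'' + d ≫ r := by rw [hr]; abel
  rw [hf]
  refine FacMap.add hκ ⟨s'', u'', v'', fun j => .cone _ _ _ (hD j) (hs j) (hs' j),
    card_supp_le_of_or hκ hc hc' ?_, rfl⟩ ((h1 I Y hY r).precomp d)
  intro j hj
  by_contra! h
  exact hj ((hD j).isZero3 h.1 h.2)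

lemma Fac.coprod {κ : Cardinal.{v}} (hκ : ℵ₀ ≤ κ) {A S : Set T}
    {J : Type v} (t : J → T) (ht : ∀ j, Fac κ A S (t j)) (hc : #{j // ¬ IsZero (t j)} ≤ κ) :
    Fac κ A S (∐ t) := by
  intro I Y hY f
  have : ∀ j, ∃ (s : I → T) (u : t j ⟶ ∐ s) (v : ∀ i, s i ⟶ Y i),
    (∀ i, Clo κ A (s i)) ∧ #{i // ¬ IsZero (s i)} ≤ κ ∧ u ≫ Limits.Sigma.map v = Sigma.ι t j ≫ f ∧
      (IsZero (t j) → ∀ i, IsZero (s i)) := by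
    intro j
    by_cases hj : IsZero (t j)
    · refine ⟨fun _ => 0, 0, fun _ => 0, fun i => .zero _ (isZero_zero T), ?_, 
        hj.eq_of_src _ _, fun _ _ => isZero_zero T⟩
      have : IsEmpty {i : I // ¬ IsZero (0 : T)} := ⟨fun i => i.2 (isZero_zero T)⟩
      simp
    · obtain ⟨s, u, v, h1, h2, h3⟩ := ht j I Y hY (Sigma.ι t j ≫ f)
      exact ⟨s, u, v, h1, h2, h3, fun h => (hj h).elim⟩
  choose s u v h1 h2 h3 h4 using this
  refine ⟨fun i => ∐ fun j => s j i,
    Sigma.desc fun j => u j ≫ Limits.Sigma.map (fun i => Sigma.ι (fun j => s j i) j),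
    fun i => Sigma.desc fun j => v j i, fun i => .coprod _ (fun j => h1 j i) ?_, ?_, ?_⟩
  · refine le_trans (mk_le_mk_of_subset (s := {j | ¬ IsZero (s j i)})
      (t := {j | ¬ IsZero (t j)}) ?_) hc
    intro j hj hj'
    exact hj (h4 j hj' i)
  · have hex : ∀ x : {i // ¬ IsZero (∐ fun j => s j i)}, ∃ j, ¬ IsZero (s j x.1) := by
      intro x
      by_contra! h
      exact x.2 (isZero_sigma h)
    choose j hj using hex
    let φ : {i // ¬ IsZero (∐ fun j => s j i)} →
      Σ (j : {j // ¬ IsZero (t j)}), {i // ¬ IsZero (s j.1 i)} :=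
      fun x => ⟨⟨j x, fun h => hj x (h4 _ h _)⟩, ⟨x.1, hj x⟩⟩
    have hφ : Function.Injective φ := by
      intro x y hxy
      have : (φ x).2.1 = (φ y).2.1 := by rw [hxy]
      exact Subtype.ext this
    refine (mk_le_of_injective hφ).trans ?_
    rw [mk_sigma]
    refine (sum_le_mk_mul_iSup _).trans ?_
    refine (mul_le_mul' hc (ciSup_le' fun j : {j // ¬ IsZero (t j)} => h2 j.1)).trans ?_
    rw [mul_eq_self hκ]
  · apply Sigma.hom_ext
    intro j
    rw [← h3 j]
    simp only [colimit.ι_desc_assoc, Cofan.mk_pt, Cofan.mk_ι_app, Category.assoc, Discrete.functor_obj_eq_as]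
    congr 1
    apply Sigma.hom_ext
    intro i
    simp

/-- The shift commutes with coproducts. -/
lemma shift_sigma_iso {I : Type v} (f : I → T) (n : ℤ) :
    Nonempty ((∐ fun i => (f i)⟦n⟧) ≅ (∐ f)⟦n⟧) :=
  ⟨asIso (sigmaComparison (shiftFunctor T n) f)⟩

lemma isZero_shift_iff (X : T) (n : ℤ) : IsZero (X⟦n⟧) ↔ IsZero X := by
  constructor
  · intro h
    rw [IsZero.iff_id_eq_zero]
    apply (shiftFunctor T n).map_injective
    exact h.eq_of_src _ _
  · intro h
    exact (shiftFunctor T n).map_isZero h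

theorem Clo.fac {κ : Cardinal.{v}} (hκ : ℵ₀ ≤ κ) {A S : Set T} (hS : IsLocalizing T S)
    (hAS : A ⊆ S) (hbase : ∀ a ∈ A, ∀ n : ℤ, Fac κ A S (a⟦n⟧)) {t : T} (ht : Clo κ A t) :
    ∀ n : ℤ, Fac κ A S (t⟦n⟧) := by
  induction ht with
  | base X hX => exact hbase X hX
  | zero X hX =>
    intro n I Y hY f
    have : f = 0 := ((isZero_shift_iff X n).2 hX).eq_of_src _ _
    rw [this]
    exact facMap_zero _ _ _ _
  | iso e _ ih => exact fun n => (ih n).iso ((shiftFunctor T n).mapIso e)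
  | shift X m _ ih => exact fun n => (ih (m + n)).iso ((shiftFunctorAdd T m n).app X)
  | cone f g d h _ _ ih₁ ih₂ =>
    intro n
    have := Triangle.shift_distinguished _ h n
    exact Fac.cone hκ hS hAS this (ih₁ n) ((ih₁ (n + 1)).iso ((shiftFunctorAdd T n 1).app _))
      (ih₂ n)
  | coprod f _ hc ih =>
    intro n
    refine (Fac.coprod hκ _ (fun i => ih i n) ?_).iso (shift_sigma_iso f n).some
    simpa only [isZero_shift_iff] using hc

end PartA

end BIK
namespace BIK

section PartC

variable {T : Type u'} [Category.{v} T] [HasZeroObject T] [Preadditive T] [HasShift T ℤ]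
  [∀ n : ℤ, (CategoryTheory.shiftFunctor T n).Additive] [Pretriangulated T]
  [HasCoproducts.{v} T]

theorem exists_localization_of_triangles (S : Set T) (hS : IsLocalizing T S)
    (h : ∀ X : T, ∃ (A B : T) (f : A ⟶ X) (g : X ⟶ B) (d : B ⟶ A⟦(1 : ℤ)⟧),
      Dist f g d ∧ A ∈ S ∧ ∀ Y ∈ S, ∀ φ : Y ⟶ B, φ = 0) :
    ∃ (L : T ⥤ T) (ηL : 𝟭 T ⟶ L)
      (eL : ∀ X : T, L.obj (X⟦(1 : ℤ)⟧) ≅ (L.obj X)⟦(1 : ℤ)⟧),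
      (∀ Tr ∈ distTriang T,
        Triangle.mk (L.map Tr.mor₁) (L.map Tr.mor₂) (L.map Tr.mor₃ ≫ (eL Tr.obj₁).hom)
          ∈ distTriang T) ∧
      (∀ X : T, IsIso (L.map (ηL.app X))) ∧
      (∀ X : T, L.map (ηL.app X) = ηL.app (L.obj X)) ∧
      {X : T | Limits.IsZero (L.obj X)} = S := by
  choose A B f g d hT hA hB using h
  let P : ObjectProperty T := fun X => X ∈ S
  haveI : P.IsStableUnderShift ℤ :=
    { isStableUnderShiftBy := fun n => ⟨fun X hX => hS.shift_mem X hX n⟩ }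
  let Q := P.rightOrthogonal
  have hQ : ∀ X, Q (B X) := fun X Y φ hY => hB X Y hY φ
  have hbij : ∀ (X : T) (Y : Q.FullSubcategory),
      Function.Bijective (fun φ : (⟨B X, hQ X⟩ : Q.FullSubcategory) ⟶ Y => g X ≫ Q.ι.map φ) := by
    intro X Y
    constructor
    · intro a b hab
      apply Q.ι.map_injective
      rw [← sub_eq_zero]
      have hab' : g X ≫ Q.ι.map a = g X ≫ Q.ι.map b := hab
      obtain ⟨c, hc⟩ := (hT X).desc3 (Q.ι.map a - Q.ι.map b) (by
        erw [Preadditive.comp_sub, hab', sub_self])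
      rw [← hc]
      have : c = 0 := Y.property c (hS.shift_mem _ (hA X) 1)
      rw [this, comp_zero]
    · intro a
      obtain ⟨c, hc⟩ := (hT X).desc2 a (Y.property _ (hA X))
      exact ⟨ObjectProperty.homMk c, hc⟩
  let e : ∀ (X : T) (Y : Q.FullSubcategory),
    ((⟨B X, hQ X⟩ : Q.FullSubcategory) ⟶ Y) ≃ (X ⟶ Q.ι.obj Y) :=
    fun X Y => Equiv.ofBijective _ (hbij X Y)
  have he : ∀ X Y Y' (g' : Y ⟶ Y') (h : _ ⟶ Y), e X Y' (h ≫ g') = e X Y h ≫ Q.ι.map g' := by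
    intro X Y Y' g' h
    simp [e]
  let F := Adjunction.leftAdjointOfEquiv e he
  let adj : F ⊣ Q.ι := Adjunction.adjunctionOfEquivLeft e he
  letI : F.CommShift ℤ := adj.leftAdjointCommShift ℤ
  haveI : adj.CommShift ℤ := adj.commShift_of_rightAdjoint ℤ
  haveI : F.IsTriangulated := adj.isTriangulated_leftAdjoint
  have hη : ∀ X, adj.unit.app X = g X := by
    intro X
    have h1 : adj.homEquiv X (F.obj X) (𝟙 (F.obj X)) = adj.unit.app X := by
      rw [adj.homEquiv_unit]
      simp
    have h2 : adj.homEquiv X (F.obj X) (𝟙 (F.obj X)) = e X (F.obj X) (𝟙 _) := by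
      simp [adj, Adjunction.adjunctionOfEquivLeft, Adjunction.mkOfHomEquiv_homEquiv]
      rfl
    rw [← h1, h2]
    simp [e]
  refine ⟨F ⋙ Q.ι, adj.unit, fun X => ((F ⋙ Q.ι).commShiftIso (1 : ℤ)).app X, ?_, ?_, ?_, ?_⟩
  · intro Tr hTr
    exact (F ⋙ Q.ι).map_distinguished Tr hTr
  · intro X
    dsimp
    infer_instance
  · intro X
    have h1 : adj.unit.app X ≫ (F ⋙ Q.ι).map (adj.unit.app X) =
      adj.unit.app X ≫ adj.unit.app ((F ⋙ Q.ι).obj X) := (adj.unit.naturality (adj.unit.app X)).symm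
    have h2 : Q.ι.preimage ((F ⋙ Q.ι).map (adj.unit.app X)) =
       Q.ι.preimage (adj.unit.app ((F ⋙ Q.ι).obj X)) := by
      apply (hbij X _).1
      dsimp only
      rw [Functor.map_preimage, Functor.map_preimage]
      simpa only [hη] using h1
    have := congrArg Q.ι.map h2
    rwa [Functor.map_preimage, Functor.map_preimage] at this
  · ext X
    constructor
    · intro hX
      have hX' : IsZero (B X) := hX
      have := (hT X).isIso1 hX'
      exact hS.iso_mem (asIso (f X)) (hA X)
    · intro hX
      change IsZero (B X)
      rw [IsZero.iff_id_eq_zero]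
      obtain ⟨c, hc⟩ := (hT X).desc3 (𝟙 (B X)) (by
        rw [Category.comp_id]; exact hB X X hX _)
      rw [← hc, hB X _ (hS.shift_mem _ (hA X) 1) c, comp_zero]

end PartC

end BIK
namespace BIK

section PartA2

open Cardinal
open scoped ZeroObject

variable {T : Type u'} [Category.{v} T] [HasZeroObject T] [Preadditive T] [HasShift T ℤ]
  [∀ n : ℤ, (CategoryTheory.shiftFunctor T n).Additive] [Pretriangulated T]
  [HasCoproducts.{v} T]

lemma Fac.shift {κ : Cardinal.{v}} {A S : Set T} (hS : IsLocalizing T S) {t : T}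
    (h : Fac κ A S t) (n : ℤ) : Fac κ A S (t⟦n⟧) := by
  intro I Y hY f
  let F := shiftFunctor T n
  let e : ∀ i, F.obj ((Y i)⟦-n⟧) ≅ Y i := fun i =>
    (shiftFunctorCompIsoId T (-n) n (by simp)).app (Y i)
  let Z : I → T := fun i => (Y i)⟦-n⟧
  let c : (∐ fun i => F.obj (Z i)) ≅ F.obj (∐ Z) := asIso (sigmaComparison F Z)
  let eY : (∐ fun i => F.obj (Z i)) ≅ ∐ Y := Sigma.mapIso e
  obtain ⟨f', hf'⟩ := F.map_surjective (f ≫ eY.inv ≫ c.hom)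
  obtain ⟨s, u, v, h1, h2, h3⟩ := h I Z (fun i => hS.shift_mem _ (hY i) _) f'
  let cs : (∐ fun i => F.obj (s i)) ≅ F.obj (∐ s) := asIso (sigmaComparison F s)
  refine ⟨fun i => F.obj (s i), F.map u ≫ cs.inv, fun i => F.map (v i) ≫ (e i).hom,
    fun i => .shift _ _ (h1 i), ?_, ?_⟩
  · simpa only [F, isZero_shift_iff] using h2
  · have key : Limits.Sigma.map (fun i => F.map (v i) ≫ (e i).hom) =
        cs.hom ≫ F.map (Limits.Sigma.map v) ≫ c.inv ≫ eY.hom := by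
      have : Limits.Sigma.map (fun i => F.map (v i)) ≫ c.hom =
          cs.hom ≫ F.map (Limits.Sigma.map v) := by
        apply Sigma.hom_ext
        intro i
        simp [c, cs, ← Functor.map_comp]
      rw [← reassoc_of% this]
      apply Sigma.hom_ext
      intro i
      simp [eY]
    rw [key]
    simp only [Category.assoc, Iso.inv_hom_id_assoc]
    rw [← F.map_comp_assoc, h3, hf']
    simp

lemma facMap_single {κ : Cardinal.{v}} (hκ : ℵ₀ ≤ κ) {A : Set T} {t : T} (ht : t ∈ A) {I : Type v}
    {Y : I → T} (j : I) (g : t ⟶ Y j) : FacMap κ A (g ≫ Sigma.ι Y j) := by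
  have h1κ : 1 ≤ κ := one_le_aleph0.trans hκ
  refine ⟨fun i => ∐ fun _ : ULift.{v} (PLift (j = i)) => t,
    Sigma.ι (fun _ : ULift.{v} (PLift (j = j)) => t) ⟨⟨rfl⟩⟩ ≫
      Sigma.ι (fun i => ∐ fun _ : ULift.{v} (PLift (j = i)) => t) j,
    fun i => Sigma.desc fun h => g ≫ eqToHom (by rw [h.down.down]), ?_, ?_, ?_⟩
  · intro i
    refine .coprod _ (fun _ => .base _ ht) (le_trans ?_ h1κ)
    rw [le_one_iff_subsingleton]
    infer_instance
  · refine le_trans ?_ h1κ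
    rw [le_one_iff_subsingleton]
    constructor
    have : ∀ i : {i // ¬ IsZero (∐ fun _ : ULift.{v} (PLift (j = i)) => t)}, j = i.1 := by
      intro i
      by_contra h
      exact i.2 (isZero_sigma fun x => (h x.down.down).elim)
    intro a b
    exact Subtype.ext ((this a).symm.trans (this b))
  · simp

lemma fac_of_compact {κ : Cardinal.{v}} (hκ : ℵ₀ ≤ κ) {A : Set T} {t : T} (ht : t ∈ A)
    (hc : IsCompactObj T t) : Fac κ A Set.univ t := by
  intro I Y _ f
  obtain ⟨d, rfl⟩ := (hc I Y).2 f
  let _ := Classical.decEq I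
  induction d using DirectSum.induction_on with
  | zero => rw [map_zero]; exact facMap_zero _ _ _ _
  | of j g =>
    have : sigmaHom T t Y (DirectSum.of (fun j => (t ⟶ Y j)) j g) = g ≫ Sigma.ι Y j := by
      simp [sigmaHom]
    rw [this]
    exact facMap_single hκ ht j g
  | add a b ha hb => rw [map_add]; exact FacMap.add hκ ha hb

lemma isLocalizing_univ : IsLocalizing T (Set.univ : Set T) :=
  ⟨fun _ _ => trivial, fun _ _ => trivial, fun _ _ _ => trivial, fun _ _ _ _ => trivial,
    fun _ _ _ => trivial⟩

theorem fac_univ {κ : Cardinal.{v}} (hκ : ℵ₀ ≤ κ) {C : Set T} (hC : ∀ c ∈ C, IsCompactObj T c)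
    {t : T} (ht : Clo κ C t) : Fac κ C Set.univ t :=
  (Clo.fac hκ isLocalizing_univ (Set.subset_univ _)
    (fun a ha n => (fac_of_compact hκ ha (hC a ha)).shift isLocalizing_univ n) ht 0).iso
    ((shiftFunctorZero T ℤ).app t)

/-- Every object lies in some bounded closure of the generators. -/
theorem exists_clo {C : Set T} (hC : Loc T C = Set.univ) (X : T) :
    ∃ κ : Cardinal.{v}, ℵ₀ ≤ κ ∧ Clo κ C X := by
  have hloc : IsLocalizing T {X : T | ∃ κ : Cardinal.{v}, ℵ₀ ≤ κ ∧ Clo κ C X} := by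
    refine ⟨fun X hX => ⟨ℵ₀, le_rfl, .zero X hX⟩, ?_, ?_, ?_, ?_⟩
    · rintro X Y e ⟨κ, h1, h2⟩
      exact ⟨κ, h1, .iso e h2⟩
    · rintro X ⟨κ, h1, h2⟩ n
      exact ⟨κ, h1, .shift _ _ h2⟩
    · rintro Tr hTr ⟨κ, h1, h2⟩ ⟨κ', h1', h2'⟩
      exact ⟨max κ κ', h1.trans (le_max_left _ _), .cone _ _ _ hTr (h2.mono (le_max_left _ _))
        (h2'.mono (le_max_right _ _))⟩
    · intro J f hf
      choose κ h1 h2 using hf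
      have hb : ∀ j, κ j ≤ max (max ℵ₀ #J) (iSup κ) := fun j =>
        (le_ciSup bddAbove_of_small j).trans (le_max_right _ _)
      refine ⟨max (max ℵ₀ #J) (iSup κ), (le_max_left _ _).trans (le_max_left _ _),
        .coprod f (fun j => (h2 j).mono (hb j)) ?_⟩
      exact (mk_subtype_le _).trans ((le_max_right _ _).trans (le_max_left _ _))
  have : X ∈ Loc T C := by rw [hC]; trivial
  exact this _ ⟨hloc, fun c hc => ⟨ℵ₀, le_rfl, .base c hc⟩⟩

theorem exists_clo_family {C : Set T} (hC : Loc T C = Set.univ) {ι : Type v} (g : ι → T) :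
    ∃ κ : Cardinal.{v}, ℵ₀ ≤ κ ∧ ∀ i, Clo κ C (g i) := by
  choose κ h1 h2 using fun i => exists_clo hC (g i)
  exact ⟨max ℵ₀ (iSup κ), le_max_left _ _, fun j => (h2 j).mono
    ((le_ciSup bddAbove_of_small j).trans (le_max_right _ _))⟩

lemma Clo.trans {κ : Cardinal.{v}} {G C : Set T} (h : ∀ g ∈ G, Clo κ C g) {X : T}
    (hX : Clo κ G X) : Clo κ C X := by
  induction hX with
  | base X hX => exact h X hX
  | zero X hX => exact .zero X hX
  | iso e _ ih => exact .iso e ih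
  | shift X n _ ih => exact .shift X n ih
  | cone f g d h _ _ ih₁ ih₂ => exact .cone f g d h ih₁ ih₂
  | coprod f _ hκ ih => exact .coprod f ih hκ

lemma loc_isLocalizing (A : Set T) : IsLocalizing T (Loc T A) where
  zero_mem X hX S hS := hS.1.zero_mem X hX
  iso_mem e hX S hS := hS.1.iso_mem e (hX S hS)
  shift_mem X hX n S hS := hS.1.shift_mem X (hX S hS) n
  ext_mem Tr hTr h1 h2 S hS := hS.1.ext_mem Tr hTr (h1 S hS) (h2 S hS)
  coprod_mem J f hf S hS := hS.1.coprod_mem J f fun j => hf j S hS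

lemma subset_loc (A : Set T) : A ⊆ Loc T A := fun _ ha _ hS => hS.2 ha

end PartA2

end BIK
namespace BIK

section PartA3

open Cardinal
open scoped ZeroObject

variable {T : Type u'} [Category.{v} T] [HasZeroObject T] [Preadditive T] [HasShift T ℤ]
  [∀ n : ℤ, (CategoryTheory.shiftFunctor T n).Additive] [Pretriangulated T]
  [HasCoproducts.{v} T]

/-- Every map from an object in `Clo κ C` to `X` factors through an object in `Clo κ G`. -/
def FT (κ : Cardinal.{v}) (C G : Set T) (X : T) : Prop :=
  ∀ t, Clo κ C t → ∀ f : t ⟶ X, ∃ (s : T) (u : t ⟶ s) (w : s ⟶ X), Clo κ G s ∧ u ≫ w = f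

lemma FT.iso {κ : Cardinal.{v}} {C G : Set T} {X Y : T} (e : X ≅ Y) (h : FT κ C G X) :
    FT κ C G Y := by
  intro t ht f
  obtain ⟨s, u, w, hs, hf⟩ := h t ht (f ≫ e.inv)
  exact ⟨s, u, w ≫ e.hom, hs, by rw [reassoc_of% hf]; simp⟩

lemma FT.shift {κ : Cardinal.{v}} {C G : Set T} {X : T} (h : FT κ C G X) (n : ℤ) :
    FT κ C G (X⟦n⟧) := by
  intro t ht f
  let F := shiftFunctor T n
  let e : F.obj (t⟦-n⟧) ≅ t := (shiftFunctorCompIsoId T (-n) n (by simp)).app t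
  obtain ⟨f', hf'⟩ := F.map_surjective (e.hom ≫ f)
  obtain ⟨s, u, w, hs, hf⟩ := h _ (.shift t (-n) ht) f'
  refine ⟨F.obj s, e.inv ≫ F.map u, F.map w, .shift _ _ hs, ?_⟩
  rw [Category.assoc, ← F.map_comp, hf, hf']
  simp

lemma FT.cone {κ : Cardinal.{v}} {C G : Set T} (hGC : ∀ g ∈ G, Clo κ C g) {X Y Z : T} {a : X ⟶ Y}
    {b : Y ⟶ Z} {d : Z ⟶ X⟦(1 : ℤ)⟧} (h : Dist a b d) (hX : FT κ C G X) (hY : FT κ C G Y) :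
    FT κ C G Z := by
  intro t ht f
  obtain ⟨s1, u, w, hs1, e1⟩ := hX.shift 1 t ht (f ≫ d)
  obtain ⟨c, q, r, hc⟩ := Dist.exists_cone u
  have hz : u ≫ w ≫ a⟦(1 : ℤ)⟧' = 0 := by
    rw [reassoc_of% e1, h.zero31, comp_zero]
  obtain ⟨y, hy⟩ := hc.desc2 _ hz
  obtain ⟨s2, q2, l, hs2, e2⟩ := hY.shift 1 c (.cone _ _ _ hc ht (hs1.trans hGC)) y
  obtain ⟨s3, p, r3, h3⟩ := Dist.exists_fib (q ≫ q2)
  have hs3 : Clo κ G s3 :=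
    .iso ((shiftFunctorCompIsoId T (1 : ℤ) (-1) (by simp)).app s3)
      (.shift _ (-1) (.cone _ _ _ (rot_of_distTriang _ h3) hs1 hs2))
  have hrot := rot_of_distTriang _ (rot_of_distTriang _ h)
  obtain ⟨m, hm, -⟩ := complete_distinguished_triangle_morphism₁ _ _ h3 hrot w (-l) (by
    change (q ≫ q2) ≫ (-l) = w ≫ (-a⟦(1 : ℤ)⟧')
    rw [Preadditive.comp_neg, Preadditive.comp_neg, Category.assoc, e2, hy])
  change s3 ⟶ Z at m
  change p ≫ w = m ≫ d at hm
  obtain ⟨u3, hu3⟩ := h3.lift2 u (by rw [← Category.assoc, hc.zero12, zero_comp])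
  obtain ⟨y', hy'⟩ := h.lift3 (f - u3 ≫ m) (by
    rw [Preadditive.sub_comp, Category.assoc, ← hm, reassoc_of% hu3, e1, sub_self])
  obtain ⟨s4, u4, w4, hs4, e4⟩ := hY t ht y'
  refine ⟨s3 ⊞ s4, biprod.lift u3 u4, biprod.desc m (w4 ≫ b), hs3.biprod hs4, ?_⟩
  rw [biprod.lift_desc, reassoc_of% e4, hy']
  abel

lemma facMap_of_FT {κ : Cardinal.{v}} (hκ : ℵ₀ ≤ κ) {C G : Set T}
    (hC : ∀ c ∈ C, IsCompactObj T c) {t : T} (ht : Clo κ C t) {I : Type v} {Y : I → T}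
    (hY : ∀ i, FT κ C G (Y i)) (f : t ⟶ ∐ Y) : FacMap κ G f := by
  obtain ⟨s, u, w, h1, h2, h3⟩ := fac_univ hκ hC ht I Y (fun _ => trivial) f
  have : ∀ i, ∃ (s' : T) (a : s i ⟶ s') (b : s' ⟶ Y i), Clo κ G s' ∧ a ≫ b = w i ∧
      (IsZero (s i) → IsZero s') := by
    intro i
    by_cases hi : IsZero (s i)
    · exact ⟨0, 0, 0, .zero _ (isZero_zero T), hi.eq_of_src _ _, fun _ => isZero_zero T⟩
    · obtain ⟨s', a, b, hs', e⟩ := hY i _ (h1 i) (w i)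
      exact ⟨s', a, b, hs', e, fun h => (hi h).elim⟩
  choose s' a b h1' h2' h3' using this
  refine ⟨s', u ≫ Limits.Sigma.map a, b, h1', ?_, ?_⟩
  · refine le_trans (mk_le_mk_of_subset (s := {j | ¬ IsZero (s' j)})
      (t := {j | ¬ IsZero (s j)}) ?_) h2
    intro j hj hj'
    exact hj (h3' j hj')
  · rw [← h3, Category.assoc]
    congr 1
    apply Sigma.hom_ext
    intro i
    simp [← h2']

theorem FT_loc {κ : Cardinal.{v}} (hκ : ℵ₀ ≤ κ) {C G : Set T}
    (hC : ∀ c ∈ C, IsCompactObj T c) (hGC : ∀ g ∈ G, Clo κ C g) {X : T} (hX : X ∈ Loc T G) :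
    FT κ C G X := by
  have hloc : IsLocalizing T {X : T | FT κ C G X} := by
    refine ⟨fun X hX t ht f => ⟨X, f, 𝟙 X, .zero X hX, by simp⟩, fun e h => FT.iso e h,
      fun X h n => FT.shift h n, fun Tr hTr h1 h2 => FT.cone hGC hTr h1 h2, ?_⟩
    intro J f hf t ht φ
    obtain ⟨s, u, w, h1, h2, h3⟩ := facMap_of_FT hκ hC ht hf φ
    exact ⟨∐ s, u, Limits.Sigma.map w, .coprod s h1 h2, h3⟩
  exact hX _ ⟨hloc, fun g hg t ht f => ⟨g, f, 𝟙 g, .base g hg, by simp⟩⟩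

/-- The objects of `Clo κ G` are perfect with respect to `Loc G`. -/
theorem fac_loc {κ : Cardinal.{v}} (hκ : ℵ₀ ≤ κ) {C G : Set T}
    (hC : ∀ c ∈ C, IsCompactObj T c) (hGC : ∀ g ∈ G, Clo κ C g) {t : T} (ht : Clo κ G t) :
    Fac κ G (Loc T G) t := fun I Y hY f =>
  facMap_of_FT hκ hC (ht.trans hGC) (fun i => FT_loc hκ hC hGC (hY i)) f

end PartA3

end BIK
namespace BIK

section PartA4

open Cardinal
open scoped ZeroObject

variable {T : Type u'} [Category.{v} T] [HasZeroObject T] [Preadditive T] [HasShift T ℤ]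
  [∀ n : ℤ, (CategoryTheory.shiftFunctor T n).Additive] [Pretriangulated T]
  [HasCoproducts.{v} T]

/-- A chosen cone. -/
noncomputable def coneObj {X Y : T} (f : X ⟶ Y) : T := (Dist.exists_cone f).choose

lemma coneObj_spec {X Y : T} (f : X ⟶ Y) :
    ∃ (g : Y ⟶ coneObj f) (d : coneObj f ⟶ X⟦(1 : ℤ)⟧), Dist f g d :=
  (Dist.exists_cone f).choose_spec

lemma coneObj_iso {X Y Z X' Y' : T} {f : X ⟶ Y} {g : Y ⟶ Z} {d : Z ⟶ X⟦(1 : ℤ)⟧}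
    (h : Dist f g d) (eX : X ≅ X') (eY : Y ≅ Y') :
    Nonempty (Z ≅ coneObj (eX.inv ≫ f ≫ eY.hom)) := by
  obtain ⟨g', d', h'⟩ := coneObj_spec (eX.inv ≫ f ≫ eY.hom)
  exact ⟨Triangle.π₃.mapIso (isoTriangleOfIso₁₂ _ _ h h' eX eY
    (by change f ≫ eY.hom = eX.hom ≫ eX.inv ≫ f ≫ eY.hom; simp))⟩

/-- Trees used to index the stages of the closure process. -/
inductive Tre (J : Type v) : Type v
  | leaf : Tre J
  | node (f : J → Tre J) : Tre J

/-- One closure step: index type. -/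
def stepIdx (ι J : Type v) (I : Type v) (x : I → T) : Type v :=
  ι ⊕ PUnit.{v + 1} ⊕ (I × ℤ) ⊕ (Σ a b : I, x a ⟶ x b) ⊕ (Σ K : Set J, K → I)

/-- One closure step: objects. -/
noncomputable def stepObj {ι : Type v} (g : ι → T) (J : Type v) (I : Type v) (x : I → T) :
    stepIdx ι J I x → T
  | .inl i => g i
  | .inr (.inl _) => 0
  | .inr (.inr (.inl p)) => (x p.1)⟦p.2⟧
  | .inr (.inr (.inr (.inl p))) => coneObj p.2.2
  | .inr (.inr (.inr (.inr p))) => ∐ fun k => x (p.2 k)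

/-- The stages of the closure process. -/
noncomputable def stage {ι : Type v} (g : ι → T) (J : Type v) : Tre J → Σ I : Type v, I → T
  | .leaf => ⟨PEmpty, fun x => x.elim⟩
  | .node f => ⟨stepIdx ι J (Σ j, (stage g J (f j)).1) (fun p => (stage g J (f p.1)).2 p.2),
      stepObj g J _ _⟩

lemma stage_clo {ι : Type v} (g : ι → T) (J : Type v) (τ : Tre J) (i : (stage g J τ).1) :
    Clo #J (Set.range g) ((stage g J τ).2 i) := by
  induction τ with
  | leaf => exact i.elim
  | node f ih =>
    rcases i with i | i | p | p | p
    · exact .base _ ⟨i, rfl⟩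
    · exact .zero _ (isZero_zero T)
    · exact .shift _ _ (ih _ _)
    · obtain ⟨a, b, φ⟩ := p
      obtain ⟨g', d', h'⟩ := coneObj_spec φ
      exact .cone _ _ _ h' (ih _ _) (ih _ _)
    · exact .coprod _ (fun k => ih _ _) ((mk_subtype_le _).trans (mk_set_le _))

lemma sigma_supp_iso {I : Type v} (f : I → T) :
    Nonempty ((∐ fun n : {i // ¬ IsZero (f i)} => f n.1) ≅ ∐ f) := by
  classical
  refine ⟨⟨Sigma.desc fun n => Sigma.ι f n.1, Sigma.desc fun i =>
    if h : ¬ IsZero (f i) then Sigma.ι (fun n : {i // ¬ IsZero (f i)} => f n.1) ⟨i, h⟩ else 0,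
    ?_, ?_⟩⟩
  · apply Sigma.hom_ext
    rintro ⟨i, hi⟩
    simp [hi]
  · apply Sigma.hom_ext
    intro i
    by_cases hi : IsZero (f i)
    · exact hi.eq_of_src _ _
    · simp [hi]

theorem clo_small {ι : Type v} (g : ι → T) (J : Type v) (hJ : ℵ₀ ≤ #J) {X : T}
    (hX : Clo #J (Set.range g) X) :
    ∃ (τ : Tre J) (i : (stage g J τ).1), Nonempty (X ≅ (stage g J τ).2 i) := by
  have hinf : Infinite J := infinite_iff.2 hJ
  obtain ⟨j₁, j₂, hj⟩ := exists_pair_ne J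
  induction hX with
  | base X hX =>
    obtain ⟨i, rfl⟩ := hX
    exact ⟨.node fun _ => .leaf, .inl i, ⟨Iso.refl _⟩⟩
  | zero X hX =>
    exact ⟨.node fun _ => .leaf, .inr (.inl PUnit.unit), ⟨hX.iso (isZero_zero T)⟩⟩
  | iso e _ ih =>
    obtain ⟨τ, i, ⟨e'⟩⟩ := ih
    exact ⟨τ, i, ⟨e.symm ≪≫ e'⟩⟩
  | shift X n _ ih =>
    obtain ⟨τ, i, ⟨e'⟩⟩ := ih
    exact ⟨.node fun _ => τ, .inr (.inr (.inl ⟨⟨j₁, i⟩, n⟩)), ⟨(shiftFunctor T n).mapIso e'⟩⟩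
  | @cone X Y Z f g' d h _ _ ih₁ ih₂ =>
    classical
    have ih₁' : ∃ (F : J → Tre J) (i : (stage g J (F j₁)).1) (k : (stage g J (F j₂)).1),
      Nonempty (X ≅ (stage g J (F j₁)).2 i) ∧ Nonempty (Y ≅ (stage g J (F j₂)).2 k) := by
      obtain ⟨τ, i, e⟩ := ih₁
      obtain ⟨τ', i', e'⟩ := ih₂
      let F : J → Tre J := fun j => if j = j₁ then τ else τ'
      have h1 : F j₁ = τ := by simp [F]
      have h2 : F j₂ = τ' := by simp [F, hj.symm]
      refine ⟨F, ?_⟩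
      rw [h1, h2]
      exact ⟨i, i', e, e'⟩
    obtain ⟨F, i, k, ⟨e⟩, ⟨e'⟩⟩ := ih₁'
    exact ⟨.node F, .inr (.inr (.inr (.inl ⟨⟨j₁, i⟩, ⟨j₂, k⟩, e.inv ≫ f ≫ e'.hom⟩))),
      coneObj_iso h e e'⟩
  | coprod f _ hκ ih =>
    classical
    obtain ⟨φ⟩ := hκ
    choose τ i e using ih
    let F : J → Tre J := Function.extend φ (fun n => τ n.1) (fun _ => .leaf)
    have hF : ∀ n, ∃ k : (stage g J (F (φ n))).1,
        Nonempty (f n.1 ≅ (stage g J (F (φ n))).2 k) := by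
      intro n
      have : F (φ n) = τ n.1 := φ.injective.extend_apply _ _ _
      rw [this]
      exact ⟨i n.1, e n.1⟩
    choose k hk using hF
    let eK := Equiv.ofInjective φ φ.injective
    let e1 : (∐ fun x : Set.range φ =>
        (stage g J (F (φ (eK.symm x)))).2 (k (eK.symm x))) ≅
      ∐ fun n => (stage g J (F (φ n))).2 (k n) :=
        Sigma.reindex eK.symm (fun n => (stage g J (F (φ n))).2 (k n))
    let e2 : (∐ fun n : {i // ¬ IsZero (f i)} => f n.1) ≅
      ∐ fun n => (stage g J (F (φ n))).2 (k n) := Sigma.mapIso fun n => (hk n).some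
    exact ⟨.node F, .inr (.inr (.inr (.inr ⟨Set.range φ, fun x =>
      ⟨φ (eK.symm x), k (eK.symm x)⟩⟩))), ⟨(sigma_supp_iso f).some.symm ≪≫ e2 ≪≫ e1.symm⟩⟩

/-- The bounded closure of a set of objects is essentially small. -/
theorem clo_essentially_small {κ : Cardinal.{v}} (hκ : ℵ₀ ≤ κ) {ι : Type v} (g : ι → T) :
    ∃ (I : Type v) (x : I → T), (∀ i, Clo κ (Set.range g) (x i)) ∧
      ∀ X, Clo κ (Set.range g) X → ∃ i, Nonempty (X ≅ x i) := by
  obtain ⟨J, rfl⟩ : ∃ J : Type v, #J = κ := ⟨κ.out, mk_out κ⟩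
  refine ⟨Σ τ : Tre J, (stage g J τ).1, fun p => (stage g J p.1).2 p.2,
    fun p => stage_clo g J _ _, fun X hX => ?_⟩
  obtain ⟨τ, i, e⟩ := clo_small g J hκ hX
  exact ⟨⟨τ, i⟩, e⟩

end PartA4

end BIK
namespace BIK

section PartB

variable {T : Type u'} [Category.{v} T] [HasZeroObject T] [Preadditive T] [HasShift T ℤ]
  [∀ n : ℤ, (CategoryTheory.shiftFunctor T n).Additive] [Pretriangulated T]
  [HasCoproducts.{v} T]

/-- Countable coproducts. -/
noncomputable def cop (A : ℕ → T) : T := ∐ fun n : ULift.{v} ℕ => A n.down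

/-- The inclusions. -/
noncomputable def inj (A : ℕ → T) (n : ℕ) : A n ⟶ cop A :=
  Sigma.ι (fun n : ULift.{v} ℕ => A n.down) ⟨n⟩

/-- Maps out of countable coproducts. -/
noncomputable def cdesc {A : ℕ → T} {X : T} (f : ∀ n, A n ⟶ X) : cop A ⟶ X :=
  Sigma.desc fun n : ULift.{v} ℕ => f n.down

lemma inj_cdesc {A : ℕ → T} {X : T} (f : ∀ n, A n ⟶ X) (n : ℕ) : inj A n ≫ cdesc f = f n := by
  exact Sigma.ι_desc (fun n : ULift.{v} ℕ => f n.down) ⟨n⟩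

lemma inj_cdesc_assoc {A : ℕ → T} {X : T} (f : ∀ n, A n ⟶ X) (n : ℕ) {Z : T} (h : X ⟶ Z) :
    inj A n ≫ cdesc f ≫ h = f n ≫ h := by
  rw [← Category.assoc, inj_cdesc]

attribute [simp] inj_cdesc inj_cdesc_assoc

lemma cop_ext {A : ℕ → T} {X : T} {f g : cop A ⟶ X} (h : ∀ n, inj A n ≫ f = inj A n ≫ g) :
    f = g := Sigma.hom_ext _ _ fun n => h n.down

/-- Maps between countable coproducts. -/
noncomputable def cmap {A B : ℕ → T} (f : ∀ n, A n ⟶ B n) : cop A ⟶ cop B :=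
  cdesc fun n => f n ≫ inj B n

lemma inj_cmap {A B : ℕ → T} (f : ∀ n, A n ⟶ B n) (n : ℕ) :
    inj A n ≫ cmap f = f n ≫ inj B n := by
  simp [cmap]

lemma inj_cmap_assoc {A B : ℕ → T} (f : ∀ n, A n ⟶ B n) (n : ℕ) {Z : T} (h : cop B ⟶ Z) :
    inj A n ≫ cmap f ≫ h = f n ≫ inj B n ≫ h := by
  rw [← Category.assoc, inj_cmap, Category.assoc]

attribute [simp] inj_cmap inj_cmap_assoc

lemma cmap_eq {A B : ℕ → T} (f : ∀ n, A n ⟶ B n) :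
    cmap f = Limits.Sigma.map fun n : ULift.{v} ℕ => f n.down := by
  apply cop_ext
  intro n
  rw [inj_cmap]
  exact (Sigma.ι_map (fun n : ULift.{v} ℕ => f n.down) ⟨n⟩).symm

/-- The shift map of a sequence. -/
noncomputable def sh {A : ℕ → T} (i : ∀ n, A n ⟶ A (n + 1)) : cop A ⟶ cop A :=
  cdesc fun n => i n ≫ inj A (n + 1)

lemma inj_sh {A : ℕ → T} (i : ∀ n, A n ⟶ A (n + 1)) (n : ℕ) :
    inj A n ≫ sh i = i n ≫ inj A (n + 1) := by
  simp [sh]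

lemma inj_sh_assoc {A : ℕ → T} (i : ∀ n, A n ⟶ A (n + 1)) (n : ℕ) {Z : T} (h : cop A ⟶ Z) :
    inj A n ≫ sh i ≫ h = i n ≫ inj A (n + 1) ≫ h := by
  rw [← Category.assoc, inj_sh, Category.assoc]

attribute [simp] inj_sh inj_sh_assoc

/-- The contraction for the constant sequence. -/
noncomputable def contr (Z : T) : cop (fun _ => Z) ⟶ cop (fun _ => Z) :=
  cdesc fun n => - ∑ k ∈ Finset.range n, inj (fun _ => Z) k

lemma inj_contr (Z : T) (n : ℕ) :
    inj (fun _ => Z) n ≫ contr Z = - ∑ k ∈ Finset.range n, inj (fun _ => Z) k := by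
  simp [contr]

lemma inj_contr_assoc (Z : T) (n : ℕ) {W : T} (h : cop (fun _ => Z) ⟶ W) :
    inj (fun _ => Z) n ≫ contr Z ≫ h = (- ∑ k ∈ Finset.range n, inj (fun _ => Z) k) ≫ h := by
  rw [← Category.assoc, inj_contr]

lemma one_sub_sh_contr (Z : T) :
    (𝟙 _ - sh (fun _ => 𝟙 Z)) ≫ contr Z = 𝟙 (cop fun _ => Z) := by
  apply cop_ext
  intro n
  rw [Preadditive.sub_comp, Preadditive.comp_sub, inj_sh_assoc (A := fun _ => Z)]
  simp only [Category.id_comp, inj_contr, Finset.sum_range_succ, Category.comp_id]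
  abel

lemma contr_one_sub_sh (Z : T) :
    contr Z ≫ (𝟙 _ - sh (fun _ => 𝟙 Z)) + cdesc (fun _ => 𝟙 Z) ≫ inj (fun _ => Z) 0 =
      𝟙 (cop fun _ => Z) := by
  apply cop_ext
  intro n
  rw [Preadditive.comp_add, inj_contr_assoc, inj_cdesc_assoc (A := fun _ => Z)]
  simp only [Category.id_comp, Category.comp_id]
  have h : ∀ n : ℕ, (∑ k ∈ Finset.range n, inj (fun _ => Z) k) ≫ (𝟙 _ - sh (fun _ => 𝟙 Z)) =
      inj (fun _ => Z) 0 - inj (fun _ => Z) n := by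
    intro n
    induction n with
    | zero => simp
    | succ n ih =>
      rw [Finset.sum_range_succ, Preadditive.add_comp, ih, Preadditive.comp_sub,
        inj_sh (A := fun _ => Z)]
      simp
  rw [Preadditive.neg_comp, h]
  abel

/-- The hypotheses on the perfect class `P` inside of `S`. -/
structure Perf (S : Set T) (P : T → Prop) : Prop where
  loc : IsLocalizing T S
  shift : ∀ s, P s → ∀ n : ℤ, P (s⟦n⟧)
  mem : ∀ s, P s → s ∈ S
  fac : ∀ s, P s → ∀ (I : Type v) (Y : I → T), (∀ i, Y i ∈ S) → ∀ f : s ⟶ ∐ Y,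
    ∃ (s' : I → T) (u : s ⟶ ∐ s') (w : ∀ i, s' i ⟶ Y i), (∀ i, P (s' i)) ∧
      u ≫ Limits.Sigma.map w = f
  small : ∃ (I : Type v) (x : I → T), (∀ i, P (x i)) ∧ ∀ X, P X → ∃ i, Nonempty (X ≅ x i)

variable {S : Set T} {P : T → Prop}

lemma Perf.cfac (hP : Perf S P) {s : T} (hs : P s) {Y : ℕ → T} (hY : ∀ n, Y n ∈ S)
    (f : s ⟶ cop Y) : ∃ (s' : ℕ → T) (u : s ⟶ cop s') (w : ∀ n, s' n ⟶ Y n), (∀ n, P (s' n)) ∧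
      u ≫ cmap w = f := by
  obtain ⟨s', u, w, h1, h2⟩ := hP.fac s hs (ULift.{v} ℕ) (fun n => Y n.down)
    (fun n => hY n.down) f
  refine ⟨fun n => s' ⟨n⟩, u, fun n => w ⟨n⟩, fun n => h1 _, ?_⟩
  rw [cmap_eq]
  exact h2

lemma Perf.cop_mem (hP : Perf S P) {A : ℕ → T} (hA : ∀ n, A n ∈ S) : cop A ∈ S :=
  hP.loc.coprod_mem _ _ fun n => hA n.down

lemma cop_exact {A B C : ℕ → T} {f : ∀ i, A i ⟶ B i} {g : ∀ i, B i ⟶ C i}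
    {d : ∀ i, C i ⟶ (A i)⟦(1 : ℤ)⟧} (h : ∀ i, Dist (f i) (g i) (d i))
    {t : T} (φ : t ⟶ cop B) (hφ : φ ≫ cmap g = 0) :
    ∃ ψ : t ⟶ cop A, ψ ≫ cmap f = φ := by
  rw [cmap_eq] at hφ
  obtain ⟨ψ, hψ⟩ := sigma_exact (fun i : ULift.{v} ℕ => h i.down) φ hφ
  refine ⟨ψ, ?_⟩
  rw [cmap_eq]
  exact hψ

/-- The tower attached to an object `X`. -/
structure Tower (S : Set T) (P : T → Prop) (X : T) where
  A : ℕ → T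
  p : ∀ n, A n ⟶ X
  i : ∀ n, A n ⟶ A (n + 1)
  mem : ∀ n, A n ∈ S
  comp : ∀ n, i n ≫ p (n + 1) = p n
  kill : ∀ n (s : T), P s → ∀ f : s ⟶ A n, f ≫ p n = 0 → f ≫ i n = 0
  surj : ∀ s : T, P s → ∀ f : s ⟶ X, ∃ g : s ⟶ A 0, g ≫ p 0 = f

lemma Perf.tower_zero (hP : Perf S P) (X : T) : ∃ (A : T) (p : A ⟶ X), A ∈ S ∧
    ∀ s : T, P s → ∀ f : s ⟶ X, ∃ g : s ⟶ A, g ≫ p = f := by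
  obtain ⟨I, x, hx, hx'⟩ := hP.small
  refine ⟨∐ fun q : (Σ i, (x i ⟶ X)) => x q.1, Sigma.desc fun q => q.2,
    hP.loc.coprod_mem _ _ fun q => hP.mem _ (hx _), ?_⟩
  intro s hs f
  obtain ⟨i, ⟨e⟩⟩ := hx' s hs
  exact ⟨e.hom ≫ Sigma.ι (fun q : (Σ i, (x i ⟶ X)) => x q.1) ⟨i, e.inv ≫ f⟩, by simp⟩

lemma Perf.tower_succ (hP : Perf S P) {X A : T} (p : A ⟶ X) (hA : A ∈ S) :
    ∃ (A' : T) (p' : A' ⟶ X) (i : A ⟶ A'), A' ∈ S ∧ i ≫ p' = p ∧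
      ∀ s : T, P s → ∀ f : s ⟶ A, f ≫ p = 0 → f ≫ i = 0 := by
  obtain ⟨I, x, hx, hx'⟩ := hP.small
  let W : (Σ i, {f : x i ⟶ A // f ≫ p = 0}) → T := fun q => x q.1
  let w : ∐ W ⟶ A := Sigma.desc fun q => q.2.1
  obtain ⟨A', i, d, h⟩ := Dist.exists_cone w
  obtain ⟨p', hp'⟩ := h.desc2 p (by
    apply Sigma.hom_ext
    intro q
    simpa [w] using q.2.2)
  refine ⟨A', p', i, hP.loc.ext_mem _ h (hP.loc.coprod_mem _ _ fun q => hP.mem _ (hx _)) hA,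
    hp', ?_⟩
  intro s hs f hf
  obtain ⟨k, ⟨e⟩⟩ := hx' s hs
  have : f = (e.hom ≫ Sigma.ι W ⟨k, e.inv ≫ f, by rw [Category.assoc, hf, comp_zero]⟩) ≫ w := by
    simp [w]
  rw [this, Category.assoc, h.zero12, comp_zero]

lemma Perf.exists_tower (hP : Perf S P) (X : T) : Nonempty (Tower S P X) := by
  obtain ⟨A₀, p₀, hA₀, h₀⟩ := hP.tower_zero X
  let St := {q : (Σ A : T, A ⟶ X) // q.1 ∈ S}
  have hstep : ∀ q : St, ∃ (q' : St) (i : q.1.1 ⟶ q'.1.1), i ≫ q'.1.2 = q.1.2 ∧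
      ∀ s : T, P s → ∀ f : s ⟶ q.1.1, f ≫ q.1.2 = 0 → f ≫ i = 0 := by
    rintro ⟨⟨A, p⟩, hA⟩
    obtain ⟨A', p', i, h1, h2, h3⟩ := hP.tower_succ p hA
    exact ⟨⟨⟨A', p'⟩, h1⟩, i, h2, h3⟩
  choose nx i h1 h2 using hstep
  let q : ℕ → St := fun n => Nat.rec ⟨⟨A₀, p₀⟩, hA₀⟩ (fun _ q => nx q) n
  exact ⟨⟨fun n => (q n).1.1, fun n => (q n).1.2, fun n => i (q n), fun n => (q n).2,
    fun n => h1 (q n), fun n => h2 (q n), h₀⟩⟩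

namespace Tower

variable {X : T} (t : Tower S P X)

/-- The composite `A 0 ⟶ A n`. -/
noncomputable def j : ∀ n, t.A 0 ⟶ t.A n
  | 0 => 𝟙 _
  | n + 1 => j n ≫ t.i n

/-- The composite `A 1 ⟶ A (n + 1)`. -/
noncomputable def j' : ∀ n, t.A 1 ⟶ t.A (n + 1)
  | 0 => 𝟙 _
  | n + 1 => j' n ≫ t.i (n + 1)

lemma i_j' (n : ℕ) : t.i 0 ≫ t.j' n = t.j (n + 1) := by
  induction n with
  | zero => simp [j, j']
  | succ n ih => rw [j', reassoc_of% ih]; rfl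

lemma j_p (n : ℕ) : t.j n ≫ t.p n = t.p 0 := by
  induction n with
  | zero => simp [j]
  | succ n ih => rw [j, Category.assoc, t.comp, ih]

lemma j_sh : cmap t.j ≫ sh t.i = sh (fun _ => 𝟙 (t.A 0)) ≫ cmap t.j := by
  apply cop_ext
  intro n
  rw [inj_cmap_assoc, inj_sh, inj_sh_assoc (A := fun _ => t.A 0), inj_cmap]
  simp [j]

lemma key (hP : Perf S P) {s : T} (hs : P s) (a : s ⟶ cop t.A) :
    ∃ c : s ⟶ cop (fun _ => t.A 0), a ≫ sh t.i = c ≫ cmap t.j ≫ sh t.i ∧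
      a ≫ cdesc t.p = c ≫ cdesc (fun _ => 𝟙 (t.A 0)) ≫ t.p 0 := by
  obtain ⟨s', b, q, hs', rfl⟩ := hP.cfac hs t.mem a
  choose ρ hρ using fun n => t.surj _ (hs' n) (q n ≫ t.p n)
  refine ⟨b ≫ cmap ρ, ?_, ?_⟩
  · rw [Category.assoc, Category.assoc]
    congr 1
    apply cop_ext
    intro n
    have h := t.kill n _ (hs' n) (q n - ρ n ≫ t.j n) (by
      rw [Preadditive.sub_comp, Category.assoc, j_p, hρ, sub_self])
    rw [Preadditive.sub_comp, sub_eq_zero, Category.assoc] at h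
    rw [inj_cmap_assoc, inj_cmap_assoc, inj_cmap_assoc, inj_sh, reassoc_of% h]
  · rw [Category.assoc, Category.assoc]
    congr 1
    apply cop_ext
    intro n
    rw [inj_cmap_assoc, inj_cmap_assoc, inj_cdesc, inj_cdesc_assoc (A := fun _ => t.A 0)]
    simp [hρ]

lemma exact_seq (hP : Perf S P) {s : T} (hs : P s) (a : s ⟶ cop t.A) (ha : a ≫ cdesc t.p = 0) :
    ∃ b : s ⟶ cop t.A, b ≫ (𝟙 _ - sh t.i) = a := by
  obtain ⟨c, h1, h2⟩ := t.key hP hs a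
  let m := c ≫ cdesc (fun _ => 𝟙 (t.A 0))
  have hm : m ≫ t.i 0 = 0 := t.kill 0 s hs m (by rw [Category.assoc, ← h2, ha])
  have hc := c ≫= contr_one_sub_sh (t.A 0)
  have hj : (𝟙 _ - sh (fun _ => 𝟙 (t.A 0))) ≫ cmap t.j = cmap t.j ≫ (𝟙 _ - sh t.i) := by
    rw [Preadditive.sub_comp, Preadditive.comp_sub, j_sh]
    simp
  have h0 : inj (fun _ => t.A 0) 0 ≫ cmap t.j = inj t.A 0 := by
    rw [inj_cmap]
    simp [j]
  have hm' : (m ≫ inj t.A 0) ≫ (𝟙 _ - sh t.i) = m ≫ inj t.A 0 := by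
    rw [Preadditive.comp_sub, Category.assoc m _ (sh t.i), inj_sh, reassoc_of% hm]
    simp
  have hcj : c ≫ cmap t.j = (c ≫ contr _ ≫ cmap t.j) ≫ (𝟙 _ - sh t.i) +
      (m ≫ inj t.A 0) ≫ (𝟙 _ - sh t.i) := by
    rw [hm', Category.assoc, Category.assoc, ← hj]
    have := hc =≫ cmap t.j
    simp only [Preadditive.comp_add, Preadditive.add_comp, Category.assoc, Category.comp_id,
      h0] at this
    rw [← this]
    simp [m]
  have h3 : a = a ≫ (𝟙 _ - sh t.i) + (c ≫ cmap t.j - (c ≫ cmap t.j) ≫ (𝟙 _ - sh t.i)) := by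
    rw [Preadditive.comp_sub, Preadditive.comp_sub, h1]
    simp
  refine ⟨a + (c ≫ contr _ ≫ cmap t.j + m ≫ inj t.A 0 - c ≫ cmap t.j), ?_⟩
  rw [Preadditive.add_comp, Preadditive.sub_comp, Preadditive.add_comp, ← hcj, ← h3]

lemma injective (hP : Perf S P) {s : T} (hs : P s) (a : s ⟶ cop t.A)
    (ha : a ≫ (𝟙 _ - sh t.i) = 0) : a = 0 := by
  obtain ⟨c, h1, -⟩ := t.key hP hs a
  have ha' : a = a ≫ sh t.i := by
    rw [Preadditive.comp_sub, sub_eq_zero] at ha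
    simpa using ha
  let σ₀ := sh (A := fun _ => t.A 0) (fun _ => 𝟙 (t.A 0))
  let e := c ≫ σ₀
  have hae : a = e ≫ cmap t.j := by
    rw [ha', h1, j_sh, Category.assoc]
  have hd : (e ≫ (𝟙 _ - σ₀)) ≫ cmap t.j = 0 := by
    rw [Category.assoc, Preadditive.sub_comp, ← j_sh, Category.id_comp, Preadditive.comp_sub,
      ← Category.assoc, ← hae, ← ha', sub_self]
  choose F k d hF using fun n => Dist.exists_fib (t.j n)
  obtain ⟨ψ, hψ⟩ := cop_exact hF _ hd
  obtain ⟨s', b, q, hs', hb⟩ := hP.cfac hs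
    (fun n => hP.loc.fib_mem (hF n) (t.mem 0) (t.mem n)) ψ
  let j₁ : cop (fun _ => t.A 0) ⟶ cop (fun _ => t.A 1) := cmap fun _ => t.i 0
  have hkill : (e ≫ (𝟙 _ - σ₀)) ≫ j₁ = 0 := by
    rw [← hψ, ← hb, Category.assoc, Category.assoc]
    have : cmap q ≫ cmap k ≫ j₁ = 0 := by
      apply cop_ext
      intro n
      have h := t.kill 0 _ (hs' n) (q n ≫ k n) (by
        rw [← t.j_p n, Category.assoc, reassoc_of% (hF n).zero12, zero_comp, comp_zero])
      rw [Category.assoc] at h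
      rw [inj_cmap_assoc, inj_cmap_assoc, inj_cmap (A := fun _ => t.A 0), reassoc_of% h]
      simp
    rw [this, comp_zero]
  have hcomm : (𝟙 _ - σ₀) ≫ j₁ = j₁ ≫ (𝟙 _ - sh (fun _ => 𝟙 (t.A 1))) := by
    rw [Preadditive.sub_comp, Preadditive.comp_sub, Category.id_comp, Category.comp_id]
    congr 1
    apply cop_ext
    intro n
    simp only [σ₀, j₁]
    rw [inj_sh_assoc (A := fun _ => t.A 0), inj_cmap_assoc (A := fun _ => t.A 0),
      inj_sh (A := fun _ => t.A 1), inj_cmap (A := fun _ => t.A 0)]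
    simp
  have hej : e ≫ j₁ = 0 := by
    have := hkill =≫ contr (t.A 1)
    rwa [Category.assoc e, hcomm, Category.assoc e, Category.assoc j₁, one_sub_sh_contr,
      Category.comp_id, zero_comp] at this
  have hfac : cmap t.j ≫ sh t.i = j₁ ≫ cdesc fun n => t.j' n ≫ inj t.A (n + 1) := by
    apply cop_ext
    intro n
    simp only [j₁]
    rw [inj_cmap_assoc, inj_sh, inj_cmap_assoc (A := fun _ => t.A 0),
      inj_cdesc (A := fun _ => t.A 1), reassoc_of% (t.i_j' n), j, Category.assoc]
  rw [ha', hae, Category.assoc, hfac, reassoc_of% hej, zero_comp]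

end Tower

lemma Perf.shift_inj (hP : Perf S P) {A B : T} (f : A ⟶ B)
    (h : ∀ s, P s → ∀ a : s ⟶ A, a ≫ f = 0 → a = 0) {s : T} (hs : P s)
    (a : s ⟶ A⟦(1 : ℤ)⟧) (ha : a ≫ f⟦(1 : ℤ)⟧' = 0) : a = 0 := by
  let F := shiftFunctor T (1 : ℤ)
  let e : F.obj (s⟦(-1 : ℤ)⟧) ≅ s := (shiftFunctorCompIsoId T (-1 : ℤ) 1 (by simp)).app s
  obtain ⟨b, hb⟩ := F.map_surjective (e.hom ≫ a)
  have : b = 0 := h _ (hP.shift _ hs _) b (F.map_injective (by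
    rw [F.map_comp, hb, Category.assoc]
    change e.hom ≫ a ≫ f⟦(1 : ℤ)⟧' = _
    rw [ha, comp_zero, F.map_zero]))
  rw [this, F.map_zero] at hb
  rw [← cancel_epi e.hom, ← hb, comp_zero]

theorem Perf.exists_triangle (hP : Perf S P) (X : T) :
    ∃ (A B : T) (f : A ⟶ X) (g : X ⟶ B) (d : B ⟶ A⟦(1 : ℤ)⟧),
      Dist f g d ∧ A ∈ S ∧ ∀ s, P s → ∀ φ : s ⟶ B, φ = 0 := by
  obtain ⟨t⟩ := hP.exists_tower X
  obtain ⟨Γ, g, d, h⟩ := Dist.exists_cone (𝟙 _ - sh t.i)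
  have hΓ : Γ ∈ S := hP.loc.ext_mem _ h (hP.cop_mem t.mem) (hP.cop_mem t.mem)
  obtain ⟨π, hπ⟩ := h.desc2 (cdesc t.p) (by
    apply cop_ext
    intro n
    rw [Preadditive.sub_comp, Preadditive.comp_sub, inj_sh_assoc]
    simp [t.comp])
  have hsurj : ∀ s, P s → ∀ f : s ⟶ X, ∃ f' : s ⟶ Γ, f' ≫ π = f := by
    intro s hs f
    obtain ⟨f', hf'⟩ := t.surj s hs f
    exact ⟨f' ≫ inj t.A 0 ≫ g, by simp [hπ, hf']⟩
  have hinj : ∀ s, P s → ∀ f : s ⟶ Γ, f ≫ π = 0 → f = 0 := by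
    intro s hs f hf
    have h0 : f ≫ d = 0 := hP.shift_inj _ (fun s hs a ha => t.injective hP hs a ha) hs (f ≫ d)
      (by rw [Category.assoc, h.zero31, comp_zero])
    obtain ⟨a, ha⟩ := h.lift3 f h0
    obtain ⟨b, hb⟩ := t.exact_seq hP hs a (by rw [← hπ, reassoc_of% ha, hf])
    rw [← ha, ← hb, Category.assoc, h.zero12, comp_zero]
  obtain ⟨L, g', d', h'⟩ := Dist.exists_cone π
  refine ⟨Γ, L, π, g', d', h', hΓ, ?_⟩
  intro s hs φ
  have h0 : φ ≫ d' = 0 := hP.shift_inj π hinj hs (φ ≫ d')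
    (by rw [Category.assoc, h'.zero31, comp_zero])
  obtain ⟨a, ha⟩ := h'.lift3 φ h0
  obtain ⟨b, hb⟩ := hsurj s hs a
  rw [← ha, ← hb, Category.assoc, h'.zero12, comp_zero]

lemma orth_isLocalizing (L : T) :
    IsLocalizing T {Y : T | ∀ (n : ℤ) (f : Y⟦n⟧ ⟶ L), f = 0} := by
  have hiso : ∀ {X Y : T}, (X ≅ Y) → (∀ f : X ⟶ L, f = 0) → ∀ f : Y ⟶ L, f = 0 := by
    intro X Y e h f
    rw [← cancel_epi e.hom, h (e.hom ≫ f), comp_zero]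
  refine ⟨?_, ?_, ?_, ?_, ?_⟩
  · intro X hX n f
    exact ((isZero_shift_iff X n).2 hX).eq_of_src _ _
  · intro X Y e h n
    exact hiso ((shiftFunctor T n).mapIso e) (h n)
  · intro X h m n
    exact hiso ((shiftFunctorAdd T m n).app X) (h (m + n))
  · intro Tr hTr h1 h2 n f
    have hd : Dist _ _ _ := Triangle.shift_distinguished _ hTr n
    obtain ⟨ψ, hψ⟩ := hd.desc3 f (h2 n _)
    rw [← hψ, hiso ((shiftFunctorAdd T n 1).app _) (h1 (n + 1)) ψ, comp_zero]
  · intro J f h n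
    refine hiso (shift_sigma_iso f n).some ?_
    intro φ
    apply Sigma.hom_ext
    intro j
    rw [h j n (_ ≫ φ), comp_zero]

end PartB

end BIK
open BIK in
/-- Lemma: a localizing subcategory generated by a set of objects is the kernel of a
localization functor. -/
theorem statement_13
    {T : Type u'} [Category.{v} T] [HasZeroObject T] [Preadditive T] [HasShift T ℤ]
    [∀ n : ℤ, (CategoryTheory.shiftFunctor T n).Additive] [Pretriangulated T]
    [HasCoproducts.{v} T]
    (hgen : CompactlyGen T)
    (S : Set T) (hS : IsLocalizing T S)
    (hset : ∃ (ι : Type v) (g : ι → T), S = Loc T (Set.range g)) :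
    ∃ (L : T ⥤ T) (ηL : 𝟭 T ⟶ L)
      (eL : ∀ X : T, L.obj (X⟦(1 : ℤ)⟧) ≅ (L.obj X)⟦(1 : ℤ)⟧),
      (∀ Tr ∈ distTriang T,
        Triangle.mk (L.map Tr.mor₁) (L.map Tr.mor₂) (L.map Tr.mor₃ ≫ (eL Tr.obj₁).hom)
          ∈ distTriang T) ∧
      (∀ X : T, IsIso (L.map (ηL.app X))) ∧
      (∀ X : T, L.map (ηL.app X) = ηL.app (L.obj X)) ∧
      {X : T | Limits.IsZero (L.obj X)} = S := by
  obtain ⟨ι, g, rfl⟩ := hset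
  obtain ⟨ι', c, hc, hgenc⟩ := hgen
  refine exists_localization_of_triangles _ hS ?_
  obtain ⟨κ, hκ, hg⟩ := exists_clo_family hgenc g
  have hC : ∀ x ∈ Set.range c, IsCompactObj T x := by
    rintro _ ⟨i, rfl⟩
    exact hc i
  have hGC : ∀ x ∈ Set.range g, Clo κ (Set.range c) x := by
    rintro _ ⟨i, rfl⟩
    exact hg i
  have hP : Perf (Loc T (Set.range g)) (Clo κ (Set.range g)) :=
    { loc := hS
      shift := fun s hs n => .shift s n hs
      mem := fun s hs => hs.mem hS (subset_loc _)
      fac := fun s hs I Y hY f => by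
        obtain ⟨s', u, w, h1, -, h3⟩ := fac_loc hκ hC hGC hs I Y hY f
        exact ⟨s', u, w, h1, h3⟩
      small := clo_essentially_small hκ g }
  intro X
  obtain ⟨A, B, f, p, d, h, hA, hB⟩ := hP.exists_triangle X
  refine ⟨A, B, f, p, d, h, hA, ?_⟩
  intro Y hY φ
  have hY' := hY _ ⟨orth_isLocalizing B, fun x hx n f => hB _ (.shift _ _ (.base x hx)) f⟩
  have h0 := hY' 0 ((shiftFunctorZero T ℤ).hom.app Y ≫ φ)
  rwa [← cancel_epi ((shiftFunctorZero T ℤ).hom.app Y), comp_zero]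
end
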